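/- Let n ≥ 3, k ≥ 1, α ∈ (0,1) and 0 < ν < n−2. Then there exists δ > 0 such that for every function τ ∈ C^{k,α}_{−ν/2−1}(ℝⁿ) with ‖τ‖_{k,α,−ν/2−1} < δ, there exist ψ ∈ C^{k+2,α}_{−ν}(ℝⁿ) and a vector field W ∈ C^{k+1,α}_{−ν/2}(ℝⁿ,ℝⁿ) such that φ := 1 + ψ is everywhere positive and the triple (φ, W, τ) solves the flat-background conformally formulated vacuum constraint system on ℝⁿ. Moreover there exists ε > 0 such that (ψ, W) is the unique pair with ‖ψ‖_{k+2,α,−ν} + ‖W‖_{k+1,α,−ν/2} < ε for which (1+ψ, W, τ) solves the system. In particular, the vacuum Einstein constraint equations admit an asymptotically Euclidean solution with any prescribed mean curvature function τ of sufficiently small weighted norm. -/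

import Mathlib

noncomputable section

open scoped BigOperators
open Filter MeasureTheory

/-- Euclidean space ℝⁿ. -/
abbrev Euc (n : ℕ) := EuclideanSpace ℝ (Fin n)

/-- Partial derivative ∂_j f of a scalar function. -/
def pder (n : ℕ) (f : Euc n → ℝ) (j : Fin n) (x : Euc n) : ℝ :=
  fderiv ℝ f x (EuclideanSpace.single j 1)

/-- The divergence Σ_k ∂_k X_k of a vector field. -/
def divg (n : ℕ) (X : Euc n → Euc n) (x : Euc n) : ℝ :=
  ∑ k, pder n (fun y => X y k) k x

/-- The flat conformal Killing operator:
`(𝒟X)_{jk} = ½(∂_j X_k + ∂_k X_j) − (1/n)(div X)δ_{jk}`. -/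
def confKill (n : ℕ) (X : Euc n → Euc n) (x : Euc n) (j k : Fin n) : ℝ :=
  (1/2) * (pder n (fun y => X y k) j x + pder n (fun y => X y j) k x)
    - (1/(n:ℝ)) * divg n X x * (if j = k then 1 else 0)

/-- The flat vector Laplacian `(LX)_j = −Σ_k ∂_k((𝒟X)_{jk})`. -/
def vLap (n : ℕ) (X : Euc n → Euc n) (x : Euc n) (j : Fin n) : ℝ :=
  - ∑ k, pder n (fun y => confKill n X y j k) k x

/-- The Euclidean Laplacian Δf = Σ_i ∂_i∂_i f. -/
def lap (n : ℕ) (f : Euc n → ℝ) (x : Euc n) : ℝ :=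
  ∑ i, pder n (fun y => pder n f i y) i x

/-- `WBound n k α ν C u` : the weighted Hölder norm of `u` in `C^{k,α}_{−ν}(ℝⁿ)`
is bounded by `C`; i.e. `u` is `C^k`, `(1+|x|)^{ν+|β|}|∂^β u(x)| ≤ C` for `|β| ≤ k`
(expressed via iterated Fréchet derivatives), the weighted Hölder seminorm on dyadic
annuli of the top derivatives is bounded by `C`, and so is the Hölder seminorm
of the top derivatives on the unit ball. -/
def WBound (n : ℕ) {F : Type*} [NormedAddCommGroup F] [NormedSpace ℝ F]
    (k : ℕ) (α ν C : ℝ) (u : Euc n → F) : Prop :=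
  ContDiff ℝ k u
  ∧ (∀ i : ℕ, i ≤ k → ∀ x : Euc n,
      (1 + ‖x‖) ^ (ν + i) * ‖iteratedFDeriv ℝ i u x‖ ≤ C)
  ∧ (∀ R : ℝ, 1 ≤ R → ∀ x y : Euc n,
      R ≤ ‖x‖ → ‖x‖ ≤ 2*R → R ≤ ‖y‖ → ‖y‖ ≤ 2*R → x ≠ y →
      (1 + R) ^ (ν + k + α) * ‖iteratedFDeriv ℝ k u x - iteratedFDeriv ℝ k u y‖
        ≤ C * ‖x - y‖ ^ α)
  ∧ (∀ x y : Euc n, ‖x‖ ≤ 1 → ‖y‖ ≤ 1 → x ≠ y →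
      ‖iteratedFDeriv ℝ k u x - iteratedFDeriv ℝ k u y‖ ≤ C * ‖x - y‖ ^ α)

/-- Membership in the weighted Hölder space `C^{k,α}_{−ν}(ℝⁿ)`. -/
def MemW (n : ℕ) {F : Type*} [NormedAddCommGroup F] [NormedSpace ℝ F]
    (k : ℕ) (α ν : ℝ) (u : Euc n → F) : Prop :=
  ∃ C : ℝ, WBound n k α ν C u

/-- The flat-background conformally formulated vacuum constraint system on ℝⁿ:
(i) `Δφ + ((n−2)/(4(n−1)))|𝒟W|² φ^{(−3n+2)/(n−2)} − ((n−2)/(4n)) τ² φ^{(n+2)/(n−2)} = 0`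
(ii) `LW + ((n−1)/n) φ^{2n/(n−2)} ∇τ = 0`. -/
def VacuumSystem (n : ℕ) (φ : Euc n → ℝ) (W : Euc n → Euc n) (τ : Euc n → ℝ) : Prop :=
  (∀ x : Euc n,
    lap n φ x
      + (((n:ℝ)-2)/(4*((n:ℝ)-1))) * (∑ j, ∑ k, (confKill n W x j k)^2)
          * (φ x) ^ ((-3*(n:ℝ)+2)/((n:ℝ)-2))
      - (((n:ℝ)-2)/(4*(n:ℝ))) * (τ x)^2 * (φ x) ^ (((n:ℝ)+2)/((n:ℝ)-2)) = 0)
  ∧ (∀ x : Euc n, ∀ j : Fin n,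
    vLap n W x j
      + (((n:ℝ)-1)/(n:ℝ)) * (φ x) ^ ((2*(n:ℝ))/((n:ℝ)-2)) * pder n τ j x = 0)

section

/-! ### Weighted Hölder bounds for scalar functions, in terms of partial derivatives -/

/-- Weighted Hölder bound of order zero, in the global form valid for nonnegative weights. -/
def HolderBound (n : ℕ) (α ν C : ℝ) (u : Euc n → ℝ) : Prop :=
  (∀ x, |u x| ≤ C * (1 + ‖x‖) ^ (-ν)) ∧
  ∀ x y, ‖x‖ ≤ ‖y‖ → |u x - u y| ≤ C * (1 + ‖x‖) ^ (-(ν + α)) * ‖x - y‖ ^ α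

/-- Weighted Hölder bound of order `k`, phrased through iterated partial derivatives. -/
def PartialBound (n : ℕ) (α : ℝ) : ℕ → ℝ → ℝ → (Euc n → ℝ) → Prop
  | 0, ν, C, u => HolderBound n α ν C u
  | k + 1, ν, C, u => Differentiable ℝ u ∧ (∀ x, |u x| ≤ C * (1 + ‖x‖) ^ (-ν)) ∧
      ∀ i, PartialBound n α k (ν + 1) C (pder n u i)

variable {n : ℕ} {α ν C : ℝ} {u v : Euc n → ℝ}

lemma one_add_norm_pos (x : Euc n) : 0 < 1 + ‖x‖ := by positivity

lemma rpow_neg_anti {a b p : ℝ} (ha : 0 < a) (hab : a ≤ b) (hp : 0 ≤ p) :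
    b ^ (-p) ≤ a ^ (-p) :=
  Real.rpow_le_rpow_of_nonpos ha hab (by linarith)

lemma rpow_neg_half {a b p : ℝ} (ha : 0 < a) (hab : a / 2 ≤ b) (hp : 0 ≤ p) :
    b ^ (-p) ≤ 2 ^ p * a ^ (-p) := by
  refine (rpow_neg_anti (by positivity) hab hp).trans (le_of_eq ?_)
  rw [Real.div_rpow ha.le (by norm_num), Real.rpow_neg (by norm_num : (0:ℝ) ≤ 2)]
  field_simp

lemma abs_le_mul_rpow_neg {C a p t : ℝ} (ha : 0 < a) (h : a ^ p * t ≤ C) :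
    t ≤ C * a ^ (-p) := by
  rw [Real.rpow_neg ha.le, ← div_eq_mul_inv, le_div_iff₀ (by positivity)]
  linarith

lemma mul_rpow_le_of_le {C a p t : ℝ} (ha : 0 < a) (h : t ≤ C * a ^ (-p)) :
    a ^ p * t ≤ C := by
  rw [Real.rpow_neg ha.le, ← div_eq_mul_inv, le_div_iff₀ (by positivity)] at h
  linarith

lemma nonneg_of_weighted_bound (h : ∀ x, |u x| ≤ C * (1 + ‖x‖) ^ (-ν)) : 0 ≤ C := by
  simpa using (abs_nonneg _).trans (h 0)

lemma norm_single_one (i : Fin n) : ‖(EuclideanSpace.single i (1:ℝ) : Euc n)‖ = 1 := by simp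

lemma fderiv_eq_sum (u : Euc n → ℝ) (x : Euc n) :
    fderiv ℝ u x = ∑ i, pder n u i x • (EuclideanSpace.proj i : Euc n →L[ℝ] ℝ) := by
  ext y
  have hy : y = ∑ i, y i • (EuclideanSpace.single i (1:ℝ) : Euc n) := by
    ext j
    simp [Finset.sum_apply, Pi.single_apply]
  conv_lhs => rw [hy]
  simp [pder, mul_comm]

lemma norm_proj_le (i : Fin n) : ‖(EuclideanSpace.proj i : Euc n →L[ℝ] ℝ)‖ ≤ 1 :=
  ContinuousLinearMap.opNorm_le_bound _ zero_le_one fun y => by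
    simpa using PiLp.norm_apply_le y i

lemma norm_sum_smul_proj_le {a : Fin n → ℝ} {B : ℝ} (h : ∀ i, |a i| ≤ B) :
    ‖∑ i, a i • (EuclideanSpace.proj i : Euc n →L[ℝ] ℝ)‖ ≤ n * B := by
  refine (norm_sum_le _ _).trans ?_
  calc _ ≤ ∑ _i : Fin n, B := Finset.sum_le_sum fun i _ => by
        rw [norm_smul, Real.norm_eq_abs]
        calc _ ≤ |a i| * 1 := mul_le_mul_of_nonneg_left (norm_proj_le i) (abs_nonneg _)
          _ ≤ B := by simpa using h i
    _ = n * B := by simp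

lemma HasFDerivAt.pder_eq {a : Fin n → ℝ} {x : Euc n}
    (h : HasFDerivAt u (∑ i, a i • (EuclideanSpace.proj i : Euc n →L[ℝ] ℝ)) x) (j : Fin n) :
    pder n u j x = a j := by
  rw [pder, h.fderiv]
  simp

lemma HolderBound.continuous (hα : 0 < α) (h : HolderBound n α ν C u) : Continuous u := by
  rw [continuous_iff_continuousAt]
  intro x
  have hC := nonneg_of_weighted_bound h.1
  have h1 : Tendsto (fun y : Euc n => C * max ((1 + ‖x‖) ^ (-(ν + α))) ((1 + ‖y‖) ^ (-(ν + α)))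
      * ‖x - y‖ ^ α) (nhds x) (nhds 0) := by
    have : ContinuousAt (fun y : Euc n => C * max ((1 + ‖x‖) ^ (-(ν + α)))
        ((1 + ‖y‖) ^ (-(ν + α))) * ‖x - y‖ ^ α) x := by
      refine ContinuousAt.mul (ContinuousAt.mul continuousAt_const
        (continuousAt_const.max ?_)) ?_
      · exact ContinuousAt.rpow_const (by fun_prop) (Or.inl (one_add_norm_pos x).ne')
      · exact ContinuousAt.rpow_const (by fun_prop) (Or.inr hα.le)
    have h2 := this.tendsto
    simpa [Real.zero_rpow hα.ne'] using h2
  rw [ContinuousAt, tendsto_iff_norm_sub_tendsto_zero]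
  refine squeeze_zero (fun _ => norm_nonneg _) (fun y => ?_) h1
  rcases le_total ‖x‖ ‖y‖ with hxy | hxy
  · rw [norm_sub_rev]
    refine (h.2 x y hxy).trans ?_
    gcongr
    exact le_max_left _ _
  · refine (h.2 y x hxy).trans ?_
    rw [norm_sub_rev]
    gcongr
    exact le_max_right _ _

/-- Near a point the Hölder bound holds with the weight of that point. -/
lemma HolderBound.near (hα : 0 < α) (hν : 0 ≤ ν) (h : HolderBound n α ν C u) {x y : Euc n}
    (hxy : ‖x - y‖ ≤ (1 + ‖x‖) / 2) :
    |u x - u y| ≤ 2 ^ (ν + α) * C * (1 + ‖x‖) ^ (-(ν + α)) * ‖x - y‖ ^ α := by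
  have hC := nonneg_of_weighted_bound h.1
  have hp : (0:ℝ) ≤ ν + α := by linarith
  have h2 : (1:ℝ) ≤ 2 ^ (ν + α) := Real.one_le_rpow (by norm_num) hp
  rcases le_total ‖x‖ ‖y‖ with hl | hl
  · refine (h.2 x y hl).trans ?_
    gcongr
    nlinarith
  · rw [abs_sub_comm]
    refine (h.2 y x hl).trans ?_
    rw [norm_sub_rev]
    have h3 : (1 + ‖x‖) / 2 ≤ 1 + ‖y‖ := by
      have := norm_sub_norm_le x y
      linarith
    have := rpow_neg_half (one_add_norm_pos x) h3 hp
    calc _ ≤ C * (2 ^ (ν + α) * (1 + ‖x‖) ^ (-(ν + α))) * ‖x - y‖ ^ α := by gcongr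
      _ = _ := by ring

/-- A weighted sup bound together with a Hölder bound at nearby points gives `HolderBound`. -/
lemma HolderBound.of_near (hα : 0 < α) (hν : 0 ≤ ν) {q : ℝ} (hq : 1 ≤ q)
    (h0 : ∀ x, |u x| ≤ C * (1 + ‖x‖) ^ (-ν))
    (h1 : ∀ x y, ‖x - y‖ ≤ (1 + ‖x‖) / q →
      |u x - u y| ≤ C * (1 + ‖x‖) ^ (-(ν + α)) * ‖x - y‖ ^ α) :
    HolderBound n α ν (2 * q ^ α * C) u := by
  have hC := nonneg_of_weighted_bound h0
  have h2 : (1:ℝ) ≤ q ^ α := Real.one_le_rpow hq hα.le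
  have hCC : C ≤ 2 * q ^ α * C := by nlinarith
  refine ⟨fun x => (h0 x).trans (by gcongr), fun x y hxy => ?_⟩
  rcases le_total ‖x - y‖ ((1 + ‖x‖) / q) with hl | hl
  · exact (h1 x y hl).trans (by gcongr)
  · have hx := one_add_norm_pos x
    have e1 : |u x - u y| ≤ 2 * C * (1 + ‖x‖) ^ (-ν) := by
      have a1 := h0 x
      have a2 := h0 y
      have a3 : (1 + ‖y‖) ^ (-ν) ≤ (1 + ‖x‖) ^ (-ν) :=
        rpow_neg_anti hx (by linarith) hν
      have a4 : C * (1 + ‖y‖) ^ (-ν) ≤ C * (1 + ‖x‖) ^ (-ν) := by gcongr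
      have := abs_sub (u x) (u y)
      linarith
    refine e1.trans ?_
    have e2 : ((1 + ‖x‖) / q) ^ α ≤ ‖x - y‖ ^ α :=
      Real.rpow_le_rpow (by positivity) hl hα.le
    rw [Real.div_rpow hx.le (by linarith), div_le_iff₀ (by positivity)] at e2
    have e3 : (1 + ‖x‖) ^ (-ν) = (1 + ‖x‖) ^ (-(ν + α)) * (1 + ‖x‖) ^ α := by
      rw [← Real.rpow_add hx]; congr 1; ring
    rw [e3]
    calc _ ≤ 2 * C * ((1 + ‖x‖) ^ (-(ν + α)) * (‖x - y‖ ^ α * q ^ α)) := by gcongr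
      _ = _ := by ring

/-- A weighted `C¹` bound implies a weighted Hölder bound. -/
lemma HolderBound.of_deriv (hα : 0 < α) (hα1 : α ≤ 1) (hν : 0 ≤ ν) (hu : Differentiable ℝ u)
    (h0 : ∀ x, |u x| ≤ C * (1 + ‖x‖) ^ (-ν))
    (h1 : ∀ i x, |pder n u i x| ≤ C * (1 + ‖x‖) ^ (-(ν + 1))) :
    HolderBound n α ν (2 * 2 ^ α * ((n * 2 ^ (ν + 1) + 1) * C)) u := by
  have hC := nonneg_of_weighted_bound h0
  refine HolderBound.of_near hα hν (by norm_num) (fun x => (h0 x).trans ?_) fun x y hxy => ?_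
  · have : C ≤ (n * 2 ^ (ν + 1) + 1) * C := by
      have : (0:ℝ) ≤ n * 2 ^ (ν + 1) * C := by positivity
      linarith
    gcongr
  have hx := one_add_norm_pos x
  set B := n * (C * (2 ^ (ν + 1) * (1 + ‖x‖) ^ (-(ν + 1)))) with hB
  have key : ‖u y - u x‖ ≤ B * ‖y - x‖ := by
    refine (convex_closedBall x ((1 + ‖x‖) / 2)).norm_image_sub_le_of_norm_hasFDerivWithin_le
      (f' := fun z => fderiv ℝ u z) (fun z _ => (hu z).hasFDerivAt.hasFDerivWithinAt)
      (fun z hz => ?_) (Metric.mem_closedBall_self (by positivity))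
      (by rwa [mem_closedBall_iff_norm, norm_sub_rev])
    rw [fderiv_eq_sum]
    refine norm_sum_smul_proj_le fun i => (h1 i z).trans ?_
    gcongr
    refine rpow_neg_half hx ?_ (by linarith)
    rw [mem_closedBall_iff_norm, norm_sub_rev] at hz
    have := norm_sub_norm_le x z
    linarith
  rw [abs_sub_comm, ← Real.norm_eq_abs]
  refine key.trans ?_
  rw [norm_sub_rev]
  rcases eq_or_ne x y with rfl | hne
  · simp [Real.zero_rpow hα.ne']
  have hr : 0 < ‖x - y‖ := norm_pos_iff.2 (sub_ne_zero.2 hne)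
  have e1 : ‖x - y‖ ≤ (1 + ‖x‖) ^ (1 - α) * ‖x - y‖ ^ α := by
    calc ‖x - y‖ = ‖x - y‖ ^ (1 - α) * ‖x - y‖ ^ α := by
          rw [← Real.rpow_add hr]; simp
      _ ≤ _ := by
          gcongr ?_ * _
          exact Real.rpow_le_rpow hr.le (by linarith) (by linarith)
  have e2 : (1 + ‖x‖) ^ (-(ν + 1)) * (1 + ‖x‖) ^ (1 - α) = (1 + ‖x‖) ^ (-(ν + α)) := by
    rw [← Real.rpow_add hx]; congr 1; ring
  calc B * ‖x - y‖ ≤ B * ((1 + ‖x‖) ^ (1 - α) * ‖x - y‖ ^ α) := by gcongr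
    _ = (n * 2 ^ (ν + 1)) * C * ((1 + ‖x‖) ^ (-(ν + 1)) * (1 + ‖x‖) ^ (1 - α)) * ‖x - y‖ ^ α := by
        rw [hB]; ring
    _ ≤ _ := by
        rw [e2]
        gcongr
        linarith

end

section

variable {n : ℕ} {α ν C : ℝ} {u v : Euc n → ℝ}

lemma pder_add (hu : Differentiable ℝ u) (hv : Differentiable ℝ v) (i : Fin n) :
    pder n (fun x => u x + v x) i = fun x => pder n u i x + pder n v i x := by
  funext x
  simp [pder, fderiv_fun_add (hu x) (hv x)]

lemma pder_const_mul (hu : Differentiable ℝ u) (a : ℝ) (i : Fin n) :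
    pder n (fun x => a * u x) i = fun x => a * pder n u i x := by
  funext x
  simp [pder, fderiv_const_mul (hu x)]

lemma pder_mul (hu : Differentiable ℝ u) (hv : Differentiable ℝ v) (i : Fin n) :
    pder n (fun x => u x * v x) i = fun x => u x * pder n v i x + v x * pder n u i x := by
  funext x
  simp [pder, fderiv_fun_mul (hu x) (hv x)]

lemma pder_sum {ι : Type*} (s : Finset ι) (f : ι → Euc n → ℝ)
    (hf : ∀ j ∈ s, Differentiable ℝ (f j)) (i : Fin n) :
    pder n (fun x => ∑ j ∈ s, f j x) i = fun x => ∑ j ∈ s, pder n (f j) i x := by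
  funext x
  simp [pder, fderiv_fun_sum fun j hj => (hf j hj) x]

lemma HolderBound.mono {C' : ℝ} (h : HolderBound n α ν C u) (hC : C ≤ C') :
    HolderBound n α ν C' u :=
  ⟨fun x => (h.1 x).trans (by gcongr), fun x y hxy => (h.2 x y hxy).trans (by gcongr)⟩

namespace PartialBound

lemma bound : ∀ {k : ℕ} {ν : ℝ}, PartialBound n α k ν C u →
    ∀ x, |u x| ≤ C * (1 + ‖x‖) ^ (-ν)
  | 0, _, h => h.1
  | _ + 1, _, h => h.2.1

lemma nonneg {k : ℕ} (h : PartialBound n α k ν C u) : 0 ≤ C := nonneg_of_weighted_bound h.bound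

lemma mono {C' : ℝ} (hC : C ≤ C') : ∀ {k : ℕ} {ν : ℝ} {u : Euc n → ℝ},
    PartialBound n α k ν C u → PartialBound n α k ν C' u
  | 0, _, _, h => HolderBound.mono h hC
  | _ + 1, _, _, h => ⟨h.1, fun x => (h.2.1 x).trans (by gcongr), fun i => mono hC (h.2.2 i)⟩

lemma pder_bound {k : ℕ} (h : PartialBound n α (k + 1) ν C u) (i : Fin n) :
    PartialBound n α k (ν + 1) C (pder n u i) := h.2.2 i

lemma weaken : ∀ {k : ℕ} {ν ν' : ℝ} {u : Euc n → ℝ}, ν' ≤ ν →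
    PartialBound n α k ν C u → PartialBound n α k ν' C u
  | 0, ν, ν', u, hν, h => by
      have hC := h.nonneg
      have key : ∀ (x : Euc n) {a b : ℝ}, a ≤ b → (1 + ‖x‖) ^ a ≤ (1 + ‖x‖) ^ b := fun x a b hab =>
        Real.rpow_le_rpow_of_exponent_le (by simp) hab
      refine ⟨fun x => (h.1 x).trans ?_, fun x y hxy => (h.2 x y hxy).trans ?_⟩
      · have := key x (neg_le_neg hν)
        gcongr
      · have := key x (neg_le_neg (add_le_add_left hν α))
        gcongr
  | k + 1, ν, ν', u, hν, h => by
      have hC := h.nonneg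
      refine ⟨h.1, fun x => (h.2.1 x).trans ?_, fun i => weaken (by linarith) (h.2.2 i)⟩
      have : (1 + ‖x‖) ^ (-ν) ≤ (1 + ‖x‖) ^ (-ν') :=
        Real.rpow_le_rpow_of_exponent_le (by simp) (neg_le_neg hν)
      gcongr

lemma add {C' : ℝ} : ∀ {k : ℕ} {ν : ℝ} {u v : Euc n → ℝ}, PartialBound n α k ν C u →
    PartialBound n α k ν C' v → PartialBound n α k ν (C + C') (fun x => u x + v x)
  | 0, ν, u, v, hu, hv => by
      refine ⟨fun x => ?_, fun x y hxy => ?_⟩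
      · rw [add_mul]
        exact (abs_add_le _ _).trans (add_le_add (hu.1 x) (hv.1 x))
      · rw [add_mul, add_mul, show u x + v x - (u y + v y) = (u x - u y) + (v x - v y) by ring]
        exact (abs_add_le _ _).trans (add_le_add (hu.2 x y hxy) (hv.2 x y hxy))
  | k + 1, ν, u, v, hu, hv => by
      refine ⟨hu.1.add hv.1, fun x => ?_, fun i => ?_⟩
      · rw [add_mul]
        exact (abs_add_le _ _).trans (add_le_add (hu.2.1 x) (hv.2.1 x))
      · rw [pder_add hu.1 hv.1]
        exact add (hu.2.2 i) (hv.2.2 i)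

lemma const_mul (a : ℝ) : ∀ {k : ℕ} {ν : ℝ} {u : Euc n → ℝ}, PartialBound n α k ν C u →
    PartialBound n α k ν (|a| * C) (fun x => a * u x)
  | 0, ν, u, hu => by
      refine ⟨fun x => ?_, fun x y hxy => ?_⟩
      · rw [abs_mul, mul_assoc]
        exact mul_le_mul_of_nonneg_left (hu.1 x) (abs_nonneg a)
      · rw [← mul_sub, abs_mul, mul_assoc, mul_assoc, ← mul_assoc C]
        exact mul_le_mul_of_nonneg_left (hu.2 x y hxy) (abs_nonneg a)
  | k + 1, ν, u, hu => by
      refine ⟨hu.1.const_mul a, fun x => ?_, fun i => ?_⟩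
      · rw [abs_mul, mul_assoc]
        exact mul_le_mul_of_nonneg_left (hu.2.1 x) (abs_nonneg a)
      · rw [pder_const_mul hu.1]
        exact const_mul a (hu.2.2 i)

lemma sub {C' : ℝ} {k : ℕ} (hu : PartialBound n α k ν C u) (hv : PartialBound n α k ν C' v) :
    PartialBound n α k ν (C + C') (fun x => u x - v x) := by
  have := hu.add (hv.const_mul (-1))
  simpa [sub_eq_add_neg] using this

lemma zero (n : ℕ) (α : ℝ) : ∀ (k : ℕ) (ν : ℝ), PartialBound n α k ν 0 (fun _ => 0)
  | 0, ν => ⟨by simp, by simp⟩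
  | k + 1, ν => by
      refine ⟨differentiable_const 0, by simp, fun i => ?_⟩
      have : pder n (fun _ => (0:ℝ)) i = fun _ => 0 := by
        funext x
        simp [pder]
      rw [this]
      exact zero n α k (ν + 1)

lemma sum {ι : Type*} {k : ℕ} (s : Finset ι) {f : ι → Euc n → ℝ} {D : ι → ℝ}
    (hf : ∀ j ∈ s, PartialBound n α k ν (D j) (f j)) :
    PartialBound n α k ν (∑ j ∈ s, D j) (fun x => ∑ j ∈ s, f j x) := by
  classical
  induction s using Finset.induction_on with
  | empty => simpa using zero n α k ν
  | insert a s ha ih =>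
    simp only [Finset.sum_insert ha]
    exact (hf a (by simp)).add (ih fun j hj => hf j (Finset.mem_insert_of_mem hj))

lemma succ_le (hα : 0 < α) (hα1 : α ≤ 1) : ∀ (k : ℕ) {ν : ℝ}, 0 ≤ ν → ∃ c, 1 ≤ c ∧
    ∀ (u : Euc n → ℝ) (C : ℝ), PartialBound n α (k + 1) ν C u → PartialBound n α k ν (c * C) u
  | 0, ν, hν => by
      refine ⟨max 1 (2 * 2 ^ α * (n * 2 ^ (ν + 1) + 1)), le_max_left _ _, fun u C h => ?_⟩
      have := HolderBound.of_deriv hα hα1 hν h.1 h.2.1 fun i x => (h.2.2 i).1 x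
      refine HolderBound.mono this ?_
      rw [← mul_assoc]
      exact mul_le_mul_of_nonneg_right (le_max_right _ _) h.nonneg
  | k + 1, ν, hν => by
      obtain ⟨c, hc, H⟩ := succ_le hα hα1 k (ν := ν + 1) (by linarith)
      refine ⟨c, hc, fun u C h => ⟨h.1, fun x => (h.2.1 x).trans ?_, fun i => H _ _ (h.2.2 i)⟩⟩
      have := h.nonneg
      gcongr
      nlinarith

lemma level_le (hα : 0 < α) (hα1 : α ≤ 1) {j k : ℕ} (hjk : j ≤ k) {ν : ℝ} (hν : 0 ≤ ν) :
    ∃ c, 1 ≤ c ∧ ∀ (u : Euc n → ℝ) (C : ℝ), PartialBound n α k ν C u →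
      PartialBound n α j ν (c * C) u := by
  induction hjk with
  | refl => exact ⟨1, le_rfl, fun u C h => by simpa using h⟩
  | step h ih =>
    obtain ⟨c, hc, H⟩ := ih
    obtain ⟨c', hc', H'⟩ := succ_le (n := n) hα hα1 _ hν
    refine ⟨c * c', by nlinarith, fun u C h => ?_⟩
    rw [mul_assoc]
    exact H _ _ (H' _ _ h)

lemma continuous (hα : 0 < α) : ∀ {k : ℕ} {ν : ℝ}, PartialBound n α k ν C u → Continuous u
  | 0, _, h => HolderBound.continuous hα h
  | _ + 1, _, h => h.1.continuous

lemma mul (hα : 0 < α) (hα1 : α ≤ 1) : ∀ (k : ℕ) {μ₁ μ₂ : ℝ}, 0 ≤ μ₁ → 0 ≤ μ₂ →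
    ∃ c, 1 ≤ c ∧ ∀ (u v : Euc n → ℝ) (C₁ C₂ : ℝ), PartialBound n α k μ₁ C₁ u →
      PartialBound n α k μ₂ C₂ v →
      PartialBound n α k (μ₁ + μ₂) (c * (C₁ * C₂)) (fun x => u x * v x)
  | 0, μ₁, μ₂, h₁, h₂ => by
      refine ⟨2, by norm_num, fun u v C₁ C₂ hu hv => ?_⟩
      have hC₁ := hu.nonneg
      have hC₂ := hv.nonneg
      refine ⟨fun x => ?_, fun x y hxy => ?_⟩
      · have hx := one_add_norm_pos x
        rw [abs_mul, show -(μ₁ + μ₂) = -μ₁ + -μ₂ by ring, Real.rpow_add hx]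
        have := mul_le_mul (hu.1 x) (hv.1 x) (abs_nonneg _) (by positivity)
        refine this.trans ?_
        have : 0 ≤ C₁ * (1 + ‖x‖) ^ (-μ₁) * (C₂ * (1 + ‖x‖) ^ (-μ₂)) := by positivity
        linarith
      · have hx := one_add_norm_pos x
        have e1 : (1 + ‖x‖) ^ (-(μ₁ + μ₂ + α)) = (1 + ‖x‖) ^ (-(μ₁ + α)) * (1 + ‖x‖) ^ (-μ₂) := by
          rw [← Real.rpow_add hx]; congr 1; ring
        have e2 : (1 + ‖x‖) ^ (-(μ₁ + μ₂ + α)) = (1 + ‖x‖) ^ (-μ₁) * (1 + ‖x‖) ^ (-(μ₂ + α)) := by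
          rw [← Real.rpow_add hx]; congr 1; ring
        have a1 : |(u x - u y) * v x| ≤
            C₁ * (1 + ‖x‖) ^ (-(μ₁ + α)) * ‖x - y‖ ^ α * (C₂ * (1 + ‖x‖) ^ (-μ₂)) := by
          rw [abs_mul]
          exact mul_le_mul (hu.2 x y hxy) (hv.1 x) (abs_nonneg _) (by positivity)
        have a0 : |u y| ≤ C₁ * (1 + ‖x‖) ^ (-μ₁) := by
          refine (hu.1 y).trans ?_
          have := rpow_neg_anti hx (show 1 + ‖x‖ ≤ 1 + ‖y‖ by linarith) h₁
          gcongr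
        have a2 : |u y * (v x - v y)| ≤
            C₁ * (1 + ‖x‖) ^ (-μ₁) * (C₂ * (1 + ‖x‖) ^ (-(μ₂ + α)) * ‖x - y‖ ^ α) := by
          rw [abs_mul]
          exact mul_le_mul a0 (hv.2 x y hxy) (abs_nonneg _) (by positivity)
        calc |u x * v x - u y * v y| = |(u x - u y) * v x + u y * (v x - v y)| := by ring_nf
          _ ≤ _ := (abs_add_le _ _).trans (add_le_add a1 a2)
          _ = C₁ * C₂ * ((1 + ‖x‖) ^ (-(μ₁ + α)) * (1 + ‖x‖) ^ (-μ₂)) * ‖x - y‖ ^ α +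
              C₁ * C₂ * ((1 + ‖x‖) ^ (-μ₁) * (1 + ‖x‖) ^ (-(μ₂ + α))) * ‖x - y‖ ^ α := by ring
          _ = _ := by rw [← e1, ← e2]; ring
  | k + 1, μ₁, μ₂, h₁, h₂ => by
      obtain ⟨c₁, hc₁, H₁⟩ := succ_le (n := n) hα hα1 k h₁
      obtain ⟨c₂, hc₂, H₂⟩ := succ_le (n := n) hα hα1 k h₂
      obtain ⟨d₁, hd₁, M₁⟩ := mul hα hα1 k (μ₁ := μ₁) (μ₂ := μ₂ + 1) h₁ (by linarith)
      obtain ⟨d₂, hd₂, M₂⟩ := mul hα hα1 k (μ₁ := μ₂) (μ₂ := μ₁ + 1) h₂ (by linarith)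
      refine ⟨d₁ * c₁ + d₂ * c₂, by nlinarith, fun u v C₁ C₂ hu hv => ?_⟩
      have hC₁ := hu.nonneg
      have hC₂ := hv.nonneg
      refine ⟨hu.1.mul hv.1, fun x => ?_, fun i => ?_⟩
      · have hx := one_add_norm_pos x
        rw [abs_mul, show -(μ₁ + μ₂) = -μ₁ + -μ₂ by ring, Real.rpow_add hx]
        have := mul_le_mul (hu.2.1 x) (hv.2.1 x) (abs_nonneg _) (by positivity)
        refine this.trans ?_
        have h3 : 0 ≤ C₁ * (1 + ‖x‖) ^ (-μ₁) * (C₂ * (1 + ‖x‖) ^ (-μ₂)) := by positivity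
        have h4 : 1 ≤ d₁ * c₁ + d₂ * c₂ := by nlinarith
        nlinarith
      · rw [pder_mul hu.1 hv.1]
        have a1 := M₁ _ _ _ _ (H₁ _ _ hu) (hv.2.2 i)
        have a2 := M₂ _ _ _ _ (H₂ _ _ hv) (hu.2.2 i)
        rw [show μ₁ + (μ₂ + 1) = μ₁ + μ₂ + 1 by ring] at a1
        rw [show μ₂ + (μ₁ + 1) = μ₁ + μ₂ + 1 by ring] at a2
        refine (a1.add a2).mono (le_of_eq ?_)
        ring

end PartialBound

end

section

variable {n : ℕ} {α ν C : ℝ} {u v : Euc n → ℝ}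

/-! ### Powers of `1 + ψ` -/

lemma rpow_le_two_rpow_abs {s : ℝ} (hs : 1 / 2 ≤ s) (hs' : s ≤ 3 / 2) (b : ℝ) :
    s ^ b ≤ 2 ^ |b| := by
  have h0 : 0 < s := by linarith
  rcases le_total 0 b with hb | hb
  · rw [abs_of_nonneg hb]
    exact Real.rpow_le_rpow h0.le (by linarith) hb
  · rw [abs_of_nonpos hb]
    calc s ^ b ≤ (1 / 2) ^ b := Real.rpow_le_rpow_of_nonpos (by norm_num) hs hb
      _ = 2 ^ (-b) := by rw [one_div, Real.inv_rpow (by norm_num), Real.rpow_neg (by norm_num)]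

lemma hasDerivAt_one_add_rpow {t : ℝ} (ht : |t| ≤ 1 / 2) (a : ℝ) :
    HasDerivAt (fun t => (1 + t) ^ a) (a * (1 + t) ^ (a - 1)) t := by
  have h1 : 1 + t ≠ 0 := by linarith [(abs_le.1 ht).1]
  have := ((hasDerivAt_id t).const_add 1).rpow_const (p := a) (Or.inl h1)
  simpa using this

lemma abs_one_add_rpow_le {t : ℝ} (ht : |t| ≤ 1 / 2) (a : ℝ) :
    |(1 + t) ^ a| ≤ 2 ^ |a| := by
  have h := abs_le.1 ht
  rw [abs_of_nonneg (Real.rpow_nonneg (by linarith) a)]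
  exact rpow_le_two_rpow_abs (by linarith) (by linarith) a

lemma abs_one_add_rpow_sub_le {s t : ℝ} (hs : |s| ≤ 1 / 2) (ht : |t| ≤ 1 / 2) (a : ℝ) :
    |(1 + s) ^ a - (1 + t) ^ a| ≤ |a| * 2 ^ |a - 1| * |s - t| := by
  have := (convex_Icc (-(1 / 2) : ℝ) (1 / 2)).norm_image_sub_le_of_norm_hasDerivWithin_le
    (f := fun t => (1 + t) ^ a) (f' := fun t => a * (1 + t) ^ (a - 1))
    (C := |a| * 2 ^ |a - 1|) (x := t) (y := s)
    (fun x hx => (hasDerivAt_one_add_rpow (abs_le.2 hx) a).hasDerivWithinAt)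
    (fun x hx => by
      rw [norm_mul, Real.norm_eq_abs]
      exact mul_le_mul_of_nonneg_left (abs_one_add_rpow_le (abs_le.2 hx) _) (abs_nonneg a))
    (abs_le.1 ht) (abs_le.1 hs)
  simpa using this

lemma abs_convex_comb_le {s t θ : ℝ} (hs : |s| ≤ 1 / 2) (ht : |t| ≤ 1 / 2)
    (hθ : θ ∈ Set.Icc (0:ℝ) 1) : |t + θ * (s - t)| ≤ 1 / 2 := by
  rw [abs_le] at *
  obtain ⟨h0, h1⟩ := hθ
  constructor <;> nlinarith

/-- Second difference estimate for the power function. -/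
lemma abs_one_add_rpow_diff_diff_le {s t s' t' : ℝ} (hs : |s| ≤ 1 / 2) (ht : |t| ≤ 1 / 2)
    (hs' : |s'| ≤ 1 / 2) (ht' : |t'| ≤ 1 / 2) (a : ℝ) :
    |(1 + s) ^ a - (1 + t) ^ a - ((1 + s') ^ a - (1 + t') ^ a)| ≤
      |a| * 2 ^ |a - 1| * |(s - t) - (s' - t')| +
      |a| * (|a - 1| * 2 ^ |a - 1 - 1|) * (|s - s'| + |t - t'|) * |s' - t'| := by
  set φ : ℝ → ℝ := fun θ => (1 + (t + θ * (s - t))) ^ a - (1 + (t' + θ * (s' - t'))) ^ a with hφ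
  have hd : ∀ θ ∈ Set.Icc (0:ℝ) 1, HasDerivWithinAt φ
      (a * (1 + (t + θ * (s - t))) ^ (a - 1) * (s - t) -
        a * (1 + (t' + θ * (s' - t'))) ^ (a - 1) * (s' - t')) (Set.Icc 0 1) θ := fun θ hθ => by
    have l1 : HasDerivAt (fun θ => t + θ * (s - t)) (s - t) θ := by
      simpa using ((hasDerivAt_id θ).mul_const (s - t)).const_add t
    have l2 : HasDerivAt (fun θ => t' + θ * (s' - t')) (s' - t') θ := by
      simpa using ((hasDerivAt_id θ).mul_const (s' - t')).const_add t'
    have m1 := (hasDerivAt_one_add_rpow (abs_convex_comb_le hs ht hθ) a).comp θ l1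
    have m2 := (hasDerivAt_one_add_rpow (abs_convex_comb_le hs' ht' hθ) a).comp θ l2
    exact (m1.sub m2).hasDerivWithinAt
  have := (convex_Icc (0:ℝ) 1).norm_image_sub_le_of_norm_hasDerivWithin_le
    (C := |a| * 2 ^ |a - 1| * |(s - t) - (s' - t')| +
      |a| * (|a - 1| * 2 ^ |a - 1 - 1|) * (|s - s'| + |t - t'|) * |s' - t'|)
    (x := 0) (y := 1) hd (fun θ hθ => ?_) (by simp) (by simp)
  · have e : φ 1 - φ 0 = (1 + s) ^ a - (1 + t) ^ a - ((1 + s') ^ a - (1 + t') ^ a) := by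
      simp only [hφ]
      ring_nf
    rw [e] at this
    simpa using this
  · set P := (1 + (t + θ * (s - t))) ^ (a - 1) with hP
    set Q := (1 + (t' + θ * (s' - t'))) ^ (a - 1) with hQ
    have b1 : |P| ≤ 2 ^ |a - 1| := abs_one_add_rpow_le (abs_convex_comb_le hs ht hθ) _
    have b2 : |P - Q| ≤ |a - 1| * 2 ^ |a - 1 - 1| * (|s - s'| + |t - t'|) := by
      refine (abs_one_add_rpow_sub_le (abs_convex_comb_le hs ht hθ)
        (abs_convex_comb_le hs' ht' hθ) _).trans ?_
      gcongr
      calc |t + θ * (s - t) - (t' + θ * (s' - t'))| = |θ * (s - s') + (1 - θ) * (t - t')| := by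
            ring_nf
        _ ≤ |θ * (s - s')| + |(1 - θ) * (t - t')| := abs_add_le _ _
        _ ≤ _ := by
            rw [abs_mul, abs_mul, abs_of_nonneg hθ.1,
              abs_of_nonneg (show 0 ≤ 1 - θ by linarith [hθ.2])]
            have := abs_nonneg (s - s')
            have := abs_nonneg (t - t')
            nlinarith [hθ.1, hθ.2]
    have e : a * P * (s - t) - a * Q * (s' - t') =
        a * P * ((s - t) - (s' - t')) + a * (P - Q) * (s' - t') := by ring
    rw [e]
    refine (norm_add_le _ _).trans ?_
    simp only [norm_mul, Real.norm_eq_abs]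
    rw [mul_assoc |a| (|a - 1| * _)]
    gcongr

lemma HolderBound.one_add_rpow_sub (hν : 0 ≤ ν) (a : ℝ) :
    ∃ c, 1 ≤ c ∧ ∀ (ψ₁ ψ₂ : Euc n → ℝ) (D : ℝ), HolderBound n α ν (1 / 2) ψ₁ →
      HolderBound n α ν (1 / 2) ψ₂ → HolderBound n α ν D (fun x => ψ₁ x - ψ₂ x) →
      HolderBound n α ν (c * D) (fun x => (1 + ψ₁ x) ^ a - (1 + ψ₂ x) ^ a) := by
  set L := |a| * 2 ^ |a - 1| with hL
  set M := |a| * (|a - 1| * 2 ^ |a - 1 - 1|) with hM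
  have hL0 : 0 ≤ L := by positivity
  have hM0 : 0 ≤ M := by positivity
  have hle : ∀ x : Euc n, (1 + ‖x‖) ^ (-ν) ≤ 1 := fun x =>
    Real.rpow_le_one_of_one_le_of_nonpos (by simp) (by linarith)
  refine ⟨1 + L + M, by linarith, fun ψ₁ ψ₂ D h₁ h₂ hD => ?_⟩
  have hD0 := nonneg_of_weighted_bound hD.1
  have s₁ : ∀ x, |ψ₁ x| ≤ 1 / 2 := fun x => (h₁.1 x).trans (by linarith [hle x])
  have s₂ : ∀ x, |ψ₂ x| ≤ 1 / 2 := fun x => (h₂.1 x).trans (by linarith [hle x])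
  refine ⟨fun x => ?_, fun x y hxy => ?_⟩
  · refine (abs_one_add_rpow_sub_le (s₁ x) (s₂ x) a).trans ?_
    calc L * |ψ₁ x - ψ₂ x| ≤ L * (D * (1 + ‖x‖) ^ (-ν)) := by gcongr; exact hD.1 x
      _ = L * D * (1 + ‖x‖) ^ (-ν) := by ring
      _ ≤ _ := by gcongr; linarith
  · refine (abs_one_add_rpow_diff_diff_le (s₁ x) (s₂ x) (s₁ y) (s₂ y) a).trans ?_
    have hx := one_add_norm_pos x
    have d : |ψ₁ y - ψ₂ y| ≤ D := (hD.1 y).trans (by nlinarith [hle y])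
    set T := (1 + ‖x‖) ^ (-(ν + α)) * ‖x - y‖ ^ α with hT
    have hT0 : 0 ≤ T := by positivity
    have b0 := hD.2 x y hxy
    have b1 := h₁.2 x y hxy
    have b2 := h₂.2 x y hxy
    rw [mul_assoc, ← hT] at b0 b1 b2
    have b3 : |ψ₁ x - ψ₁ y| + |ψ₂ x - ψ₂ y| ≤ T := by linarith
    calc _ ≤ L * (D * T) + M * T * D := by
          gcongr
      _ ≤ (1 + L + M) * D * (1 + ‖x‖) ^ (-(ν + α)) * ‖x - y‖ ^ α := by
          rw [mul_assoc _ _ (‖x - y‖ ^ α), ← hT]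
          have : 0 ≤ D * T := by positivity
          linarith

lemma differentiable_one_add_rpow (hu : Differentiable ℝ u) (h : ∀ x, |u x| ≤ 1 / 2) (a : ℝ) :
    Differentiable ℝ (fun x => (1 + u x) ^ a) := fun x =>
  ((hasDerivAt_one_add_rpow (h x) a).comp_hasFDerivAt x (hu x).hasFDerivAt).differentiableAt

lemma pder_one_add_rpow (hu : Differentiable ℝ u) (h : ∀ x, |u x| ≤ 1 / 2) (a : ℝ) (i : Fin n) :
    pder n (fun x => (1 + u x) ^ a) i = fun x => a * ((1 + u x) ^ (a - 1) * pder n u i x) := by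
  funext x
  have := (hasDerivAt_one_add_rpow (h x) a).comp_hasFDerivAt x (hu x).hasFDerivAt
  rw [pder, show (fun x => (1 + u x) ^ a) = (fun t : ℝ => (1 + t) ^ a) ∘ u from rfl, this.fderiv]
  simp [pder, mul_assoc]

lemma PartialBound.one_add_rpow (hα : 0 < α) (hα1 : α ≤ 1) (hν : 0 ≤ ν) :
    ∀ (k : ℕ) (a M : ℝ), ∃ c, ∀ ψ : Euc n → ℝ, PartialBound n α k ν M ψ → (∀ x, |ψ x| ≤ 1 / 2) →
      PartialBound n α k 0 c (fun x => (1 + ψ x) ^ a)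
  | 0, a, M => by
      refine ⟨max (2 ^ |a|) (|a| * 2 ^ |a - 1| * M), fun ψ h hs => ⟨fun x => ?_, fun x y hxy => ?_⟩⟩
      · simpa using Or.inl (abs_one_add_rpow_le (hs x) a)
      · refine (abs_one_add_rpow_sub_le (hs x) (hs y) a).trans ?_
        have h0 := h.2 x y hxy
        have hM := h.nonneg
        have h1 : (1 + ‖x‖) ^ (-(ν + α)) ≤ (1 + ‖x‖) ^ (-(0 + α)) :=
          Real.rpow_le_rpow_of_exponent_le (by simp) (by linarith)
        calc _ ≤ |a| * 2 ^ |a - 1| * (M * (1 + ‖x‖) ^ (-(0 + α)) * ‖x - y‖ ^ α) := by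
              gcongr
              exact h0.trans (by gcongr)
          _ = |a| * 2 ^ |a - 1| * M * (1 + ‖x‖) ^ (-(0 + α)) * ‖x - y‖ ^ α := by ring
          _ ≤ _ := by
              gcongr
              exact le_max_right _ _
  | k + 1, a, M => by
      obtain ⟨c₁, hc₁, H₁⟩ := PartialBound.succ_le (n := n) hα hα1 k hν
      obtain ⟨c, hc⟩ := PartialBound.one_add_rpow hα hα1 hν k (a - 1) (c₁ * M)
      obtain ⟨d, hd, Hd⟩ := PartialBound.mul (n := n) hα hα1 k (μ₁ := 0) (μ₂ := ν + 1) le_rfl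
        (by linarith)
      refine ⟨max (2 ^ |a|) (|a| * (d * (c * M))), fun ψ h hs => ⟨?_, fun x => ?_, fun i => ?_⟩⟩
      · exact differentiable_one_add_rpow h.1 hs a
      · simpa using Or.inl (abs_one_add_rpow_le (hs x) a)
      · rw [pder_one_add_rpow h.1 hs]
        have := Hd _ _ _ _ (hc ψ (H₁ _ _ h) hs) (h.2.2 i)
        exact ((this.const_mul a).weaken (by linarith)).mono (le_max_right _ _)

end

section

variable {n : ℕ} {α ν C : ℝ}

/-! ### Comparison with `WBound` -/

section WBound

variable {F G : Type*} [NormedAddCommGroup F] [NormedSpace ℝ F] [NormedAddCommGroup G]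
  [NormedSpace ℝ G] {k : ℕ} {u v : Euc n → F}

lemma WBound.nonneg (h : WBound n k α ν C u) : 0 ≤ C :=
  le_trans (by positivity) (h.2.1 0 (Nat.zero_le _) 0)

lemma WBound.mono {C' : ℝ} (h : WBound n k α ν C u) (hC : C ≤ C') : WBound n k α ν C' u :=
  ⟨h.1, fun i hi x => (h.2.1 i hi x).trans hC,
    fun R hR x y h1 h2 h3 h4 hxy => (h.2.2.1 R hR x y h1 h2 h3 h4 hxy).trans (by gcongr),
    fun x y hx hy hxy => (h.2.2.2 x y hx hy hxy).trans (by gcongr)⟩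

lemma WBound.clm_comp (L : F →L[ℝ] G) (h : WBound n k α ν C u) :
    WBound n k α ν (‖L‖ * C) (fun x => L (u x)) := by
  have e : ∀ i ≤ k, ∀ x, iteratedFDeriv ℝ i (fun x => L (u x)) x =
      L.compContinuousMultilinearMap (iteratedFDeriv ℝ i u x) := fun i hi x =>
    L.iteratedFDeriv_comp_left h.1.contDiffAt (by exact_mod_cast hi)
  have e' : ∀ x y, ‖iteratedFDeriv ℝ k (fun x => L (u x)) x -
      iteratedFDeriv ℝ k (fun x => L (u x)) y‖ ≤
      ‖L‖ * ‖iteratedFDeriv ℝ k u x - iteratedFDeriv ℝ k u y‖ := fun x y => by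
    rw [e k le_rfl, e k le_rfl]
    have : L.compContinuousMultilinearMap (iteratedFDeriv ℝ k u x) -
        L.compContinuousMultilinearMap (iteratedFDeriv ℝ k u y) =
        L.compContinuousMultilinearMap (iteratedFDeriv ℝ k u x - iteratedFDeriv ℝ k u y) := by
      ext m
      simp
    rw [this]
    exact L.norm_compContinuousMultilinearMap_le _
  refine ⟨L.contDiff.comp h.1, fun i hi x => ?_, fun R hR x y h1 h2 h3 h4 hxy => ?_,
    fun x y hx hy hxy => ?_⟩
  · rw [e i hi]
    have h1 := L.norm_compContinuousMultilinearMap_le (iteratedFDeriv ℝ i u x)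
    have h2 := h.2.1 i hi x
    calc _ ≤ (1 + ‖x‖) ^ (ν + i) * (‖L‖ * ‖iteratedFDeriv ℝ i u x‖) := by gcongr
      _ = ‖L‖ * ((1 + ‖x‖) ^ (ν + i) * ‖iteratedFDeriv ℝ i u x‖) := by ring
      _ ≤ _ := by gcongr
  · have h5 := h.2.2.1 R hR x y h1 h2 h3 h4 hxy
    calc _ ≤ (1 + R) ^ (ν + k + α) *
          (‖L‖ * ‖iteratedFDeriv ℝ k u x - iteratedFDeriv ℝ k u y‖) := by
          gcongr
          exact e' x y
      _ = ‖L‖ * ((1 + R) ^ (ν + k + α) *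
          ‖iteratedFDeriv ℝ k u x - iteratedFDeriv ℝ k u y‖) := by ring
      _ ≤ ‖L‖ * (C * ‖x - y‖ ^ α) := by gcongr
      _ = _ := by ring
  · refine (e' x y).trans ?_
    rw [mul_assoc]
    gcongr
    exact h.2.2.2 x y hx hy hxy

lemma WBound.add {C' : ℝ} (hu : WBound n k α ν C u) (hv : WBound n k α ν C' v) :
    WBound n k α ν (C + C') (fun x => u x + v x) := by
  have e : ∀ i ≤ k, ∀ x, iteratedFDeriv ℝ i (fun x => u x + v x) x =
      iteratedFDeriv ℝ i u x + iteratedFDeriv ℝ i v x := fun i hi x =>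
    iteratedFDeriv_add_apply (hu.1.of_le (by exact_mod_cast hi)).contDiffAt
      (hv.1.of_le (by exact_mod_cast hi)).contDiffAt
  have e' : ∀ x y, ‖iteratedFDeriv ℝ k (fun x => u x + v x) x -
      iteratedFDeriv ℝ k (fun x => u x + v x) y‖ ≤
      ‖iteratedFDeriv ℝ k u x - iteratedFDeriv ℝ k u y‖ +
      ‖iteratedFDeriv ℝ k v x - iteratedFDeriv ℝ k v y‖ := fun x y => by
    rw [e k le_rfl, e k le_rfl, add_sub_add_comm]
    exact norm_add_le _ _
  refine ⟨hu.1.add hv.1, fun i hi x => ?_, fun R hR x y h1 h2 h3 h4 hxy => ?_,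
    fun x y hx hy hxy => ?_⟩
  · rw [e i hi]
    have h1 := hu.2.1 i hi x
    have h2 := hv.2.1 i hi x
    calc _ ≤ (1 + ‖x‖) ^ (ν + i) * (‖iteratedFDeriv ℝ i u x‖ + ‖iteratedFDeriv ℝ i v x‖) := by
          gcongr
          exact norm_add_le _ _
      _ ≤ _ := by linarith
  · have h5 := hu.2.2.1 R hR x y h1 h2 h3 h4 hxy
    have h6 := hv.2.2.1 R hR x y h1 h2 h3 h4 hxy
    calc _ ≤ (1 + R) ^ (ν + k + α) *
          (‖iteratedFDeriv ℝ k u x - iteratedFDeriv ℝ k u y‖ +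
            ‖iteratedFDeriv ℝ k v x - iteratedFDeriv ℝ k v y‖) := by
          gcongr
          exact e' x y
      _ ≤ _ := by linarith
  · have h5 := hu.2.2.2 x y hx hy hxy
    have h6 := hv.2.2.2 x y hx hy hxy
    linarith [e' x y]

lemma WBound.sum {ι : Type*} (s : Finset ι) {f : ι → Euc n → F} {D : ι → ℝ}
    (hf : ∀ j ∈ s, WBound n k α ν (D j) (f j)) :
    WBound n k α ν (∑ j ∈ s, D j) (fun x => ∑ j ∈ s, f j x) := by
  classical
  induction s using Finset.induction_on with
  | empty =>
    have e : ∀ i, iteratedFDeriv ℝ i (fun _ : Euc n => (0:F)) = 0 := fun i =>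
      iteratedFDeriv_fun_zero
    simp only [Finset.sum_empty]
    exact ⟨contDiff_const, by simp [e], by simp [e], by simp [e]⟩
  | insert a s ha ih =>
    simp only [Finset.sum_insert ha]
    exact (hf a (by simp)).add (ih fun j hj => hf j (Finset.mem_insert_of_mem hj))

lemma norm_iteratedFDeriv_succ_sub (u : Euc n → F) (x y : Euc n) :
    ‖iteratedFDeriv ℝ (k + 1) u x - iteratedFDeriv ℝ (k + 1) u y‖ =
      ‖iteratedFDeriv ℝ k (fderiv ℝ u) x - iteratedFDeriv ℝ k (fderiv ℝ u) y‖ := by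
  rw [← dist_eq_norm, ← dist_eq_norm, iteratedFDeriv_succ_eq_comp_right, Function.comp_apply,
    iteratedFDeriv_succ_eq_comp_right, Function.comp_apply]
  exact LinearIsometryEquiv.dist_map _ _ _

lemma wBound_succ_iff : WBound n (k + 1) α ν C u ↔ Differentiable ℝ u ∧
    (∀ x, (1 + ‖x‖) ^ ν * ‖u x‖ ≤ C) ∧ WBound n k α (ν + 1) C (fderiv ℝ u) := by
  have hcd : ContDiff ℝ ((k + 1 : ℕ) : WithTop ℕ∞) u ↔
      Differentiable ℝ u ∧ ContDiff ℝ k (fderiv ℝ u) := by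
    rw [Nat.cast_add, Nat.cast_one, contDiff_succ_iff_fderiv]
    simp
  have e1 : ν + ((k + 1 : ℕ) : ℝ) + α = ν + 1 + k + α := by push_cast; ring
  constructor
  · rintro ⟨h0, h1, h2, h3⟩
    refine ⟨(hcd.1 h0).1, fun x => by simpa using h1 0 (Nat.zero_le _) x, (hcd.1 h0).2,
      fun i hi x => ?_, fun R hR x y a b c d hxy => ?_, fun x y a b hxy => ?_⟩
    · have := h1 (i + 1) (by omega) x
      rw [norm_iteratedFDeriv_fderiv]
      convert! this using 3
      push_cast; ring
    · have := h2 R hR x y a b c d hxy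
      rwa [norm_iteratedFDeriv_succ_sub, e1] at this
    · have := h3 x y a b hxy
      rwa [norm_iteratedFDeriv_succ_sub] at this
  · rintro ⟨hd, h0, hc, h1, h2, h3⟩
    refine ⟨hcd.2 ⟨hd, hc⟩, fun i hi x => ?_, fun R hR x y a b c d hxy => ?_,
      fun x y a b hxy => ?_⟩
    · rcases i with _ | i
      · simpa using h0 x
      · have := h1 i (by omega) x
        rw [norm_iteratedFDeriv_fderiv] at this
        convert! this using 3
        push_cast; ring
    · rw [norm_iteratedFDeriv_succ_sub, e1]
      exact h2 R hR x y a b c d hxy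
    · rw [norm_iteratedFDeriv_succ_sub]
      exact h3 x y a b hxy

lemma norm_iteratedFDeriv_zero_sub (u : Euc n → F) (x y : Euc n) :
    ‖iteratedFDeriv ℝ 0 u x - iteratedFDeriv ℝ 0 u y‖ = ‖u x - u y‖ := by
  rw [iteratedFDeriv_zero_eq_comp, Function.comp_apply, Function.comp_apply, ← map_sub,
    LinearIsometryEquiv.norm_map]

lemma wBound_zero_iff : WBound n 0 α ν C u ↔ Continuous u ∧
    (∀ x, (1 + ‖x‖) ^ ν * ‖u x‖ ≤ C) ∧
    (∀ R : ℝ, 1 ≤ R → ∀ x y : Euc n, R ≤ ‖x‖ → ‖x‖ ≤ 2*R → R ≤ ‖y‖ → ‖y‖ ≤ 2*R → x ≠ y →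
      (1 + R) ^ (ν + α) * ‖u x - u y‖ ≤ C * ‖x - y‖ ^ α)
    ∧ (∀ x y : Euc n, ‖x‖ ≤ 1 → ‖y‖ ≤ 1 → x ≠ y → ‖u x - u y‖ ≤ C * ‖x - y‖ ^ α) := by
  simp [WBound, norm_iteratedFDeriv_zero_sub]

end WBound

lemma exists_norm_eq_one {p q : Euc n} (hp : ‖p‖ ≤ 1) (hq : 1 ≤ ‖q‖) :
    ∃ z, ‖z‖ = 1 ∧ ‖p - z‖ ≤ ‖p - q‖ ∧ ‖z - q‖ ≤ ‖p - q‖ := by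
  have hc : ContinuousOn (fun t : ℝ => ‖p + t • (q - p)‖) (Set.Icc 0 1) := by fun_prop
  obtain ⟨t, ht, h⟩ := intermediate_value_Icc zero_le_one hc
    (show (1:ℝ) ∈ Set.Icc _ _ by simp [hp, hq])
  refine ⟨_, h, ?_, ?_⟩
  · rw [show p - (p + t • (q - p)) = t • (p - q) by module, norm_smul, Real.norm_eq_abs,
      abs_of_nonneg ht.1]
    exact mul_le_of_le_one_left (norm_nonneg _) ht.2
  · rw [show p + t • (q - p) - q = (1 - t) • (p - q) by module, norm_smul, Real.norm_eq_abs,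
      abs_of_nonneg (by linarith [ht.2])]
    exact mul_le_of_le_one_left (norm_nonneg _) (by linarith [ht.1])

lemma WBound.holderBound (hα : 0 < α) (hν : 0 ≤ ν) {u : Euc n → ℝ} (h : WBound n 0 α ν C u) :
    HolderBound n α ν (2 * 4 ^ α * (2 * 3 ^ (ν + α) * C)) u := by
  have hC := h.nonneg
  obtain ⟨-, h0, h1, h2⟩ := wBound_zero_iff.1 h
  have hp : 0 ≤ ν + α := by linarith
  have h3 : (1:ℝ) ≤ 3 ^ (ν + α) := Real.one_le_rpow (by norm_num) hp
  have inner : ∀ p q : Euc n, ‖p‖ ≤ 1 → ‖q‖ ≤ 1 → |u p - u q| ≤ C * ‖p - q‖ ^ α := by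
    intro p q hp hq
    rcases eq_or_ne p q with rfl | hne
    · simp [Real.zero_rpow hα.ne']
    · exact h2 p q hp hq hne
  have outer : ∀ p q : Euc n, 1 ≤ ‖p‖ → ‖p‖ ≤ ‖q‖ → ‖q‖ ≤ 2 * ‖p‖ →
      |u p - u q| ≤ C * (1 + ‖p‖) ^ (-(ν + α)) * ‖p - q‖ ^ α := by
    intro p q hp hpq hq
    rcases eq_or_ne p q with rfl | hne
    · simp [Real.zero_rpow hα.ne']
    · have := abs_le_mul_rpow_neg (one_add_norm_pos p)
        (h1 ‖p‖ hp p q le_rfl (by linarith) hpq hq hne)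
      rw [Real.norm_eq_abs] at this
      linarith
  have outer' : ∀ p q : Euc n, 1 ≤ ‖p‖ → ‖p‖ ≤ ‖q‖ → ‖q‖ ≤ 2 * ‖p‖ →
      |u p - u q| ≤ C * ‖p - q‖ ^ α := fun p q hp hpq hq => by
    refine (outer p q hp hpq hq).trans ?_
    have : (1 + ‖p‖) ^ (-(ν + α)) ≤ 1 :=
      Real.rpow_le_one_of_one_le_of_nonpos (by simp) (by linarith)
    have := mul_le_mul_of_nonneg_left this hC
    gcongr
    linarith
  have crossing : ∀ p q : Euc n, ‖p‖ ≤ 1 → 1 ≤ ‖q‖ → ‖q‖ ≤ 2 →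
      |u p - u q| ≤ 2 * C * ‖p - q‖ ^ α := fun p q hp hq hq2 => by
    obtain ⟨z, hz, z1, z2⟩ := exists_norm_eq_one hp hq
    have a1 := inner p z hp hz.le
    have a2 := outer' z q hz.ge (by linarith) (by linarith)
    have b1 : ‖p - z‖ ^ α ≤ ‖p - q‖ ^ α := by gcongr
    have b2 : ‖z - q‖ ^ α ≤ ‖p - q‖ ^ α := by gcongr
    have := mul_le_mul_of_nonneg_left b1 hC
    have := mul_le_mul_of_nonneg_left b2 hC
    linarith [abs_sub_le (u p) (u z) (u q)]
  have small : ∀ x : Euc n, ‖x‖ ≤ 2 → 1 ≤ 3 ^ (ν + α) * (1 + ‖x‖) ^ (-(ν + α)) := fun x hx => by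
    rw [Real.rpow_neg (by positivity), ← div_eq_mul_inv, one_le_div (by positivity)]
    exact Real.rpow_le_rpow (by positivity) (by linarith) hp
  refine HolderBound.of_near hα hν (by norm_num) (fun x => ?_) fun x y hxy => ?_
  · refine (abs_le_mul_rpow_neg (one_add_norm_pos x) (h0 x)).trans ?_
    gcongr
    nlinarith
  have hx := one_add_norm_pos x
  have n1 := norm_sub_norm_le x y
  have n2 := norm_sub_norm_le y x
  rw [norm_sub_rev] at n2
  have small' : ‖x‖ ≤ 2 → |u x - u y| ≤ 2 * C * ‖x - y‖ ^ α →
      |u x - u y| ≤ 2 * 3 ^ (ν + α) * C * (1 + ‖x‖) ^ (-(ν + α)) * ‖x - y‖ ^ α := fun h2 h => by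
    refine h.trans ?_
    have := mul_le_mul_of_nonneg_left (small x h2) (show 0 ≤ 2 * C * ‖x - y‖ ^ α by positivity)
    linarith
  rcases le_total ‖x‖ 1 with hx1 | hx1 <;> rcases le_total ‖y‖ 1 with hy1 | hy1
  · refine small' (by linarith) ((inner x y hx1 hy1).trans ?_)
    gcongr
    linarith
  · exact small' (by linarith) (crossing x y hx1 hy1 (by linarith))
  · refine small' (by linarith) ?_
    rw [abs_sub_comm, norm_sub_rev]
    exact crossing y x hy1 hx1 (by linarith)
  · rcases le_total ‖x‖ ‖y‖ with hl | hl
    · refine (outer x y hx1 hl (by linarith)).trans ?_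
      gcongr
      nlinarith
    · rw [abs_sub_comm, norm_sub_rev]
      refine (outer y x hy1 hl (by linarith)).trans ?_
      have a1 := rpow_neg_half hx (b := 1 + ‖y‖) (by linarith) hp
      have a2 : (2:ℝ) ^ (ν + α) ≤ 3 ^ (ν + α) := Real.rpow_le_rpow (by norm_num) (by norm_num) hp
      rw [norm_sub_rev]
      calc _ ≤ C * (3 ^ (ν + α) * (1 + ‖x‖) ^ (-(ν + α))) * ‖x - y‖ ^ α := by
            gcongr
            exact a1.trans (by gcongr)
        _ = 3 ^ (ν + α) * C * (1 + ‖x‖) ^ (-(ν + α)) * ‖x - y‖ ^ α := by ring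
        _ ≤ _ := by
            gcongr
            nlinarith

lemma HolderBound.wBound (hα : 0 < α) (hν : 0 ≤ ν) {u : Euc n → ℝ} (h : HolderBound n α ν C u) :
    WBound n 0 α ν C u := by
  have hC := nonneg_of_weighted_bound h.1
  refine wBound_zero_iff.2 ⟨h.continuous hα, fun x => ?_, fun R hR x y hx _ hy _ _ => ?_,
    fun x y hx hy _ => ?_⟩
  · exact mul_rpow_le_of_le (one_add_norm_pos x) (h.1 x)
  · have hR0 : 0 < 1 + R := by linarith
    refine mul_rpow_le_of_le hR0 ?_
    rcases le_total ‖x‖ ‖y‖ with hl | hl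
    · have := rpow_neg_anti hR0 (show 1 + R ≤ 1 + ‖x‖ by linarith) (show 0 ≤ ν + α by linarith)
      refine (h.2 x y hl).trans ?_
      rw [mul_right_comm]
      gcongr
    · have := rpow_neg_anti hR0 (show 1 + R ≤ 1 + ‖y‖ by linarith) (show 0 ≤ ν + α by linarith)
      rw [norm_sub_rev (u x), norm_sub_rev x]
      refine (h.2 y x hl).trans ?_
      rw [mul_right_comm]
      gcongr
  · have key : ∀ p : Euc n, (1 + ‖p‖) ^ (-(ν + α)) ≤ 1 := fun p =>
      Real.rpow_le_one_of_one_le_of_nonpos (by simp) (by linarith)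
    rcases le_total ‖x‖ ‖y‖ with hl | hl
    · refine (h.2 x y hl).trans ?_
      have := mul_le_mul_of_nonneg_left (key x) hC
      gcongr
      linarith
    · rw [norm_sub_rev (u x), norm_sub_rev x]
      refine (h.2 y x hl).trans ?_
      have := mul_le_mul_of_nonneg_left (key y) hC
      gcongr
      linarith

lemma WBound.pder {k : ℕ} {u : Euc n → ℝ} (h : WBound n (k + 1) α ν C u) (i : Fin n) :
    WBound n k α (ν + 1) C (pder n u i) := by
  have h1 := (wBound_succ_iff.1 h).2.2
  have h2 := h1.clm_comp (ContinuousLinearMap.apply ℝ ℝ (EuclideanSpace.single i (1:ℝ) : Euc n))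
  refine h2.mono (mul_le_of_le_one_left h1.nonneg ?_)
  refine ContinuousLinearMap.opNorm_le_bound _ zero_le_one fun L => ?_
  simpa using L.le_opNorm (EuclideanSpace.single i (1:ℝ) : Euc n)

lemma WBound.partialBound (hα : 0 < α) : ∀ (k : ℕ) {ν : ℝ}, 0 ≤ ν → ∃ c, 1 ≤ c ∧
    ∀ (u : Euc n → ℝ) (C : ℝ), WBound n k α ν C u → PartialBound n α k ν (c * C) u
  | 0, ν, hν => by
      refine ⟨max 1 (2 * 4 ^ α * (2 * 3 ^ (ν + α))), le_max_left _ _, fun u C h => ?_⟩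
      refine (h.holderBound hα hν).mono ?_
      rw [← mul_assoc]
      exact mul_le_mul_of_nonneg_right (le_max_right _ _) h.nonneg
  | k + 1, ν, hν => by
      obtain ⟨c, hc, H⟩ := WBound.partialBound hα k (ν := ν + 1) (by linarith)
      refine ⟨c, hc, fun u C h => ?_⟩
      have hC := h.nonneg
      obtain ⟨hd, h0, -⟩ := wBound_succ_iff.1 h
      refine ⟨hd, fun x => ?_, fun i => H _ _ (h.pder i)⟩
      refine (abs_le_mul_rpow_neg (one_add_norm_pos x) (h0 x)).trans ?_
      gcongr
      nlinarith

lemma PartialBound.wBound (hα : 0 < α) : ∀ (k : ℕ) {ν : ℝ}, 0 ≤ ν → ∃ c, 1 ≤ c ∧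
    ∀ (u : Euc n → ℝ) (C : ℝ), PartialBound n α k ν C u → WBound n k α ν (c * C) u
  | 0, ν, hν => ⟨1, le_rfl, fun u C h => by simpa using HolderBound.wBound hα hν h⟩
  | k + 1, ν, hν => by
      obtain ⟨c, hc, H⟩ := PartialBound.wBound hα k (ν := ν + 1) (by linarith)
      refine ⟨(n + 1) * c, ?_, fun u C h => ?_⟩
      · have : (0:ℝ) ≤ n * c := by positivity
        linarith
      have hC := h.nonneg
      have hle : C ≤ (n + 1) * c * C := by
        have h1 : 1 ≤ (n + 1) * c := by
          have : (0:ℝ) ≤ n * c := by positivity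
          linarith
        nlinarith
      refine wBound_succ_iff.2 ⟨h.1, fun x => ?_, ?_⟩
      · exact mul_rpow_le_of_le (one_add_norm_pos x) ((h.2.1 x).trans (by gcongr))
      · have e : fderiv ℝ u = fun x => ∑ i, ContinuousLinearMap.toSpanSingleton ℝ
            (EuclideanSpace.proj i : Euc n →L[ℝ] ℝ) (_root_.pder n u i x) := by
          funext x
          rw [fderiv_eq_sum]
          simp
        rw [e]
        have := WBound.sum Finset.univ (D := fun _ => c * C) (fun i _ =>
          ((H _ _ (h.2.2 i)).clm_comp (ContinuousLinearMap.toSpanSingleton ℝ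
            (EuclideanSpace.proj i : Euc n →L[ℝ] ℝ))).mono
            (mul_le_of_le_one_left (by positivity)
              (by simpa using norm_proj_le i)))
        refine this.mono ?_
        simp only [Finset.sum_const, Finset.card_univ, Fintype.card_fin, nsmul_eq_mul]
        have : 0 ≤ c * C := by positivity
        linarith

end

section

variable {n : ℕ} {α ν C : ℝ} {u v : Euc n → ℝ}

/-! ### Smooth kernels supported in the unit ball and the associated averages -/

/-- Smooth functions supported in the closed unit ball. -/
structure IsKernel (χ : Euc n → ℝ) : Prop where
  smooth : ContDiff ℝ (⊤ : ℕ∞) χ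
  eq_zero : ∀ z, 1 < ‖z‖ → χ z = 0

/-- The average of `g` over the ball of radius `s` around `x` against the kernel `χ`. -/
def ballAvg (χ g : Euc n → ℝ) (s : ℝ) (x : Euc n) : ℝ := ∫ z, χ z * g (x - s • z)

/-- The kernel `div (z χ(z))`, which governs the dependence of averages on the radius. -/
def radialDiv (χ : Euc n → ℝ) (z : Euc n) : ℝ := n * χ z + fderiv ℝ χ z z

namespace IsKernel

variable {χ g : Euc n → ℝ}

lemma continuous (h : IsKernel χ) : Continuous χ := h.smooth.continuous

lemma differentiable (h : IsKernel χ) : Differentiable ℝ χ := h.smooth.differentiable (by simp)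

lemma hasCompactSupport (h : IsKernel χ) : HasCompactSupport χ :=
  HasCompactSupport.intro (isCompact_closedBall (0 : Euc n) 1) fun z hz => h.eq_zero z (by
    simpa using hz)

lemma fderiv_eq_zero (h : IsKernel χ) {z : Euc n} (hz : 1 < ‖z‖) : fderiv ℝ χ z = 0 := by
  have : χ =ᶠ[nhds z] fun _ => 0 := by
    filter_upwards [(isOpen_lt continuous_const continuous_norm).mem_nhds hz] with w hw
    exact h.eq_zero w hw
  rw [this.fderiv_eq]
  simp

lemma pder (h : IsKernel χ) (i : Fin n) : IsKernel (pder n χ i) := by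
  refine ⟨?_, fun z hz => by simp [_root_.pder, h.fderiv_eq_zero hz]⟩
  exact (h.smooth.fderiv_right (m := (⊤ : ℕ∞)) (by simp)).clm_apply contDiff_const

lemma radialDiv (h : IsKernel χ) : IsKernel (radialDiv χ) := by
  refine ⟨?_, fun z hz => by simp [_root_.radialDiv, h.fderiv_eq_zero hz, h.eq_zero z hz]⟩
  exact (contDiff_const.mul h.smooth).add
    ((h.smooth.fderiv_right (m := (⊤ : ℕ∞)) (by simp)).clm_apply contDiff_id)

lemma integrable (h : IsKernel χ) : Integrable χ :=
  h.continuous.integrable_of_hasCompactSupport h.hasCompactSupport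

lemma integrable_mul (h : IsKernel χ) (hg : Continuous g) (s : ℝ) (x : Euc n) :
    Integrable fun z => χ z * g (x - s • z) :=
  (h.continuous.mul (by fun_prop)).integrable_of_hasCompactSupport h.hasCompactSupport.mul_right

lemma integral_pder (h : IsKernel χ) (i : Fin n) : ∫ z, _root_.pder n χ i z = 0 := by
  have := integral_mul_fderiv_eq_neg_fderiv_mul_of_integrable (μ := volume) (f := fun _ => (1:ℝ))
    (g := χ) (v := EuclideanSpace.single i (1:ℝ)) (by simp)
    (by simp only [one_mul]; exact (h.pder i).integrable) (by simpa using h.integrable)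
    (fun _ _ => by fun_prop) (fun x _ => h.differentiable x)
  simpa [_root_.pder] using this

lemma continuous_ballAvg (h : IsKernel χ) (hg : Continuous g) :
    Continuous fun p : ℝ × Euc n => ballAvg χ g p.1 p.2 := by
  have e : (fun p : ℝ × Euc n => ballAvg χ g p.1 p.2) = fun p =>
      ∫ z in Metric.closedBall (0 : Euc n) 1, χ z * g (p.2 - p.1 • z) := by
    funext p
    rw [ballAvg, setIntegral_eq_integral_of_forall_compl_eq_zero]
    intro z hz
    rw [h.eq_zero z (by simpa using hz), zero_mul]
  rw [e]
  apply continuous_parametric_integral_of_continuous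
    (f := fun (p : ℝ × Euc n) (z : Euc n) => χ z * g (p.2 - p.1 • z))
  · have := h.continuous
    simp only [Function.uncurry_def]
    fun_prop
  · exact isCompact_closedBall _ _

lemma ballAvg_zero (x : Euc n) : ballAvg χ g 0 x = (∫ z, χ z) * g x := by
  simp [ballAvg, integral_mul_const]

lemma abs_ballAvg_le (h : IsKernel χ) {s M : ℝ} (hs : 0 ≤ s) {x : Euc n}
    (hM : ∀ y, ‖x - y‖ ≤ s → |g y| ≤ M) : |ballAvg χ g s x| ≤ (∫ z, |χ z|) * M := by
  rw [ballAvg, ← Real.norm_eq_abs, ← integral_mul_const]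
  refine norm_integral_le_of_norm_le (h.integrable.abs.mul_const M)
    (Eventually.of_forall fun z => ?_)
  rw [Real.norm_eq_abs, abs_mul]
  by_cases hz : 1 < ‖z‖
  · simp [h.eq_zero z hz]
  · refine mul_le_mul_of_nonneg_left (hM _ ?_) (abs_nonneg _)
    rw [sub_sub_cancel, norm_smul, Real.norm_eq_abs, abs_of_nonneg hs]
    exact mul_le_of_le_one_right hs (not_lt.1 hz)

lemma abs_ballAvg_le_of_integral_eq_zero (h : IsKernel χ) (h0 : ∫ z, χ z = 0) (hg : Continuous g)
    {s M : ℝ} (hs : 0 ≤ s) {x : Euc n} (hM : ∀ y, ‖x - y‖ ≤ s → |g x - g y| ≤ M) :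
    |ballAvg χ g s x| ≤ (∫ z, |χ z|) * M := by
  have e : ballAvg χ g s x = ballAvg χ (fun y => g y - g x) s x := by
    have : (fun z => χ z * (g (x - s • z) - g x)) =
        fun z => χ z * g (x - s • z) - χ z * g x := by funext z; ring
    rw [ballAvg, ballAvg, this, integral_sub (h.integrable_mul hg s x)
      (h.integrable.mul_const _), integral_mul_const, h0]
    simp
  rw [e]
  exact h.abs_ballAvg_le hs fun y hy => by rw [abs_sub_comm]; exact hM y hy

lemma ballAvg_pder (h : IsKernel χ) (hg : Differentiable ℝ g) (i : Fin n)
    (hg' : Continuous (_root_.pder n g i)) {s : ℝ} (hs : 0 < s) (x : Euc n) :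
    ballAvg χ (_root_.pder n g i) s x = s⁻¹ * ballAvg (_root_.pder n χ i) g s x := by
  have hd : ∀ z : Euc n, HasFDerivAt (fun z => g (x - s • z))
      ((fderiv ℝ g (x - s • z)).comp (-(s • ContinuousLinearMap.id ℝ (Euc n)))) z := fun z => by
    refine (hg _).hasFDerivAt.comp z ?_
    exact ((hasFDerivAt_id z).const_smul s).const_sub x
  have e : ∀ z : Euc n, fderiv ℝ (fun z => g (x - s • z)) z (EuclideanSpace.single i 1) =
      -s * _root_.pder n g i (x - s • z) := fun z => by
    rw [(hd z).fderiv]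
    simp [_root_.pder]
  have := integral_mul_fderiv_eq_neg_fderiv_mul_of_integrable (μ := volume) (f := χ)
    (g := fun z => g (x - s • z)) (v := EuclideanSpace.single i (1:ℝ))
    ((h.pder i).integrable_mul hg.continuous s x)
    (by
      simp only [e]
      refine ((h.integrable_mul hg' s x).const_mul (-s)).congr (Eventually.of_forall fun z => ?_)
      simp only
      ring)
    (h.integrable_mul hg.continuous s x) (fun z _ => h.differentiable z)
    (fun z _ => (hd z).differentiableAt)
  simp only [e] at this
  have e2 : ∫ z, χ z * (-s * _root_.pder n g i (x - s • z)) =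
      -s * ballAvg χ (_root_.pder n g i) s x := by
    rw [ballAvg, ← integral_const_mul]
    exact integral_congr_ae (Eventually.of_forall fun z => by simp only; ring)
  rw [e2] at this
  have e3 : ∫ z, fderiv ℝ χ z (EuclideanSpace.single i 1) * g (x - s • z) =
      ballAvg (_root_.pder n χ i) g s x := rfl
  rw [e3] at this
  field_simp
  linarith

lemma ballAvg_eq_convolution {s : ℝ} (hs : 0 < s) (x : Euc n) :
    ballAvg χ g s x = convolution g (fun w => (s⁻¹) ^ n * χ (s⁻¹ • w))
      (ContinuousLinearMap.mul ℝ ℝ) volume x := by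
  rw [convolution_def]
  have h1 := integral_sub_left_eq_self
    (fun t => g t * ((s⁻¹) ^ n * χ (s⁻¹ • (x - t)))) (volume : Measure (Euc n)) x
  have h2 := Measure.integral_comp_smul (volume : Measure (Euc n))
    (fun w => g (x - w) * ((s⁻¹) ^ n * χ (s⁻¹ • w))) s
  simp only [sub_sub_cancel] at h1
  simp only [ContinuousLinearMap.mul_apply']
  rw [← h1]
  have e : (fun z => g (x - s • z) * (s⁻¹ ^ n * χ (s⁻¹ • s • z))) =
      fun z => s⁻¹ ^ n * (χ z * g (x - s • z)) := by
    funext z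
    rw [smul_smul, inv_mul_cancel₀ hs.ne', one_smul]
    ring
  rw [e, integral_const_mul] at h2
  have hp : 0 < s⁻¹ ^ n := by positivity
  rw [finrank_euclideanSpace_fin, abs_of_nonneg (by positivity), ← inv_pow, smul_eq_mul] at h2
  exact mul_left_cancel₀ hp.ne' h2

lemma hasFDerivAt_scaled (h : IsKernel χ) {s : ℝ} (hs : 0 < s) (w : Euc n) :
    HasFDerivAt (fun q : ℝ × Euc n => (q.1⁻¹) ^ n * χ (q.1⁻¹ • q.2))
      ((-s⁻¹ * ((s⁻¹) ^ n * _root_.radialDiv χ (s⁻¹ • w))) • ContinuousLinearMap.fst ℝ ℝ (Euc n) +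
        (s⁻¹ * (s⁻¹) ^ n) • (fderiv ℝ χ (s⁻¹ • w)).comp (ContinuousLinearMap.snd ℝ ℝ (Euc n)))
      (s, w) := by
  have h1 : HasFDerivAt (fun q : ℝ × Euc n => q.1⁻¹)
      ((-(s ^ 2)⁻¹) • ContinuousLinearMap.fst ℝ ℝ (Euc n)) (s, w) :=
    (hasDerivAt_inv hs.ne').comp_hasFDerivAt (s, w) hasFDerivAt_fst
  have h2 : HasFDerivAt (fun q : ℝ × Euc n => q.1⁻¹ • q.2) _ (s, w) := h1.smul hasFDerivAt_snd
  have h3 := (h.differentiable (s⁻¹ • w)).hasFDerivAt.comp (s, w) h2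
  have h4 := (h1.pow n).mul h3
  refine h4.congr_fderiv ?_
  ext q
  · simp only [_root_.radialDiv, Function.comp]
    rcases n with _ | n
    · simp
      ring
    · simp
      field_simp
      ring
  · simp
    ring

lemma hasFDerivAt_ballAvg_prod (h : IsKernel χ) (hg : Continuous g) {s : ℝ} (hs : 0 < s)
    (x : Euc n) :
    HasFDerivAt (fun q : ℝ × Euc n => ballAvg χ g q.1 q.2)
      ((-s⁻¹ * ballAvg (_root_.radialDiv χ) g s x) • ContinuousLinearMap.fst ℝ ℝ (Euc n) +
        (∑ i, (s⁻¹ * ballAvg (_root_.pder n χ i) g s x) •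
          (EuclideanSpace.proj i : Euc n →L[ℝ] ℝ)).comp (ContinuousLinearMap.snd ℝ ℝ (Euc n)))
      (s, x) := by
  set K : ℝ → Euc n → ℝ := fun s w => (s⁻¹) ^ n * χ (s⁻¹ • w) with hK
  have hKs : ∀ q : ℝ × Euc n, 0 < q.1 → ContDiffAt ℝ (⊤ : ℕ∞) (↿K) q := fun q hq => by
    have hi : ContDiffAt ℝ (⊤ : ℕ∞) (fun q : ℝ × Euc n => q.1⁻¹) q :=
      contDiffAt_fst.inv hq.ne'
    exact (hi.pow n).mul (h.smooth.contDiffAt.comp q (hi.smul contDiffAt_snd))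
  have hLI : LocallyIntegrable g := hg.locallyIntegrable
  have hzero : ∀ (p : ℝ) (w : Euc n), p ∈ Set.Ioo (s / 2) (2 * s) →
      w ∉ Metric.closedBall (0 : Euc n) (2 * s) → 1 < ‖p⁻¹ • w‖ := by
    intro p w hp hw
    have hp0 : 0 < p := by linarith [hp.1]
    rw [norm_smul, norm_inv, Real.norm_eq_abs, abs_of_pos hp0, inv_mul_eq_div, lt_div_iff₀ hp0]
    have : 2 * s < ‖w‖ := by simpa using hw
    linarith [hp.2]
  have hsm : s ∈ Set.Ioo (s / 2) (2 * s) := ⟨by linarith, by linarith⟩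
  have key := hasFDerivAt_convolution_right_with_param (𝕜 := ℝ) (μ := volume) (f := g) (g := K)
    (ContinuousLinearMap.mul ℝ ℝ) (isOpen_Ioo (a := s / 2) (b := 2 * s))
    (isCompact_closedBall (0 : Euc n) (2 * s))
    (fun p w hp hw => by simp [hK, h.eq_zero _ (hzero p w hp hw)]) hLI
    (fun q hq => ((hKs q (by linarith [hq.1.1])).of_le (by simp)).contDiffWithinAt) (s, x) hsm
  have hcs : HasCompactSupport fun w => fderiv ℝ ↿K (s, w) := by
    refine HasCompactSupport.intro (isCompact_closedBall (0 : Euc n) (2 * s)) fun w hw => ?_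
    have h1 := hzero s w hsm hw
    have e := (h.hasFDerivAt_scaled hs w).fderiv
    have e' : fderiv ℝ ↿K (s, w) = _ := e
    rw [e', h.radialDiv.eq_zero _ h1, h.fderiv_eq_zero h1]
    simp
  have hcont : Continuous fun w => fderiv ℝ ↿K (s, w) := by
    rw [continuous_iff_continuousAt]
    intro w
    have := ((hKs (s, w) hs).fderiv_right (m := (⊤ : ℕ∞)) (by simp)).continuousAt
    exact this.comp (f := fun w : Euc n => (s, w)) (by fun_prop)
  have ev : ∀ q : ℝ × Euc n, (convolution g (fun w => fderiv ℝ ↿K (s, w))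
      (ContinuousLinearMap.precompR (ℝ × Euc n) (ContinuousLinearMap.mul ℝ ℝ)) volume x) q =
      ∫ t, g t * fderiv ℝ ↿K (s, x - t) q := fun q => by
    rw [convolution_precompR_apply _ hLI hcs hcont, convolution_def]
    simp
  have hev : (fun q : ℝ × Euc n => ballAvg χ g q.1 q.2) =ᶠ[nhds (s, x)]
      fun q => convolution g (K q.1) (ContinuousLinearMap.mul ℝ ℝ) volume q.2 := by
    filter_upwards [(isOpen_lt continuous_const continuous_fst).mem_nhds
      (show (0:ℝ) < (s, x).1 from hs)] with q hq
    exact ballAvg_eq_convolution hq q.2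
  refine (key.congr_of_eventuallyEq hev).congr_fderiv ?_
  have e' : ∀ w, fderiv ℝ ↿K (s, w) = _ := fun w => (h.hasFDerivAt_scaled hs w).fderiv
  have c1 : ∀ θ : Euc n → ℝ, ∀ a : ℝ, ∫ t, g t * (a * ((s⁻¹) ^ n * θ (s⁻¹ • (x - t)))) =
      a * ballAvg θ g s x := fun θ a => by
    rw [ballAvg_eq_convolution hs, convolution_def, ← integral_const_mul]
    refine integral_congr_ae (Eventually.of_forall fun t => ?_)
    simp only [ContinuousLinearMap.mul_apply']
    ring
  have hb : ∀ A B : Euc n →L[ℝ] ℝ, (∀ i, A (EuclideanSpace.single i 1) =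
      B (EuclideanSpace.single i 1)) → A = B := fun A B hAB => by
    refine ContinuousLinearMap.coe_injective ((EuclideanSpace.basisFun (Fin n) ℝ).toBasis.ext
      fun i => ?_)
    simpa using hAB i
  refine ContinuousLinearMap.prod_ext ?_ (hb _ _ fun j => ?_)
  · ext
    refine (ev (1, 0)).trans ?_
    simp only [e']
    have := c1 (_root_.radialDiv χ) (-s⁻¹)
    simpa using this
  · refine (ev (0, EuclideanSpace.single j 1)).trans ?_
    simp only [e']
    have := c1 (_root_.pder n χ j) (s⁻¹)
    simp only [_root_.pder] at this
    simpa [_root_.pder, mul_assoc] using this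

lemma hasFDerivAt_ballAvg (h : IsKernel χ) (hg : Continuous g) {s : ℝ} (hs : 0 < s) (x : Euc n) :
    HasFDerivAt (ballAvg χ g s) (∑ i, (s⁻¹ * ballAvg (_root_.pder n χ i) g s x) •
      (EuclideanSpace.proj i : Euc n →L[ℝ] ℝ)) x := by
  have := (h.hasFDerivAt_ballAvg_prod hg hs x).comp x (hasFDerivAt_prodMk_right s x)
  refine this.congr_fderiv ?_
  ext y
  simp

lemma hasDerivAt_ballAvg (h : IsKernel χ) (hg : Continuous g) {s : ℝ} (hs : 0 < s) (x : Euc n) :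
    HasDerivAt (fun s => ballAvg χ g s x) (-s⁻¹ * ballAvg (_root_.radialDiv χ) g s x) s := by
  have := (h.hasFDerivAt_ballAvg_prod hg hs x).comp_hasDerivAt s
    ((hasDerivAt_id s).prodMk (hasDerivAt_const s x))
  refine this.congr_deriv ?_
  simp

end IsKernel

end

section

variable {n : ℕ} {α ν C : ℝ} {u v : Euc n → ℝ}

/-! ### Decay of averages, the bump function, and power integrals -/

lemma IsKernel.exists_bound {χ : Euc n → ℝ} (h : IsKernel χ) : ∃ M, 0 ≤ M ∧ ∀ z, |χ z| ≤ M := by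
  obtain ⟨M, hM⟩ := h.hasCompactSupport.exists_bound_of_continuous h.continuous
  exact ⟨M, (norm_nonneg _).trans (hM 0), hM⟩

/-- Averages of functions with decay rate `p < n` decay like `s ^ (-p)` in the radius,
uniformly in the centre. -/
lemma IsKernel.abs_ballAvg_decay (hn : 0 < n) {χ : Euc n → ℝ} (h : IsKernel χ) {p : ℝ}
    (hp : 0 ≤ p) (hpn : p < n) :
    ∃ c, 0 ≤ c ∧ ∀ (f : Euc n → ℝ) (C : ℝ), (∀ x, |f x| ≤ C * (1 + ‖x‖) ^ (-p)) →
      ∀ (s : ℝ), 0 < s → ∀ x, |ballAvg χ f s x| ≤ c * C * s ^ (-p) := by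
  obtain ⟨M, hM0, hM⟩ := h.exists_bound
  have : Nonempty (Fin n) := ⟨⟨0, hn⟩⟩
  set k : Euc n → ℝ := (Metric.ball (0 : Euc n) 1).indicator fun y => ‖y‖ ^ (-p) with hk
  have hkint : Integrable k := by
    rw [hk, integrable_indicator_iff measurableSet_ball]
    refine integrableOn_ball_of_norm_le_rpow (by simpa using Nat.succ_le_of_lt hn) (C := 1) (α := p)
      (by simpa using hpn) (Eventually.of_forall fun x => ?_)
      (measurable_norm.pow_const _).aestronglyMeasurable
    rw [one_mul, Real.norm_eq_abs, abs_of_nonneg (by positivity)]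
  have hk0 : ∀ y, 0 ≤ k y := fun y => Set.indicator_nonneg (fun y _ => by positivity) y
  have hk1 : ∀ y ≠ 0, ‖y‖ ^ (-p) ≤ k y + 1 := by
    intro y hy
    by_cases hy1 : y ∈ Metric.ball (0 : Euc n) 1
    · simp [hk, Set.indicator_of_mem hy1]
    · have : 1 ≤ ‖y‖ := by simpa using hy1
      linarith [hk0 y, Real.rpow_le_one_of_one_le_of_nonpos this (by linarith : -p ≤ 0)]
  have hC0 : 0 ≤ (M * ∫ z, k z) + ∫ z, |χ z| :=
    add_nonneg (mul_nonneg hM0 (integral_nonneg fun z => hk0 z))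
      (integral_nonneg fun z => abs_nonneg _)
  refine ⟨(M * ∫ z, k z) + ∫ z, |χ z|, hC0, fun f C hf s hs x => ?_⟩
  have hC := nonneg_of_weighted_bound hf
  have e : ((M * ∫ z, k z) + ∫ z, |χ z|) * C * s ^ (-p) =
      ∫ z, C * s ^ (-p) * (M * k (s⁻¹ • x - z) + |χ z|) := by
    rw [integral_const_mul, integral_add ((hkint.comp_sub_left _).const_mul M) h.integrable.abs,
      integral_const_mul, integral_sub_left_eq_self k volume]
    ring
  rw [e, ballAvg, ← Real.norm_eq_abs]
  refine norm_integral_le_of_norm_le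
    ((((hkint.comp_sub_left _).const_mul M).add h.integrable.abs).const_mul _) ?_
  filter_upwards [compl_mem_ae_iff.2 (measure_singleton (μ := volume) (s⁻¹ • x))] with z hz
  have hy : s⁻¹ • x - z ≠ 0 := sub_ne_zero.2 fun h => hz h.symm
  have hxz : ‖x - s • z‖ = s * ‖s⁻¹ • x - z‖ := by
    rw [← abs_of_pos hs, ← Real.norm_eq_abs, ← norm_smul, Real.norm_eq_abs, abs_of_pos hs, smul_sub,
      smul_smul, mul_inv_cancel₀ hs.ne', one_smul]
  have hpos : 0 < ‖s⁻¹ • x - z‖ := norm_pos_iff.2 hy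
  have h1 : |f (x - s • z)| ≤ C * (s ^ (-p) * (k (s⁻¹ • x - z) + 1)) := by
    refine (hf _).trans (mul_le_mul_of_nonneg_left ?_ hC)
    calc (1 + ‖x - s • z‖) ^ (-p) ≤ ‖x - s • z‖ ^ (-p) :=
          rpow_neg_anti (by rw [hxz]; positivity) (by linarith) hp
      _ = s ^ (-p) * ‖s⁻¹ • x - z‖ ^ (-p) := by rw [hxz, Real.mul_rpow hs.le hpos.le]
      _ ≤ _ := by gcongr; exact hk1 _ hy
  have hs' : 0 ≤ s ^ (-p) := by positivity
  rw [Real.norm_eq_abs, abs_mul]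
  calc |χ z| * |f (x - s • z)| ≤ |χ z| * (C * (s ^ (-p) * (k (s⁻¹ • x - z) + 1))) := by gcongr
    _ = C * s ^ (-p) * (|χ z| * k (s⁻¹ • x - z) + |χ z|) := by ring
    _ ≤ _ := by
      have := mul_le_mul_of_nonneg_right (hM z) (hk0 (s⁻¹ • x - z))
      gcongr

/-- A radial bump function. -/
def bump (n : ℕ) (z : Euc n) : ℝ := expNegInvGlue (1 - ‖z‖ ^ 2)

/-- The kernel `ζ` with `∇ bump = z ζ`. -/
def bumpSlope (n : ℕ) (z : Euc n) : ℝ := -2 * deriv expNegInvGlue (1 - ‖z‖ ^ 2)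

lemma one_sub_sq_neg {z : Euc n} (hz : 1 < ‖z‖) : 1 - ‖z‖ ^ 2 < 0 := by nlinarith

lemma isKernel_bump (n : ℕ) : IsKernel (bump n) :=
  ⟨expNegInvGlue.contDiff.comp (contDiff_const.sub (contDiff_norm_sq ℝ)), fun _ hz =>
    expNegInvGlue.zero_of_nonpos (one_sub_sq_neg hz).le⟩

lemma isKernel_bumpSlope (n : ℕ) : IsKernel (bumpSlope n) := by
  refine ⟨contDiff_const.mul (ContDiff.comp (g := deriv expNegInvGlue) ?_
    (contDiff_const.sub (contDiff_norm_sq ℝ))), fun z hz => ?_⟩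
  · exact (contDiff_infty_iff_deriv.1 expNegInvGlue.contDiff).2
  · have : expNegInvGlue =ᶠ[nhds (1 - ‖z‖ ^ 2)] fun _ => 0 := by
      filter_upwards [isOpen_Iio.mem_nhds (one_sub_sq_neg hz)] with t ht
      exact expNegInvGlue.zero_of_nonpos (le_of_lt ht)
    rw [bumpSlope, this.deriv_eq]
    simp

lemma integral_bumpSlope_ne_zero (hn : 0 < n) : ∫ z, bumpSlope n z ≠ 0 := by
  have hdiff : Differentiable ℝ expNegInvGlue :=
    (expNegInvGlue.contDiff (n := 1)).differentiable (by simp)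
  obtain ⟨t, ht, h⟩ := exists_deriv_eq_slope expNegInvGlue zero_lt_one hdiff.continuous.continuousOn
    hdiff.differentiableOn
  have hpos : deriv expNegInvGlue t ≠ 0 := by
    rw [h, expNegInvGlue.zero]
    have := expNegInvGlue.pos_of_pos zero_lt_one
    simp [this.ne']
  set z : Euc n := EuclideanSpace.single ⟨0, hn⟩ (√(1 - t)) with hz
  have hz2 : 1 - ‖z‖ ^ 2 = t := by
    simp [hz, Real.sq_sqrt (by linarith [ht.2] : 0 ≤ 1 - t)]
  have key : 0 < ∫ z, -bumpSlope n z :=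
    (isKernel_bumpSlope n).continuous.neg.integral_pos_of_hasCompactSupport_nonneg_nonzero
      (x := z) (isKernel_bumpSlope n).hasCompactSupport.neg
      (fun w => by
        have := expNegInvGlue.monotone.deriv_nonneg (x := 1 - ‖w‖ ^ 2)
        simp [bumpSlope, this]) (by simp [bumpSlope, hz2, hpos])
  rw [integral_neg] at key
  linarith

lemma pder_bump (i : Fin n) (z : Euc n) : pder n (bump n) i z = z i * bumpSlope n z := by
  have hdiff : Differentiable ℝ expNegInvGlue :=
    (expNegInvGlue.contDiff (n := 1)).differentiable (by simp)
  have h1 : HasFDerivAt (fun z : Euc n => 1 - ‖z‖ ^ 2) _ z :=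
    (hasStrictFDerivAt_norm_sq z).hasFDerivAt.const_sub 1
  have h2 := (hdiff (1 - ‖z‖ ^ 2)).hasDerivAt.comp_hasFDerivAt z h1
  have h3 : HasFDerivAt (bump n) _ z := h2
  rw [pder, h3.fderiv]
  have h4 : inner ℝ z (EuclideanSpace.single i (1:ℝ)) = z i := by
    simp [EuclideanSpace.inner_single_right]
  simp [bumpSlope, h4]
  ring

lemma sum_pder_pder_bump (z : Euc n) :
    ∑ i, pder n (pder n (bump n) i) i z = radialDiv (bumpSlope n) z := by
  have h := isKernel_bumpSlope n
  have e : ∀ i, pder n (pder n (bump n) i) i z =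
      bumpSlope n z + z i * pder n (bumpSlope n) i z := by
    intro i
    have h1 : pder n (bump n) i = fun z => z i * bumpSlope n z := funext fun z => pder_bump i z
    have h2 : HasFDerivAt (fun z : Euc n => z i) (EuclideanSpace.proj i : Euc n →L[ℝ] ℝ) z :=
      (EuclideanSpace.proj i : Euc n →L[ℝ] ℝ).hasFDerivAt
    rw [h1, pder_mul (u := fun z : Euc n => z i)
      (EuclideanSpace.proj i : Euc n →L[ℝ] ℝ).differentiable h.differentiable]
    have : pder n (fun z : Euc n => z i) i z = 1 := by
      rw [pder, h2.fderiv]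
      simp
    simp only [this]
    ring
  rw [Finset.sum_congr rfl fun i _ => e i, Finset.sum_add_distrib, radialDiv, fderiv_eq_sum]
  simp [mul_comm]

lemma integrableOn_Ioc_rpow {e : ℝ} (he : -1 < e) (ρ : ℝ) :
    IntegrableOn (fun s : ℝ => s ^ e) (Set.Ioc 0 ρ) := by
  rcases le_total 0 ρ with hρ | hρ
  · exact (intervalIntegrable_iff_integrableOn_Ioc_of_le hρ).1
      (intervalIntegral.intervalIntegrable_rpow' he)
  · simp [Set.Ioc_eq_empty (not_lt.2 hρ)]

lemma abs_setIntegral_Ioc_le {F : ℝ → ℝ} {A e ρ : ℝ} (he : -1 < e) (hρ : 0 ≤ ρ)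
    (h : ∀ s ∈ Set.Ioc 0 ρ, |F s| ≤ A * s ^ e) :
    |∫ s in Set.Ioc 0 ρ, F s| ≤ A * (ρ ^ (e + 1) / (e + 1)) := by
  have h1 := integrableOn_Ioc_rpow he ρ
  have h2 : ∫ s in Set.Ioc 0 ρ, A * s ^ e = A * (ρ ^ (e + 1) / (e + 1)) := by
    rw [integral_const_mul, ← intervalIntegral.integral_of_le hρ, integral_rpow (Or.inl he),
      Real.zero_rpow (by linarith), sub_zero]
  rw [← h2, ← Real.norm_eq_abs]
  exact norm_integral_le_of_norm_le (h1.const_mul A)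
    ((ae_restrict_iff' measurableSet_Ioc).2 (Eventually.of_forall h))

lemma abs_setIntegral_le_of_subset_Ioi {F : ℝ → ℝ} {A e ρ : ℝ} (he : e < -1) (hρ : 0 < ρ)
    (hA : 0 ≤ A) {S : Set ℝ} (hS : MeasurableSet S) (hSρ : S ⊆ Set.Ioi ρ)
    (h : ∀ s ∈ S, |F s| ≤ A * s ^ e) :
    |∫ s in S, F s| ≤ A * (ρ ^ (e + 1) / (-(e + 1))) := by
  have h1 : IntegrableOn (fun s : ℝ => s ^ e) (Set.Ioi ρ) := integrableOn_Ioi_rpow_of_lt he hρ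
  have h2 : ∫ s in Set.Ioi ρ, A * s ^ e = A * (ρ ^ (e + 1) / (-(e + 1))) := by
    rw [integral_const_mul, integral_Ioi_rpow_of_lt he hρ, div_neg, neg_div]
  rw [← h2, ← Real.norm_eq_abs]
  refine (norm_integral_le_of_norm_le ((h1.mono_set hSρ).const_mul A)
    ((ae_restrict_iff' hS).2 (Eventually.of_forall h))).trans ?_
  refine setIntegral_mono_set (h1.const_mul A) ?_ hSρ.eventuallyLE
  refine (ae_restrict_iff' measurableSet_Ioi).2 (Eventually.of_forall fun s hs => ?_)
  have : 0 < s := hρ.trans hs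
  simp only [Pi.zero_apply]
  positivity

end

section

variable {n : ℕ} {α ν C : ℝ} {u v : Euc n → ℝ}

/-! ### Integrals of averages over scales -/

/-- The integral over the scales `s ∈ S` of the averages of `g`, weighted by `s ^ e`. -/
def scaleInt (χ : Euc n → ℝ) (e : ℝ) (S : Set ℝ) (g : Euc n → ℝ) (x : Euc n) : ℝ :=
  ∫ s in S, s ^ e * ballAvg χ g s x

/-- `v` splits, at every scale `ρ`, into a near part built from `g` and a far part built
from `f`. -/
def ScaleSplit (θ χ : Euc n → ℝ) (e m : ℝ) (f g v : Euc n → ℝ) : Prop :=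
  ∀ ρ, 0 < ρ → ∀ x, v x = scaleInt θ e (Set.Ioc 0 ρ) g x + scaleInt χ (e - m) (Set.Ioi ρ) f x

variable {χ θ f g : Euc n → ℝ}

lemma IsKernel.aestronglyMeasurable_scale (h : IsKernel χ) (hg : Continuous g) (e : ℝ)
    (μ : Measure ℝ) (x : Euc n) : AEStronglyMeasurable (fun s => s ^ e * ballAvg χ g s x) μ := by
  have h1 : Continuous fun s => ballAvg χ g s x :=
    (h.continuous_ballAvg hg).comp (by fun_prop : Continuous fun s : ℝ => (s, x))
  exact ((measurable_id.pow_const e).mul h1.measurable).aestronglyMeasurable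

lemma IsKernel.integrableOn_scale (h : IsKernel χ) (hg : Continuous g) {e : ℝ} {S : Set ℝ}
    (hS : MeasurableSet S) {b : ℝ → ℝ} (hb : IntegrableOn b S) {x : Euc n}
    (hle : ∀ s ∈ S, |s ^ e * ballAvg χ g s x| ≤ b s) :
    IntegrableOn (fun s => s ^ e * ballAvg χ g s x) S :=
  Integrable.mono' hb (h.aestronglyMeasurable_scale hg e _ x)
    ((ae_restrict_iff' hS).2 (Eventually.of_forall hle))

lemma IsKernel.hasFDerivAt_scaleInt (h : IsKernel χ) (hg : Continuous g) {e : ℝ} {S : Set ℝ}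
    (hS : MeasurableSet S) (hS0 : S ⊆ Set.Ioi 0) {b : ℝ → ℝ} (hb : IntegrableOn b S)
    (hle : ∀ i x, ∀ s ∈ S, |s ^ (e - 1) * ballAvg (_root_.pder n χ i) g s x| ≤ b s) {x : Euc n}
    (hintg : IntegrableOn (fun s => s ^ e * ballAvg χ g s x) S) :
    HasFDerivAt (scaleInt χ e S g) (∑ i, scaleInt (_root_.pder n χ i) (e - 1) S g x •
      (EuclideanSpace.proj i : Euc n →L[ℝ] ℝ)) x := by
  have hi : ∀ i, IntegrableOn (fun s => s ^ (e - 1) * ballAvg (_root_.pder n χ i) g s x) S :=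
    fun i => (h.pder i).integrableOn_scale hg hS hb (hle i x)
  have key := hasFDerivAt_integral_of_dominated_of_fderiv_le (𝕜 := ℝ) (μ := volume.restrict S)
    (F := fun x s => s ^ e * ballAvg χ g s x)
    (F' := fun x s => ∑ i, (s ^ (e - 1) * ballAvg (_root_.pder n χ i) g s x) •
      (EuclideanSpace.proj i : Euc n →L[ℝ] ℝ)) (x₀ := x) (s := Set.univ) (bound := fun s => n * b s)
    Filter.univ_mem (Eventually.of_forall fun y => h.aestronglyMeasurable_scale hg e _ y) hintg
    (Finset.aestronglyMeasurable_fun_sum _ fun i _ =>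
      ((h.pder i).aestronglyMeasurable_scale hg (e - 1) _ x).smul_const _)
    ((ae_restrict_iff' hS).2 (Eventually.of_forall fun s hs y _ =>
      norm_sum_smul_proj_le fun i => hle i y s hs)) (hb.const_mul _)
    ((ae_restrict_iff' hS).2 (Eventually.of_forall fun s hs y _ => by
      refine ((h.hasFDerivAt_ballAvg hg (hS0 hs) y).const_mul (s ^ e)).congr_fderiv ?_
      rw [Finset.smul_sum]
      refine Finset.sum_congr rfl fun i _ => ?_
      rw [smul_smul, ← mul_assoc, Real.rpow_sub_one (ne_of_gt (hS0 hs)), div_eq_mul_inv]))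
  refine key.congr_fderiv ?_
  rw [integral_finsetSum _ fun i _ => (hi i).smul_const _]
  exact Finset.sum_congr rfl fun i _ => integral_smul_const _ _

lemma abs_rpow_mul_le {s e p t A : ℝ} (hs : 0 < s) (h : |t| ≤ A * s ^ p) :
    |s ^ e * t| ≤ A * s ^ (e + p) := by
  rw [abs_mul, abs_of_nonneg (by positivity), Real.rpow_add hs]
  calc _ ≤ s ^ e * (A * s ^ p) := by gcongr
    _ = _ := by ring

lemma ScaleSplit.pder (hn : 0 < n) {e m p a A C : ℝ} (hθ : IsKernel θ) (hχ : IsKernel χ)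
    (hf : Continuous f) (hg : Continuous g) (hp : 0 ≤ p) (hpn : p < n)
    (hfC : ∀ x, |f x| ≤ C * (1 + ‖x‖) ^ (-p)) (he : e - m - p < -1) (hea : 0 < e + a)
    (hA : ∀ s, 0 < s → ∀ x, |ballAvg θ g s x| ≤ A * s ^ a)
    (hA' : ∀ i s, 0 < s → ∀ x, |ballAvg (_root_.pder n θ i) g s x| ≤ A * s ^ a)
    (hv : ScaleSplit θ χ e m f g v) :
    Differentiable ℝ v ∧ ∀ i, ScaleSplit (_root_.pder n θ i) (_root_.pder n χ i) (e - 1) m f g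
      (_root_.pder n v i) := by
  have hfC' := nonneg_of_weighted_bound hfC
  obtain ⟨c₀, hc₀, H₀⟩ := hχ.abs_ballAvg_decay hn hp hpn
  choose c hc H using fun i => (hχ.pder i).abs_ballAvg_decay hn hp hpn
  have key : ∀ ρ, 0 < ρ → ∀ x, HasFDerivAt v (∑ i,
      (scaleInt (_root_.pder n θ i) (e - 1) (Set.Ioc 0 ρ) g x +
        scaleInt (_root_.pder n χ i) (e - 1 - m) (Set.Ioi ρ) f x) •
      (EuclideanSpace.proj i : Euc n →L[ℝ] ℝ)) x := by
    intro ρ hρ x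
    have h1 := hθ.hasFDerivAt_scaleInt hg (e := e) measurableSet_Ioc (Set.Ioc_subset_Ioi_self)
      (b := fun s => A * s ^ (e - 1 + a)) ((integrableOn_Ioc_rpow (by linarith) ρ).const_mul A)
      (fun i y s hs => abs_rpow_mul_le hs.1 (hA' i s hs.1 y)) (x := x)
      (hθ.integrableOn_scale hg measurableSet_Ioc (b := fun s => A * s ^ (e + a))
        ((integrableOn_Ioc_rpow (by linarith) ρ).const_mul A)
        fun s hs => abs_rpow_mul_le hs.1 (hA s hs.1 x))
    have h2 := hχ.hasFDerivAt_scaleInt hf (e := e - m) measurableSet_Ioi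
      (Set.Ioi_subset_Ioi hρ.le)
      (b := fun s => (∑ i, c i) * C * s ^ (e - m - 1 + -p))
      ((integrableOn_Ioi_rpow_of_lt (by linarith) hρ).const_mul _)
      (fun i y s hs => abs_rpow_mul_le (hρ.trans hs) ((H i f C hfC s (hρ.trans hs) y).trans (by
        have : 0 < s := hρ.trans hs
        have := Finset.single_le_sum (fun j _ => hc j) (Finset.mem_univ i)
        gcongr))) (x := x)
      (hχ.integrableOn_scale hf measurableSet_Ioi (b := fun s => c₀ * C * s ^ (e - m + -p))
        ((integrableOn_Ioi_rpow_of_lt (by linarith) hρ).const_mul _)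
        fun s hs => abs_rpow_mul_le (hρ.trans hs) (H₀ f C hfC s (hρ.trans hs) x))
    have e1 : v = fun x => scaleInt θ e (Set.Ioc 0 ρ) g x + scaleInt χ (e - m) (Set.Ioi ρ) f x :=
      funext fun x => hv ρ hρ x
    rw [e1]
    refine (h1.add h2).congr_fderiv ?_
    rw [← Finset.sum_add_distrib]
    refine Finset.sum_congr rfl fun i _ => ?_
    rw [add_smul, show e - m - 1 = e - 1 - m by ring]
  exact ⟨fun x => (key 1 one_pos x).differentiableAt, fun i ρ hρ x => (key ρ hρ x).pder_eq i⟩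

lemma ScaleSplit.pder_right (hn : 0 < n) {m p C : ℝ} (hθ : IsKernel θ) (hχ : IsKernel χ)
    (hf : Continuous f) (hp : 0 ≤ p) (hpn : p < n)
    (hfC : ∀ x, |f x| ≤ C * (1 + ‖x‖) ^ (-p)) (he : 1 - m - p < -1) {B : ℝ}
    (hg : Differentiable ℝ g) (hg' : ∀ i, Continuous (_root_.pder n g i))
    (hgB : ∀ x, |g x| ≤ B) (hv : ScaleSplit θ χ 1 m f g v) :
    Differentiable ℝ v ∧ ∀ i, ScaleSplit θ (_root_.pder n χ i) 1 (m + 1) f (_root_.pder n g i)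
      (_root_.pder n v i) := by
  have hB : 0 ≤ B := (abs_nonneg _).trans (hgB 0)
  have hs0 : ∀ i, 0 ≤ ∫ z, |_root_.pder n θ i z| := fun i => integral_nonneg fun z => abs_nonneg _
  have hs1 : 0 ≤ ∫ z, |θ z| := integral_nonneg fun z => abs_nonneg _
  obtain ⟨h1, h2⟩ := hv.pder hn (a := 0)
    (A := ((∫ z, |θ z|) + ∑ i, ∫ z, |_root_.pder n θ i z|) * B) hθ hχ hf hg.continuous hp hpn hfC he
    (by norm_num)
    (fun s hs x => by
      rw [Real.rpow_zero, mul_one]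
      refine (hθ.abs_ballAvg_le hs.le fun y _ => hgB y).trans ?_
      have := Finset.sum_nonneg fun i (_ : i ∈ Finset.univ) => hs0 i
      gcongr
      linarith)
    (fun i s hs x => by
      rw [Real.rpow_zero, mul_one]
      refine ((hθ.pder i).abs_ballAvg_le hs.le fun y _ => hgB y).trans ?_
      have := Finset.single_le_sum (fun j _ => hs0 j) (Finset.mem_univ i)
      gcongr
      linarith)
  refine ⟨h1, fun i ρ hρ x => ?_⟩
  rw [h2 i ρ hρ x, show (1:ℝ) - 1 - m = 1 - (m + 1) by ring]
  congr 1
  refine setIntegral_congr_fun measurableSet_Ioc fun s hs => ?_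
  simp only [sub_self, Real.rpow_zero, Real.rpow_one, one_mul]
  rw [hθ.ballAvg_pder hg i (hg' i) hs.1, mul_inv_cancel_left₀ hs.1.ne']

/-- Size estimate for functions with a scale splitting. -/
lemma ScaleSplit.bound (hn : 0 < n) {e m p a : ℝ} (hχ : IsKernel χ)
    (hp : 0 ≤ p) (hpn : p < n) (he : e - m - p < -1) (hea : -1 < e + a) :
    ∃ c, 0 ≤ c ∧ ∀ (θ f g v : Euc n → ℝ) (C : ℝ), (∀ x, |f x| ≤ C * (1 + ‖x‖) ^ (-p)) →
      (∀ s x, 0 < s → s ≤ (1 + ‖x‖) / 2 →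
        |ballAvg θ g s x| ≤ C * (1 + ‖x‖) ^ (-(m + p + a)) * s ^ a) →
      ScaleSplit θ χ e m f g v → ∀ x, |v x| ≤ c * C * (1 + ‖x‖) ^ (-(m + p - e - 1)) := by
  obtain ⟨c₀, hc₀, H₀⟩ := hχ.abs_ballAvg_decay hn hp hpn
  set d := m + p - e - 1 with hd
  have hd0 : 0 < d := by rw [hd]; linarith
  refine ⟨(1 / 2) ^ (e + a + 1) / (e + a + 1) + c₀ * ((1 / 2) ^ (-d) / d), by
    have : 0 < e + a + 1 := by linarith
    positivity, fun θ f g v C hf hg hv x => ?_⟩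
  have hC := nonneg_of_weighted_bound hf
  have hx := one_add_norm_pos x
  have hρ : 0 < (1 + ‖x‖) / 2 := by positivity
  rw [hv _ hρ x]
  have h1 := abs_setIntegral_Ioc_le (F := fun s => s ^ e * ballAvg θ g s x)
    (A := C * (1 + ‖x‖) ^ (-(m + p + a))) hea hρ.le
    fun s hs => abs_rpow_mul_le hs.1 (hg s x hs.1 hs.2)
  have h2 := abs_setIntegral_le_of_subset_Ioi (F := fun s => s ^ (e - m) * ballAvg χ f s x)
    (A := c₀ * C) (e := e - m + -p) (by linarith) hρ (by positivity) measurableSet_Ioi subset_rfl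
    fun s hs => abs_rpow_mul_le (hρ.trans hs) (H₀ f C hf s (hρ.trans hs) x)
  refine (abs_add_le _ _).trans ((add_le_add h1 h2).trans (le_of_eq ?_))
  rw [show e - m + -p + 1 = -d by rw [hd]; ring, neg_neg, div_eq_mul_inv (1 + ‖x‖) 2,
    Real.mul_rpow hx.le (by norm_num), Real.mul_rpow hx.le (by norm_num)]
  have e1 : (1 + ‖x‖) ^ (-(m + p + a)) * (1 + ‖x‖) ^ (e + a + 1) = (1 + ‖x‖) ^ (-d) := by
    rw [← Real.rpow_add hx]
    congr 1
    rw [hd]; ring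
  rw [show (2:ℝ)⁻¹ = 1 / 2 by norm_num]
  calc _ = C * ((1 + ‖x‖) ^ (-(m + p + a)) * (1 + ‖x‖) ^ (e + a + 1)) *
        ((1 / 2) ^ (e + a + 1) / (e + a + 1)) +
          c₀ * C * ((1 + ‖x‖) ^ (-d) * (1 / 2) ^ (-d) / d) := by
        ring
    _ = _ := by rw [e1]; ring

end

section

variable {n : ℕ} {α ν C : ℝ} {u v : Euc n → ℝ}

/-! ### Schauder estimates for scale integrals -/

variable {χ θ f g : Euc n → ℝ}

lemma HolderBound.abs_le (hν : 0 ≤ ν) (h : HolderBound n α ν C g) (x : Euc n) : |g x| ≤ C := by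
  have hC := nonneg_of_weighted_bound h.1
  refine (h.1 x).trans (mul_le_of_le_one_right hC ?_)
  exact Real.rpow_le_one_of_one_le_of_nonpos (by linarith [norm_nonneg x]) (by linarith)

lemma HolderBound.abs_sub_le (hνα : 0 ≤ ν + α) (h : HolderBound n α ν C g) (x y : Euc n) :
    |g x - g y| ≤ C * ‖x - y‖ ^ α := by
  have hC := nonneg_of_weighted_bound h.1
  wlog hxy : ‖x‖ ≤ ‖y‖ generalizing x y
  · rw [abs_sub_comm, norm_sub_rev]
    exact this y x (le_of_not_ge hxy)
  refine (h.2 x y hxy).trans ?_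
  gcongr
  exact mul_le_of_le_one_right hC
    (Real.rpow_le_one_of_one_le_of_nonpos (by linarith [norm_nonneg x]) (by linarith))

lemma IsKernel.abs_ballAvg_le_near (h : IsKernel χ) (hν : 0 ≤ ν) (hg : HolderBound n α ν C g)
    {s : ℝ} (hs : 0 < s) {x : Euc n} (hsx : s ≤ (1 + ‖x‖) / 2) :
    |ballAvg χ g s x| ≤ (∫ z, |χ z|) * (2 ^ ν * C * (1 + ‖x‖) ^ (-ν)) := by
  have hC := nonneg_of_weighted_bound hg.1
  refine h.abs_ballAvg_le hs.le fun y hy => (hg.1 y).trans ?_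
  have h1 := rpow_neg_half (one_add_norm_pos x) (b := 1 + ‖y‖)
    (by linarith [norm_sub_norm_le x y]) hν
  calc _ ≤ C * (2 ^ ν * (1 + ‖x‖) ^ (-ν)) := by gcongr
    _ = _ := by ring

lemma IsKernel.abs_ballAvg_le_near_of_integral_eq_zero (h : IsKernel χ) (h0 : ∫ z, χ z = 0)
    (hα : 0 < α) (hν : 0 ≤ ν) (hg : HolderBound n α ν C g)
    {s : ℝ} (hs : 0 < s) {x : Euc n} (hsx : s ≤ (1 + ‖x‖) / 2) :
    |ballAvg χ g s x| ≤
      (∫ z, |χ z|) * (2 ^ (ν + α) * C * (1 + ‖x‖) ^ (-(ν + α))) * s ^ α := by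
  have hC := nonneg_of_weighted_bound hg.1
  rw [mul_assoc]
  refine h.abs_ballAvg_le_of_integral_eq_zero h0 (hg.continuous hα) hs.le fun y hy => ?_
  refine (hg.near hα hν (hy.trans hsx)).trans ?_
  have := one_add_norm_pos x
  gcongr

lemma IsKernel.abs_ballAvg_sub_le (h : IsKernel χ) (hg : Continuous g) {s M R : ℝ} (hs : 0 < s)
    {x y : Euc n} (hM : ∀ i z, ‖x - z‖ ≤ R → |ballAvg (_root_.pder n χ i) g s z| ≤ M)
    (hy : ‖x - y‖ ≤ R) :
    |ballAvg χ g s x - ballAvg χ g s y| ≤ n * (s⁻¹ * M) * ‖x - y‖ := by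
  have hR : 0 ≤ R := (norm_nonneg _).trans hy
  refine (convex_closedBall x R).norm_image_sub_le_of_norm_hasFDerivWithin_le
    (f := ballAvg χ g s) (fun z _ => (h.hasFDerivAt_ballAvg hg hs z).hasFDerivWithinAt)
    (fun z hz => norm_sum_smul_proj_le fun i => ?_) ?_ (Metric.mem_closedBall_self hR)
  · rw [abs_mul, abs_of_pos (inv_pos.2 hs)]
    gcongr
    exact hM i z (by rwa [← dist_eq_norm, dist_comm, ← Metric.mem_closedBall])
  · rwa [Metric.mem_closedBall, dist_comm, dist_eq_norm]

lemma ScaleSplit.holderBound (hn : 0 < n) {m p : ℝ} (hα : 0 < α) (hα1 : α < 1)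
    (hθ : IsKernel θ) (hχ : IsKernel χ) (h0 : ∫ z, θ z = 0) (hp : 0 ≤ p) (hpn : p < n)
    (hmp : 0 < m + p) :
    ∃ c, 0 ≤ c ∧ ∀ (f g v : Euc n → ℝ) (C : ℝ), Continuous f →
      (∀ x, |f x| ≤ C * (1 + ‖x‖) ^ (-p)) → HolderBound n α (m + p) C g →
      ScaleSplit θ χ (-1) m f g v → HolderBound n α (m + p) (c * C) v := by
  obtain ⟨c₀, hc₀, H₀⟩ := ScaleSplit.bound hn (e := -1) (m := m) (a := α) hχ hp hpn (by linarith)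
    (by linarith)
  obtain ⟨c₁, hc₁, H₁⟩ := hχ.abs_ballAvg_decay hn hp hpn
  choose c₂ hc₂ H₂ using fun i => (hχ.pder i).abs_ballAvg_decay hn hp hpn
  set q := m + p with hq
  set I₀ := ∫ z, |θ z| with hI₀
  have hI₀' : 0 ≤ I₀ := integral_nonneg fun _ => abs_nonneg _
  set I₁ := ∑ i, ∫ z, |_root_.pder n θ i z| with hI₁
  have hI₁' : 0 ≤ I₁ := Finset.sum_nonneg fun _ _ => integral_nonneg fun _ => abs_nonneg _
  set c₃ := ∑ i, c₂ i with hc₃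
  have hc₃' : 0 ≤ c₃ := Finset.sum_nonneg fun i _ => hc₂ i
  set E := (2:ℝ) ^ (q + α) with hE
  have hE1 : 1 ≤ E := Real.one_le_rpow (by norm_num) (by linarith)
  -- constants for the three ranges of scales
  set k₁ := 2 * (I₀ * (E * E)) / α with hk₁
  set k₂ := n * (I₁ * (E * E)) / (1 - α) with hk₂
  set k₃ := n * c₃ * ((1 / 4) ^ (-(q + 1)) / (q + 1)) with hk₃
  have h1α : 0 < 1 - α := by linarith
  set K := max (c₀ * (1 + I₀ * E)) (k₁ + k₂ + k₃) with hK
  have hK0 : 0 ≤ K := le_max_of_le_left (by positivity)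
  refine ⟨2 * 8 ^ α * K, by positivity, fun f g v C hf hfC hg hv => ?_⟩
  have hC := nonneg_of_weighted_bound hfC
  have hgc := hg.continuous hα
  rw [mul_assoc]
  refine HolderBound.of_near hα hmp.le (by norm_num : (1:ℝ) ≤ 8) (fun x => ?_) (fun x y hxy => ?_)
  · have := H₀ θ f g v ((1 + I₀ * E) * C) (fun x => (hfC x).trans ?_) (fun s x hs hsx => ?_) hv x
    · refine this.trans ?_
      rw [show m + p - -1 - 1 = q by rw [hq]; ring, ← mul_assoc]
      have := one_add_norm_pos x
      gcongr
      exact le_max_left _ _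
    · have := one_add_norm_pos x
      gcongr
      exact le_mul_of_one_le_left hC (by nlinarith)
    · refine (hθ.abs_ballAvg_le_near_of_integral_eq_zero h0 hα hmp.le hg hs hsx).trans ?_
      have := one_add_norm_pos x
      calc _ = (I₀ * E) * C * (1 + ‖x‖) ^ (-(q + α)) * s ^ α := by ring
        _ ≤ _ := by gcongr; linarith
  · rcases eq_or_ne x y with rfl | hne
    · simp only [sub_self, abs_zero]
      positivity
    set h := 1 + ‖x‖ with hh
    have hpos : 0 < h := one_add_norm_pos x
    set r := ‖x - y‖ with hr
    have hr0 : 0 < r := norm_pos_iff.2 (sub_ne_zero.2 hne)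
    set ρ := h / 4 with hρ
    have hρ0 : 0 < ρ := by positivity
    have hrρ : r ≤ ρ := by rw [hρ]; linarith
    set w := h ^ (-(q + α)) with hw
    have hw0 : 0 < w := by positivity
    -- local bounds
    have hloc : ∀ (χ' : Euc n → ℝ), IsKernel χ' → ∫ z, χ' z = 0 → ∀ s, 0 < s → s ≤ ρ → ∀ z,
        ‖x - z‖ ≤ h / 8 → |ballAvg χ' g s z| ≤ (∫ z, |χ' z|) * (E * E) * (C * w) * s ^ α := by
      intro χ' hχ' h0' s hs hsρ z hz
      have hz1 : h / 2 ≤ 1 + ‖z‖ := by linarith [norm_sub_norm_le x z]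
      have hz2 : h * 7 / 8 ≤ 1 + ‖z‖ := by linarith [norm_sub_norm_le x z]
      refine (hχ'.abs_ballAvg_le_near_of_integral_eq_zero h0' hα hmp.le hg hs
        (by rw [hρ] at hsρ; linarith)).trans ?_
      have hI : 0 ≤ ∫ z, |χ' z| := integral_nonneg fun _ => abs_nonneg _
      have := rpow_neg_half hpos hz1 (p := q + α) (by linarith)
      calc _ ≤ (∫ z, |χ' z|) * (E * C * (E * w)) * s ^ α := by gcongr
        _ = _ := by ring
    have hintg₁ : ∀ z, IntegrableOn (fun s => s ^ (-1:ℝ) * ballAvg θ g s z) (Set.Ioc 0 ρ) := by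
      intro z
      refine hθ.integrableOn_scale hgc measurableSet_Ioc (b := fun s => I₀ * C * s ^ (-1 + α))
        ((integrableOn_Ioc_rpow (by linarith) ρ).const_mul _)
        fun s hs => abs_rpow_mul_le hs.1 ?_
      rw [mul_assoc]
      refine hθ.abs_ballAvg_le_of_integral_eq_zero h0 hgc hs.1.le fun y hy => ?_
      refine (hg.abs_sub_le (by linarith) _ _).trans ?_
      gcongr
    have hintg₂ : ∀ z, IntegrableOn (fun s => s ^ (-1 - m) * ballAvg χ f s z) (Set.Ioi ρ) := by
      intro z
      exact hχ.integrableOn_scale hf measurableSet_Ioi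
        (b := fun s => c₁ * C * s ^ (-1 - m + -p))
        ((integrableOn_Ioi_rpow_of_lt (by linarith) hρ0).const_mul _)
        fun s hs => abs_rpow_mul_le (hρ0.trans hs) (H₁ f C hfC s (hρ0.trans hs) z)
    have hsub : Set.Ioc 0 r ∪ Set.Ioc r ρ = Set.Ioc 0 ρ := Set.Ioc_union_Ioc_eq_Ioc hr0.le hrρ
    have hd := (hintg₁ x).sub (hintg₁ y)
    have hdec : v x - v y =
        (∫ s in Set.Ioc 0 r, s ^ (-1:ℝ) * (ballAvg θ g s x - ballAvg θ g s y)) +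
        (∫ s in Set.Ioc r ρ, s ^ (-1:ℝ) * (ballAvg θ g s x - ballAvg θ g s y)) +
        ∫ s in Set.Ioi ρ, s ^ (-1 - m) * (ballAvg χ f s x - ballAvg χ f s y) := by
      rw [hv ρ hρ0 x, hv ρ hρ0 y, ← setIntegral_union (Set.Ioc_disjoint_Ioc_of_le le_rfl)
        measurableSet_Ioc]
      · rw [hsub]
        simp only [mul_sub]
        rw [integral_sub (hintg₁ x) (hintg₁ y), integral_sub (hintg₂ x) (hintg₂ y)]
        simp only [scaleInt]
        ring
      · simp only [mul_sub]
        exact hd.mono_set (hsub ▸ Set.subset_union_left)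
      · simp only [mul_sub]
        exact hd.mono_set (hsub ▸ Set.subset_union_right)
    have b1 := abs_setIntegral_Ioc_le
      (F := fun s => s ^ (-1:ℝ) * (ballAvg θ g s x - ballAvg θ g s y))
      (A := 2 * (I₀ * (E * E) * (C * w))) (e := -1 + α) (ρ := r) (by linarith) hr0.le
      fun s hs => abs_rpow_mul_le hs.1 (by
        have := hloc θ hθ h0 s hs.1 (hs.2.trans hrρ)
        have h1 := this x (by simp; positivity)
        have h2 := this y hxy
        rw [← hI₀] at h1 h2
        calc _ ≤ _ := abs_sub _ _
          _ ≤ _ := add_le_add h1 h2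
          _ = _ := by ring)
    have b2 := abs_setIntegral_le_of_subset_Ioi
      (F := fun s => s ^ (-1:ℝ) * (ballAvg θ g s x - ballAvg θ g s y))
      (A := n * (I₁ * (E * E) * (C * w)) * r) (e := -1 + (α - 1)) (ρ := r) (S := Set.Ioc r ρ)
      (by linarith) hr0 (by positivity) measurableSet_Ioc Set.Ioc_subset_Ioi_self
      fun s hs => abs_rpow_mul_le (hr0.trans hs.1) (by
        have hs0 : 0 < s := hr0.trans hs.1
        refine (hθ.abs_ballAvg_sub_le hgc hs0 (R := h / 8) (M := I₁ * (E * E) * (C * w) * s ^ α)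
          (fun i z hz => ?_) hxy).trans (le_of_eq ?_)
        · refine (hloc _ (hθ.pder i) (hθ.integral_pder i) s hs0 hs.2 z hz).trans ?_
          have := Finset.single_le_sum (f := fun i => ∫ z, |_root_.pder n θ i z|)
            (fun i _ => integral_nonneg fun _ => abs_nonneg _) (Finset.mem_univ i)
          gcongr
        · rw [Real.rpow_sub_one hs0.ne', ← hr]
          field_simp)
    have b3 := abs_setIntegral_le_of_subset_Ioi
      (F := fun s => s ^ (-1 - m) * (ballAvg χ f s x - ballAvg χ f s y))
      (A := n * (c₃ * C) * r) (e := -1 - m + (-p - 1)) (ρ := ρ) (S := Set.Ioi ρ)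
      (by linarith) hρ0 (by positivity) measurableSet_Ioi subset_rfl
      fun s hs => abs_rpow_mul_le (hρ0.trans hs) (by
        have hs0 : 0 < s := hρ0.trans hs
        refine (hχ.abs_ballAvg_sub_le hf hs0 (R := h / 8) (M := c₃ * C * s ^ (-p))
          (fun i z hz => ?_) hxy).trans (le_of_eq ?_)
        · refine (H₂ i f C hfC s hs0 z).trans ?_
          have := Finset.single_le_sum (fun j _ => hc₂ j) (Finset.mem_univ i)
          gcongr
        · rw [Real.rpow_sub_one hs0.ne', ← hr]
          field_simp)
    rw [show -1 + α + 1 = α by ring] at b1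
    rw [show -1 + (α - 1) + 1 = α - 1 by ring, neg_sub] at b2
    rw [show -1 - m + (-p - 1) + 1 = -(q + 1) by rw [hq]; ring, neg_neg,
      show ρ ^ (-(q + 1)) = h ^ (-(q + 1)) * (1 / 4) ^ (-(q + 1)) by
        rw [hρ, div_eq_mul_one_div h 4, Real.mul_rpow hpos.le (by norm_num)]] at b3
    have e2 : r * r ^ (α - 1) = r ^ α := by
      rw [Real.rpow_sub_one hr0.ne']
      field_simp
    have e3 : h ^ (-(q + 1)) * r ≤ w * r ^ α := by
      have h1 : r ^ (1 - α) ≤ h ^ (1 - α) := by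
        gcongr
        linarith
      calc h ^ (-(q + 1)) * r = h ^ (-(q + 1)) * (r ^ (1 - α) * r ^ α) := by
            rw [← Real.rpow_add hr0, sub_add_cancel, Real.rpow_one]
        _ ≤ h ^ (-(q + 1)) * (h ^ (1 - α) * r ^ α) := by gcongr
        _ = w * r ^ α := by
            rw [← mul_assoc, ← Real.rpow_add hpos, hw]
            congr 2
            ring
    rw [hdec]
    refine (abs_add_three _ _ _).trans ?_
    have s2 : n * (I₁ * (E * E) * (C * w)) * r * (r ^ (α - 1) / (1 - α)) =
        k₂ * (C * w * r ^ α) := by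
      rw [hk₂, ← e2]; ring
    have s1 : 2 * (I₀ * (E * E) * (C * w)) * (r ^ α / α) = k₁ * (C * w * r ^ α) := by
      rw [hk₁]; ring
    have s3 : n * (c₃ * C) * r * (h ^ (-(q + 1)) * (1 / 4) ^ (-(q + 1)) / (q + 1)) ≤
        k₃ * (C * w * r ^ α) := by
      calc _ = k₃ * (C * (h ^ (-(q + 1)) * r)) := by rw [hk₃]; ring
        _ ≤ k₃ * (C * (w * r ^ α)) := by gcongr
        _ = _ := by ring
    calc _ ≤ k₁ * (C * w * r ^ α) + k₂ * (C * w * r ^ α) + k₃ * (C * w * r ^ α) := by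
          rw [← s1, ← s2]
          exact add_le_add (add_le_add b1 b2) (b3.trans s3)
      _ = (k₁ + k₂ + k₃) * (C * w * r ^ α) := by ring
      _ ≤ K * (C * w * r ^ α) := by gcongr; exact le_max_right _ _
      _ = _ := by ring

end

section

variable {n : ℕ} {α ν C : ℝ} {u v : Euc n → ℝ}

variable {χ θ f g : Euc n → ℝ}

lemma IsKernel.abs_ballAvg_le_of_holderBound (h : IsKernel χ) (hg : HolderBound n α ν C g)
    (hν : 0 ≤ ν) {M : ℝ} (hM : ∫ z, |χ z| ≤ M) (s : ℝ) (hs : 0 < s) (x : Euc n) :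
    |ballAvg χ g s x| ≤ M * C * s ^ (0:ℝ) := by
  have hC := nonneg_of_weighted_bound hg.1
  rw [Real.rpow_zero, mul_one]
  refine (h.abs_ballAvg_le hs.le fun y _ => hg.abs_le hν y).trans ?_
  gcongr

lemma IsKernel.abs_ballAvg_le_rpow_of_holderBound (h : IsKernel χ) (hα : 0 < α)
    (hg : HolderBound n α ν C g) (hν : 0 ≤ ν) (h0 : ∫ z, χ z = 0) {M : ℝ} (hM : ∫ z, |χ z| ≤ M)
    (s : ℝ) (hs : 0 < s) (x : Euc n) : |ballAvg χ g s x| ≤ M * C * s ^ α := by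
  have hC := nonneg_of_weighted_bound hg.1
  refine (h.abs_ballAvg_le_of_integral_eq_zero h0 (hg.continuous hα) hs.le fun y hy =>
    (hg.abs_sub_le (by linarith) _ _).trans (b := C * ‖x - y‖ ^ α) (c := C * s ^ α) ?_).trans ?_
  · gcongr
  · rw [← mul_assoc]
    gcongr

lemma ScaleSplit.bound_of_holderBound (hn : 0 < n) {e m p : ℝ} (hθ : IsKernel θ)
    (hχ : IsKernel χ) (hp : 0 ≤ p) (hpn : p < n) (hmp : 0 ≤ m + p) (he : e - m - p < -1)
    (he1 : -1 < e) :
    ∃ c, 0 ≤ c ∧ ∀ (f g v : Euc n → ℝ) (C : ℝ), (∀ x, |f x| ≤ C * (1 + ‖x‖) ^ (-p)) →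
      HolderBound n α (m + p) C g → ScaleSplit θ χ e m f g v →
      ∀ x, |v x| ≤ c * C * (1 + ‖x‖) ^ (-(m + p - e - 1)) := by
  obtain ⟨c, hc, H⟩ := ScaleSplit.bound hn (e := e) (m := m) (a := 0) hχ hp hpn he (by linarith)
  have hI : 0 ≤ ∫ z, |θ z| := integral_nonneg fun _ => abs_nonneg _
  refine ⟨c * (1 + (∫ z, |θ z|) * 2 ^ (m + p)), by positivity, fun f g v C hf hg hv x => ?_⟩
  have hC := nonneg_of_weighted_bound hf
  rw [mul_assoc c]
  refine H θ f g v _ (fun y => (hf y).trans ?_) (fun s y hs hsy => ?_) hv x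
  · have := one_add_norm_pos y
    gcongr
    exact le_mul_of_one_le_left hC (le_add_of_nonneg_right (by positivity))
  · have := one_add_norm_pos y
    refine (hθ.abs_ballAvg_le_near hmp hg hs hsy).trans ?_
    rw [add_zero, Real.rpow_zero, mul_one]
    calc _ = ((∫ z, |θ z|) * 2 ^ (m + p)) * C * (1 + ‖y‖) ^ (-(m + p)) := by ring
      _ ≤ _ := by gcongr; linarith

lemma ScaleSplit.pder_pder (hn : 0 < n) (hα : 0 < α) {m p : ℝ} (hθ : IsKernel θ)
    (hχ : IsKernel χ) (hf : Continuous f) (hp : 0 ≤ p) (hpn : p < n) (hmp : 0 ≤ m + p)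
    (he : 1 - m - p < -1) (hfC : ∀ x, |f x| ≤ C * (1 + ‖x‖) ^ (-p))
    (hg : HolderBound n α (m + p) C g) (hv : ScaleSplit θ χ 1 m f g v) :
    Differentiable ℝ v ∧ ∀ i, ScaleSplit (_root_.pder n θ i) (_root_.pder n χ i) 0 m f g
      (_root_.pder n v i) ∧ Differentiable ℝ (_root_.pder n v i) ∧
      ∀ j, ScaleSplit (_root_.pder n (_root_.pder n θ i) j) (_root_.pder n (_root_.pder n χ i) j)
        (-1) m f g (_root_.pder n (_root_.pder n v i) j) := by
  have hC := nonneg_of_weighted_bound hfC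
  have hgc := hg.continuous hα
  have hI : ∀ θ : Euc n → ℝ, 0 ≤ ∫ z, |θ z| := fun θ => integral_nonneg fun _ => abs_nonneg _
  have hs1 := fun (θ : Euc n → ℝ) i => Finset.single_le_sum
    (f := fun i => ∫ z, |_root_.pder n θ i z|) (fun i _ => hI _) (Finset.mem_univ i)
  obtain ⟨hv1, hvs⟩ := hv.pder hn (a := 0)
    (A := ((∫ z, |θ z|) + ∑ i, ∫ z, |_root_.pder n θ i z|) * C) hθ hχ hf hgc hp hpn hfC
    (by linarith) (by norm_num)
    (hθ.abs_ballAvg_le_of_holderBound hg hmp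
      (le_add_of_nonneg_right (Finset.sum_nonneg fun i _ => hI _)))
    (fun i => (hθ.pder i).abs_ballAvg_le_of_holderBound hg hmp
      ((hs1 θ i).trans (le_add_of_nonneg_left (hI θ))))
  rw [sub_self] at hvs
  refine ⟨hv1, fun i => ⟨hvs i, ?_⟩⟩
  have key := (hvs i).pder hn (a := α)
    (A := ((∫ z, |_root_.pder n θ i z|) + ∑ j, ∫ z, |_root_.pder n (_root_.pder n θ i) j z|) * C)
    (hθ.pder i) (hχ.pder i) hf hgc hp hpn hfC (by linarith) (by linarith)
    ((hθ.pder i).abs_ballAvg_le_rpow_of_holderBound hα hg hmp (hθ.integral_pder i)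
      (le_add_of_nonneg_right (Finset.sum_nonneg fun i _ => hI _)))
    (fun j => ((hθ.pder i).pder j).abs_ballAvg_le_rpow_of_holderBound hα hg hmp
      ((hθ.pder i).integral_pder j) ((hs1 _ j).trans (le_add_of_nonneg_left (hI _))))
  rwa [zero_sub] at key

lemma ScaleSplit.partialBound_two (hn : 0 < n) (hα : 0 < α) (hα1 : α < 1) (hν : 0 < ν)
    (hνn : ν + 2 < n) (hθ : IsKernel θ) (hχ : IsKernel χ) {m : ℝ} (hm : 0 ≤ m) :
    ∃ c, 0 ≤ c ∧ ∀ (f g v : Euc n → ℝ) (C : ℝ), Continuous f →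
      (∀ x, |f x| ≤ C * (1 + ‖x‖) ^ (-(ν + 2))) → HolderBound n α (m + (ν + 2)) C g →
      ScaleSplit θ χ 1 m f g v → PartialBound n α 2 (ν + m) (c * C) v := by
  have hp : 0 ≤ ν + 2 := by linarith
  obtain ⟨a, ha, A⟩ := ScaleSplit.bound_of_holderBound (α := α) hn (e := 1) (m := m) hθ hχ hp hνn
    (by linarith) (by linarith) (by norm_num)
  choose b hb B using fun i => ScaleSplit.bound_of_holderBound (α := α) hn (e := 0) (m := m)
    (hθ.pder i) (hχ.pder i) hp hνn (by linarith) (by linarith) (by norm_num)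
  choose d hd D using fun i j => ScaleSplit.holderBound (m := m) hn hα hα1 ((hθ.pder i).pder j)
    ((hχ.pder i).pder j) ((hθ.pder i).integral_pder j) hp hνn (by linarith)
  have hb' := fun i => Finset.single_le_sum (fun i _ => hb i) (Finset.mem_univ i)
  have hd₁ : ∀ i, 0 ≤ ∑ j, d i j := fun i => Finset.sum_nonneg fun j _ => hd i j
  have hd' : ∀ i j, d i j ≤ ∑ i, ∑ j, d i j := fun i j =>
    (Finset.single_le_sum (fun j _ => hd i j) (Finset.mem_univ j)).trans
      (Finset.single_le_sum (f := fun i => ∑ j, d i j) (fun i _ => hd₁ i) (Finset.mem_univ i))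
  have hbs : 0 ≤ ∑ i, b i := Finset.sum_nonneg fun i _ => hb i
  have hds : 0 ≤ ∑ i, ∑ j, d i j := Finset.sum_nonneg fun i _ => hd₁ i
  refine ⟨a + ∑ i, b i + ∑ i, ∑ j, d i j, by positivity, fun f g v C hf hfC hg hv => ?_⟩
  have hC := nonneg_of_weighted_bound hfC
  obtain ⟨hv1, hv2⟩ := hv.pder_pder hn hα hθ hχ hf hp hνn (by linarith) (by linarith) hfC hg
  refine ⟨hv1, fun x => (A f g v C hfC hg hv x).trans ?_, fun i => ⟨(hv2 i).2.1,
    fun x => (B i f g _ C hfC hg (hv2 i).1 x).trans ?_, fun j => ?_⟩⟩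
  · have := one_add_norm_pos x
    rw [show m + (ν + 2) - 1 - 1 = ν + m by ring]
    gcongr
    linarith
  · have := one_add_norm_pos x
    rw [show m + (ν + 2) - 0 - 1 = ν + m + 1 by ring]
    gcongr
    linarith [hb' i]
  · have := D i j f g _ C hf hfC hg ((hv2 i).2.2 j)
    rw [show m + (ν + 2) = ν + m + 1 + 1 by ring] at this
    refine HolderBound.mono this ?_
    gcongr
    linarith [hd' i j]

lemma ScaleSplit.partialBound (hn : 0 < n) (hα : 0 < α) (hα1 : α < 1) (hν : 0 < ν)
    (hνn : ν + 2 < n) (hθ : IsKernel θ) (k : ℕ) : ∀ {m : ℝ} {χ : Euc n → ℝ}, 0 ≤ m → IsKernel χ →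
    ∃ c, 0 ≤ c ∧ ∀ (f g v : Euc n → ℝ) (C : ℝ), Continuous f →
      (∀ x, |f x| ≤ C * (1 + ‖x‖) ^ (-(ν + 2))) → PartialBound n α k (m + (ν + 2)) C g →
      ScaleSplit θ χ 1 m f g v → PartialBound n α (k + 2) (ν + m) (c * C) v := by
  induction k with
  | zero => exact fun hm hχ => ScaleSplit.partialBound_two hn hα hα1 hν hνn hθ hχ hm
  | succ k ih =>
    intro m χ hm hχ
    have hp : 0 ≤ ν + 2 := by linarith
    obtain ⟨l, hl, L⟩ := PartialBound.level_le (n := n) hα hα1.le (Nat.zero_le (k + 1))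
      (ν := m + (ν + 2)) (by linarith)
    obtain ⟨a, ha, A⟩ := ScaleSplit.bound_of_holderBound (α := α) hn (e := 1) (m := m) hθ hχ hp hνn
      (by linarith) (by linarith) (by norm_num)
    choose b hb B using fun i => ih (m := m + 1) (by linarith) (hχ.pder i)
    have hb' := fun i => Finset.single_le_sum (fun i _ => hb i) (Finset.mem_univ i)
    have hbs : 0 ≤ ∑ i, b i := Finset.sum_nonneg fun i _ => hb i
    refine ⟨a * l + ∑ i, b i, by positivity, fun f g v C hf hfC hg hv => ?_⟩
    have hC := nonneg_of_weighted_bound hfC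
    have hg0 : HolderBound n α (m + (ν + 2)) (l * C) g := L g C hg
    obtain ⟨hv1, hvs⟩ := hv.pder_right hn hθ hχ hf hp hνn hfC (by linarith) hg.1
      (fun i => (hg.pder_bound i).continuous hα) (fun x => hg0.abs_le (by linarith) x)
    refine ⟨hv1, fun x => (A f g v (l * C) (fun y => (hfC y).trans ?_) hg0 hv x).trans ?_,
      fun i => ?_⟩
    · have := one_add_norm_pos y
      gcongr
      exact le_mul_of_one_le_left hC hl
    · have := one_add_norm_pos x
      rw [show m + (ν + 2) - 1 - 1 = ν + m by ring, ← mul_assoc]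
      gcongr
      linarith
    · have h1 : PartialBound n α k (m + 1 + (ν + 2)) C (_root_.pder n g i) := by
        rw [show m + 1 + (ν + 2) = m + (ν + 2) + 1 by ring]
        exact hg.pder_bound i
      have := B i f _ _ C hf hfC h1 (hvs i)
      rw [← add_assoc] at this
      refine this.mono ?_
      gcongr
      have := hb' i
      have : 0 ≤ a * l := by positivity
      linarith

end

section

variable {n : ℕ} {α ν C : ℝ} {u v : Euc n → ℝ}

variable {χ θ f g : Euc n → ℝ}

/-! ### The inverse Laplacian -/

lemma IsKernel.integrableOn_Ioi_scale (h : IsKernel χ) (hn : 0 < n) (hf : Continuous f)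
    {p e a A : ℝ} (hp : 0 ≤ p) (hpn : p < n) (hfC : ∀ x, |f x| ≤ C * (1 + ‖x‖) ^ (-p))
    (he : e - p < -1) (hea : -1 < e + a)
    (hA : ∀ s, 0 < s → ∀ x, |ballAvg χ f s x| ≤ A * s ^ a) (x : Euc n) :
    IntegrableOn (fun s => s ^ e * ballAvg χ f s x) (Set.Ioi 0) := by
  obtain ⟨c, hc, H⟩ := h.abs_ballAvg_decay hn hp hpn
  rw [← Set.Ioc_union_Ioi_eq_Ioi zero_le_one]
  refine IntegrableOn.union ?_ ?_
  · exact h.integrableOn_scale hf measurableSet_Ioc (b := fun s => A * s ^ (e + a))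
      ((integrableOn_Ioc_rpow hea 1).const_mul _) fun s hs => abs_rpow_mul_le hs.1 (hA s hs.1 x)
  · exact h.integrableOn_scale hf measurableSet_Ioi (b := fun s => c * C * s ^ (e + -p))
      ((integrableOn_Ioi_rpow_of_lt (by linarith) one_pos).const_mul _)
      fun s hs => abs_rpow_mul_le (one_pos.trans hs) (H f C hfC s (one_pos.trans hs) x)

lemma scaleInt_Ioi {e : ℝ} (hintg : ∀ x, IntegrableOn (fun s => s ^ e * ballAvg χ f s x)
    (Set.Ioi 0)) : ScaleSplit χ χ e 0 f f (scaleInt χ e (Set.Ioi 0) f) := by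
  intro ρ hρ x
  rw [sub_zero, scaleInt, ← Set.Ioc_union_Ioi_eq_Ioi hρ.le, setIntegral_union
    (Set.Ioc_disjoint_Ioi le_rfl) measurableSet_Ioi
    ((hintg x).mono_set Set.Ioc_subset_Ioi_self) ((hintg x).mono_set (Set.Ioi_subset_Ioi hρ.le))]
  rfl

lemma HolderBound.integrableOn_scale (hf : HolderBound n α ν C f) (hn : 0 < n) (hα : 0 < α)
    (h : IsKernel χ) {e : ℝ} (hν : 0 ≤ ν) (hνn : ν < n) (he : e - ν < -1) (he1 : -1 < e)
    (x : Euc n) : IntegrableOn (fun s => s ^ e * ballAvg χ f s x) (Set.Ioi 0) :=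
  h.integrableOn_Ioi_scale hn (hf.continuous hα) hν hνn hf.1 he (a := 0) (by linarith)
    (h.abs_ballAvg_le_of_holderBound hf hν le_rfl) x

lemma HolderBound.integrableOn_scale_of_integral_eq_zero (hf : HolderBound n α ν C f) (hn : 0 < n)
    (hα : 0 < α) (h : IsKernel χ) (h0 : ∫ z, χ z = 0) (hν : 0 < ν) (hνn : ν < n)
    (x : Euc n) : IntegrableOn (fun s => s ^ (-1:ℝ) * ballAvg χ f s x) (Set.Ioi 0) :=
  h.integrableOn_Ioi_scale hn (hf.continuous hα) hν.le hνn hf.1 (by linarith) (a := α)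
    (by linarith) (h.abs_ballAvg_le_rpow_of_holderBound hα hf hν.le h0 le_rfl) x

lemma sum_ballAvg_pder_pder_bump (hg : Continuous g) (s : ℝ) (x : Euc n) :
    ∑ i, ballAvg (pder n (pder n (bump n) i) i) g s x =
      ballAvg (radialDiv (bumpSlope n)) g s x := by
  simp only [ballAvg]
  rw [← integral_finsetSum _ fun i _ => (((isKernel_bump n).pder i).pder i).integrable_mul hg s x]
  refine integral_congr_ae (Eventually.of_forall fun z => ?_)
  simp only [← Finset.sum_mul, sum_pder_pder_bump]

lemma sum_scaleInt_pder_pder_bump (hn : 0 < n) (hα : 0 < α) (hν : 0 < ν) (hνn : ν < n)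
    (hg : HolderBound n α ν C g) (x : Euc n) :
    ∑ i, scaleInt (pder n (pder n (bump n) i) i) (-1) (Set.Ioi 0) g x =
      (∫ z, bumpSlope n z) * g x := by
  have hb := isKernel_bump n
  have hs := isKernel_bumpSlope n
  have hgc := hg.continuous hα
  have hintg := fun i => hg.integrableOn_scale_of_integral_eq_zero hn hα ((hb.pder i).pder i)
    ((hb.pder i).integral_pder i) hν hνn x
  have e1 : (fun s : ℝ => ∑ i, s ^ (-1:ℝ) * ballAvg (pder n (pder n (bump n) i) i) g s x) =
      fun s => s ^ (-1:ℝ) * ballAvg (radialDiv (bumpSlope n)) g s x := by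
    funext s
    rw [← Finset.mul_sum, sum_ballAvg_pder_pder_bump hgc]
  simp only [scaleInt]
  rw [← integral_finsetSum _ fun i _ => hintg i, e1]
  have hintg' : IntegrableOn (fun s : ℝ => s ^ (-1:ℝ) * ballAvg (radialDiv (bumpSlope n)) g s x)
      (Set.Ioi 0) := by
    rw [← e1]
    exact integrable_finsetSum _ fun i _ => hintg i
  obtain ⟨c, hc, H⟩ := hs.abs_ballAvg_decay hn hν.le hνn
  have hlim : Tendsto (fun s => ballAvg (bumpSlope n) g s x) atTop (nhds 0) := by
    refine squeeze_zero_norm' (a := fun s => c * C * s ^ (-ν)) ?_ ?_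
    · filter_upwards [eventually_gt_atTop 0] with s hs' using H g C hg.1 s hs' x
    · simpa using (tendsto_rpow_neg_atTop hν).const_mul (c * C)
  have key := integral_Ioi_of_hasDerivAt_of_tendsto (a := 0)
    (f := fun s => ballAvg (bumpSlope n) g s x)
    (f' := fun s => -(s ^ (-1:ℝ) * ballAvg (radialDiv (bumpSlope n)) g s x))
    ((hs.continuous_ballAvg hgc).comp (Continuous.prodMk_left x)).continuousAt.continuousWithinAt
    (fun s hs' => by
      simpa [Real.rpow_neg_one] using hs.hasDerivAt_ballAvg hgc hs' x) hintg'.neg hlim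
  rw [integral_neg, IsKernel.ballAvg_zero] at key
  linarith

/-- The inverse of the Laplacian on decaying functions. -/
def green (f : Euc n → ℝ) (x : Euc n) : ℝ :=
  (∫ z, bumpSlope n z)⁻¹ * scaleInt (bump n) 1 (Set.Ioi 0) f x

lemma HolderBound.scaleSplit (hf : HolderBound n α (ν + 2) C f) (hn : 0 < n) (hα : 0 < α)
    (hν : 0 < ν) (hνn : ν + 2 < n) :
    ScaleSplit (bump n) (bump n) 1 0 f f (scaleInt (bump n) 1 (Set.Ioi 0) f) :=
  scaleInt_Ioi fun x => hf.integrableOn_scale hn hα (isKernel_bump n) (by linarith) hνn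
    (by linarith) (by norm_num) x

lemma green_partialBound (hn : 0 < n) (hα : 0 < α) (hα1 : α < 1) (hν : 0 < ν) (hνn : ν + 2 < n)
    (k : ℕ) : ∃ c, 0 ≤ c ∧ ∀ (f : Euc n → ℝ) (C : ℝ), PartialBound n α k (ν + 2) C f →
      PartialBound n α (k + 2) ν (c * C) (green f) := by
  obtain ⟨c, hc, H⟩ := ScaleSplit.partialBound hn hα hα1 hν hνn (isKernel_bump n) k le_rfl
    (isKernel_bump n)
  obtain ⟨l, hl, L⟩ := PartialBound.level_le (n := n) hα hα1.le (Nat.zero_le k) (ν := ν + 2)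
    (by linarith)
  refine ⟨|(∫ z, bumpSlope n z)⁻¹| * c, by positivity, fun f C hf => ?_⟩
  have h0 : HolderBound n α (ν + 2) (l * C) f := L f C hf
  have := H f f _ C (hf.continuous hα) hf.bound (by rwa [zero_add])
    (h0.scaleSplit hn hα hν hνn)
  rw [add_zero] at this
  rw [mul_assoc]
  exact this.const_mul _

lemma pder_green_aux (hn : 0 < n) (hα : 0 < α) (hν : 0 < ν) (hνn : ν + 2 < n)
    (hf : HolderBound n α (ν + 2) C f) :
    (∀ i, pder n (green f) i = fun x => (∫ z, bumpSlope n z)⁻¹ *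
      scaleInt (pder n (bump n) i) 0 (Set.Ioi 0) f x) ∧
    ∀ i j, pder n (pder n (green f) i) j = fun x => (∫ z, bumpSlope n z)⁻¹ *
      scaleInt (pder n (pder n (bump n) i) j) (-1) (Set.Ioi 0) f x := by
  have hb := isKernel_bump n
  obtain ⟨h1, h2⟩ := (hf.scaleSplit hn hα hν hνn).pder_pder hn hα hb hb (hf.continuous hα)
    (by linarith) hνn (by linarith) (by linarith) hf.1 (by rwa [zero_add])
  have e1 : ∀ i, pder n (green f) i = fun x => (∫ z, bumpSlope n z)⁻¹ *
      pder n (scaleInt (bump n) 1 (Set.Ioi 0) f) i x := fun i => pder_const_mul h1 _ i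
  refine ⟨fun i => ?_, fun i j => ?_⟩
  · rw [e1]
    funext x
    rw [(h2 i).1 1 one_pos x, ← scaleInt_Ioi (fun x => hf.integrableOn_scale hn hα (hb.pder i)
      (by linarith) hνn (by linarith) (by norm_num) x) 1 one_pos x]
  · rw [e1, pder_const_mul (h2 i).2.1]
    funext x
    rw [(h2 i).2.2 j 1 one_pos x, ← scaleInt_Ioi (fun x =>
      hf.integrableOn_scale_of_integral_eq_zero hn hα ((hb.pder i).pder j)
        ((hb.pder i).integral_pder j) (by linarith) hνn x) 1 one_pos x]

lemma lap_green (hn : 0 < n) (hα : 0 < α) (hν : 0 < ν) (hνn : ν + 2 < n)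
    (hf : HolderBound n α (ν + 2) C f) : lap n (green f) = f := by
  funext x
  have h := (pder_green_aux hn hα hν hνn hf).2
  have h0 := integral_bumpSlope_ne_zero hn
  simp only [lap]
  calc _ = ∑ i, (∫ z, bumpSlope n z)⁻¹ *
        scaleInt (pder n (pder n (bump n) i) i) (-1) (Set.Ioi 0) f x :=
        Finset.sum_congr rfl fun i _ => congrFun (h i i) x
    _ = _ := by
        rw [← Finset.mul_sum, sum_scaleInt_pder_pder_bump hn hα (by linarith) hνn hf x]
        field_simp

lemma sum_pder_green_pder (hn : 0 < n) (hα : 0 < α) (hα1 : α < 1) (hν : 0 < ν) (hνn : ν + 2 < n)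
    (hf : PartialBound n α 1 (ν + 1) C f) (x : Euc n) :
    ∑ i, pder n (green (pder n f i)) i x = f x := by
  have h := fun i => (pder_green_aux hn hα hν hνn (f := pder n f i) (C := C) (by
    have := hf.pder_bound i
    rwa [show ν + 1 + 1 = ν + 2 by ring] at this)).1 i
  have h0 := integral_bumpSlope_ne_zero hn
  obtain ⟨c, -, hc⟩ := PartialBound.level_le (n := n) hα hα1.le (Nat.zero_le 1) (ν := ν + 1)
    (by linarith)
  have hf0 : HolderBound n α (ν + 1) (c * C) f := hc f C hf
  calc _ = ∑ i, (∫ z, bumpSlope n z)⁻¹ *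
        scaleInt (pder n (pder n (bump n) i) i) (-1) (Set.Ioi 0) f x := by
        refine Finset.sum_congr rfl fun i _ => ?_
        rw [h i]
        simp only [scaleInt]
        congr 1
        refine setIntegral_congr_fun measurableSet_Ioi fun s (hs : 0 < s) => ?_
        simp only [((isKernel_bump n).pder i).ballAvg_pder hf.1 i
          ((hf.pder_bound i).continuous hα) hs x, Real.rpow_zero, one_mul, Real.rpow_neg_one]
    _ = _ := by
        rw [← Finset.mul_sum, sum_scaleInt_pder_pder_bump hn hα (by linarith) (by linarith) hf0 x]
        field_simp

lemma ballAvg_lap (hα : 0 < α) (h : PartialBound n α 2 ν C u) {s : ℝ} (hs : 0 < s) (x : Euc n) :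
    s * ballAvg (bump n) (lap n u) s x = s⁻¹ * ballAvg (radialDiv (bumpSlope n)) u s x := by
  have hb := isKernel_bump n
  have hc := fun i => ((h.pder_bound i).pder_bound i).continuous hα
  have e1 : ballAvg (bump n) (lap n u) s x =
      ∑ i, ballAvg (bump n) (pder n (pder n u i) i) s x := by
    simp only [ballAvg, lap, Finset.mul_sum]
    exact integral_finsetSum _ fun i _ => hb.integrable_mul (hc i) s x
  rw [e1, ← sum_ballAvg_pder_pder_bump (h.continuous hα), Finset.mul_sum, Finset.mul_sum]
  refine Finset.sum_congr rfl fun i _ => ?_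
  rw [hb.ballAvg_pder (h.pder_bound i).1 i (hc i) hs x,
    (hb.pder i).ballAvg_pder h.1 i ((h.pder_bound i).continuous hα) hs x]
  field_simp

lemma green_lap (hn : 0 < n) (hα : 0 < α) (hα1 : α < 1) (hν : 0 < ν) (hνn : ν + 2 < n)
    (h : PartialBound n α 2 ν C u) : green (lap n u) = u := by
  funext x
  have h0 := integral_bumpSlope_ne_zero hn
  obtain ⟨c, -, hc⟩ := PartialBound.level_le (n := n) hα hα1.le (Nat.zero_le 2) hν.le
  have hu : HolderBound n α ν (c * C) u := hc u C h
  have hb := isKernel_bump n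
  have hintg := fun i => hu.integrableOn_scale_of_integral_eq_zero hn hα ((hb.pder i).pder i)
    ((hb.pder i).integral_pder i) hν (by linarith) x
  have key := sum_scaleInt_pder_pder_bump hn hα hν (by linarith) hu x
  simp only [scaleInt] at key
  rw [← integral_finsetSum _ fun i _ => hintg i] at key
  rw [green, scaleInt, setIntegral_congr_fun measurableSet_Ioi (g := fun s : ℝ =>
    ∑ i, s ^ (-1:ℝ) * ballAvg (pder n (pder n (bump n) i) i) u s x) fun s (hs : 0 < s) => by
      simp only [Real.rpow_one]
      rw [ballAvg_lap hα h hs x, ← Finset.mul_sum, sum_ballAvg_pder_pder_bump (h.continuous hα),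
        Real.rpow_neg_one], key]
  field_simp

lemma green_linear (hn : 0 < n) (hα : 0 < α) (hν : 0 < ν) (hνn : ν + 2 < n) {C' : ℝ}
    (hf : HolderBound n α (ν + 2) C f) (hg : HolderBound n α (ν + 2) C' g) (a b : ℝ) :
    green (fun x => a * f x + b * g x) = fun x => a * green f x + b * green g x := by
  funext x
  have hb := isKernel_bump n
  have e : ∀ s, ballAvg (bump n) (fun x => a * f x + b * g x) s x =
      a * ballAvg (bump n) f s x + b * ballAvg (bump n) g s x := fun s => by
    simp only [ballAvg]
    rw [← integral_const_mul, ← integral_const_mul, ← integral_add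
      ((hb.integrable_mul (hf.continuous hα) s x).const_mul a)
      ((hb.integrable_mul (hg.continuous hα) s x).const_mul b)]
    refine integral_congr_ae (Eventually.of_forall fun z => ?_)
    simp only
    ring
  have h1 := hf.integrableOn_scale hn hα hb (e := 1) (by linarith) hνn (by linarith)
    (by norm_num) x
  have h2 := hg.integrableOn_scale hn hα hb (e := 1) (by linarith) hνn (by linarith)
    (by norm_num) x
  have e2 : scaleInt (bump n) 1 (Set.Ioi 0) (fun x => a * f x + b * g x) x =
      a * scaleInt (bump n) 1 (Set.Ioi 0) f x + b * scaleInt (bump n) 1 (Set.Ioi 0) g x := by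
    simp only [scaleInt]
    rw [← integral_const_mul, ← integral_const_mul, ← integral_add (h1.const_mul a)
      (h2.const_mul b)]
    refine integral_congr_ae (Eventually.of_forall fun s => ?_)
    simp only [e]
    ring
  simp only [green, e2]
  ring

end

section

variable {n : ℕ} {α ν C : ℝ} {u v : Euc n → ℝ}

variable {f g : Euc n → ℝ}

/-! ### The inverse of the vector Laplacian -/

lemma PartialBound.contDiff {k : ℕ} (hα : 0 < α) (hν : 0 ≤ ν) (h : PartialBound n α k ν C u) :
    ContDiff ℝ k u := by
  obtain ⟨c, -, H⟩ := PartialBound.wBound (n := n) hα k hν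
  exact (H u C h).1

lemma pder_pder_comm (hu : ContDiff ℝ 2 u) (i j : Fin n) :
    pder n (pder n u i) j = pder n (pder n u j) i := by
  have hd : Differentiable ℝ (fderiv ℝ u) :=
    (hu.fderiv_right (m := 1) (by norm_num)).differentiable (by norm_num)
  have key : ∀ (i j : Fin n) (x : Euc n), pder n (pder n u i) j x =
      fderiv ℝ (fderiv ℝ u) x (EuclideanSpace.single j 1) (EuclideanSpace.single i 1) := by
    intro i j x
    have := ((hd x).hasFDerivAt.clm_apply
      (hasFDerivAt_const (EuclideanSpace.single i (1:ℝ) : Euc n) x)).fderiv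
    change fderiv ℝ (fun y => fderiv ℝ u y (EuclideanSpace.single i 1)) x _ = _
    rw [this]
    simp
  funext x
  rw [key, key]
  exact (hu.contDiffAt.isSymmSndFDerivAt (by simp)).eq _ _

lemma pder_linear (hu : Differentiable ℝ u) (hv : Differentiable ℝ v) (a b : ℝ) (i : Fin n) :
    pder n (fun x => a * u x + b * v x) i = fun x => a * pder n u i x + b * pder n v i x := by
  rw [pder_add (hu.const_mul a) (hv.const_mul b), pder_const_mul hu, pder_const_mul hv]

lemma divg_bound {k : ℕ} {X : Euc n → Euc n}
    (hX : ∀ j, PartialBound n α (k + 1) ν C fun x => X x j) :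
    PartialBound n α k (ν + 1) (n * C) (divg n X) := by
  have := PartialBound.sum Finset.univ (f := fun i => pder n (fun x => X x i) i)
    (D := fun _ => C) fun i _ => (hX i).pder_bound i
  rw [Finset.sum_const, Finset.card_univ, Fintype.card_fin, nsmul_eq_mul] at this
  exact this

lemma vLap_eq (hα : 0 < α) (hν : 0 ≤ ν) {X : Euc n → Euc n}
    (hX : ∀ j, PartialBound n α 2 ν C fun x => X x j) (x : Euc n) (j : Fin n) :
    vLap n X x j = -(1 / 2) * lap n (fun y => X y j) x
      - (1 / 2 - 1 / (n:ℝ)) * pder n (divg n X) j x := by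
  have hd : Differentiable ℝ (divg n X) := (divg_bound hX).1
  have hp : ∀ j k, Differentiable ℝ (pder n (fun y => X y j) k) :=
    fun j k => ((hX j).pder_bound k).1
  have e : ∀ k, pder n (fun y => confKill n X y j k) k x =
      (1 / 2) * (pder n (pder n (fun y => X y k) k) j x + pder n (pder n (fun y => X y j) k) k x)
        + -(1 / (n:ℝ) * if j = k then 1 else 0) * pder n (divg n X) k x := by
    intro k
    have h1 : (fun y => confKill n X y j k) = fun y => (1 / 2) *
        (pder n (fun y => X y k) j y + pder n (fun y => X y j) k y) +
        -(1 / (n:ℝ) * if j = k then 1 else 0) * divg n X y := by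
      funext y
      simp only [confKill]
      ring
    rw [h1, pder_linear ((hp k j).fun_add (hp j k)) hd, pder_add (hp k j) (hp j k),
      pder_pder_comm ((hX k).contDiff hα hν) j k]
  have e2 : pder n (divg n X) j x = ∑ k, pder n (pder n (fun y => X y k) k) j x := by
    have := congrFun (pder_sum Finset.univ (fun k => pder n (fun y => X y k) k)
      (fun k _ => hp k k) j) x
    exact this
  simp only [vLap, e, Finset.sum_add_distrib, ← Finset.mul_sum]
  rw [← e2]
  simp only [lap, mul_ite, mul_one, mul_zero, neg_ite, neg_zero, ite_mul, zero_mul,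
    Finset.sum_ite_eq, Finset.mem_univ, if_true]
  ring

/-- The divergence of the componentwise inverse Laplacian of `F`. -/
def greenDiv (F : Fin n → Euc n → ℝ) (x : Euc n) : ℝ := ∑ i, pder n (green (F i)) i x

/-- The inverse of the vector Laplacian on decaying vector fields. -/
def vGreen (F : Fin n → Euc n → ℝ) (x : Euc n) : Euc n :=
  WithLp.toLp 2 fun j =>
    -2 * green (F j) x + ((n:ℝ) - 2) / ((n:ℝ) - 1) * green (pder n (greenDiv F) j) x

lemma vGreen_apply (F : Fin n → Euc n → ℝ) (x : Euc n) (j : Fin n) : vGreen F x j =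
    -2 * green (F j) x + ((n:ℝ) - 2) / ((n:ℝ) - 1) * green (pder n (greenDiv F) j) x := rfl

lemma greenDiv_partialBound (hn : 0 < n) (hα : 0 < α) (hα1 : α < 1) (hν : 0 < ν)
    (hνn : ν + 2 < n) (k : ℕ) : ∃ c, 0 ≤ c ∧ ∀ (F : Fin n → Euc n → ℝ) (C : ℝ),
      (∀ i, PartialBound n α k (ν + 2) C (F i)) →
      PartialBound n α (k + 1) (ν + 1) (c * C) (greenDiv F) := by
  obtain ⟨c, hc, H⟩ := green_partialBound hn hα hα1 hν hνn k
  refine ⟨n * c, by positivity, fun F C hF => ?_⟩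
  have := PartialBound.sum Finset.univ (f := fun i => pder n (green (F i)) i)
    (D := fun _ => c * C) fun i _ => (H (F i) C (hF i)).pder_bound i
  rw [Finset.sum_const, Finset.card_univ, Fintype.card_fin, nsmul_eq_mul, ← mul_assoc] at this
  exact this

lemma PartialBound.pder_bound_add_two {k : ℕ} (h : PartialBound n α (k + 1) (ν + 1) C u)
    (i : Fin n) : PartialBound n α k (ν + 2) C (pder n u i) := by
  have := h.pder_bound i
  rwa [show ν + 1 + 1 = ν + 2 by ring] at this

lemma vGreen_partialBound (hn : 0 < n) (hα : 0 < α) (hα1 : α < 1) (hν : 0 < ν)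
    (hνn : ν + 2 < n) (k : ℕ) : ∃ c, 0 ≤ c ∧ ∀ (F : Fin n → Euc n → ℝ) (C : ℝ),
      (∀ i, PartialBound n α k (ν + 2) C (F i)) →
      ∀ j, PartialBound n α (k + 2) ν (c * C) fun x => vGreen F x j := by
  obtain ⟨c, hc, H⟩ := green_partialBound hn hα hα1 hν hνn k
  obtain ⟨d, hd, D⟩ := greenDiv_partialBound hn hα hα1 hν hνn k
  refine ⟨2 * c + |((n:ℝ) - 2) / ((n:ℝ) - 1)| * (c * d), by positivity, fun F C hF j => ?_⟩
  have h := ((H _ _ (hF j)).const_mul (-2)).add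
    ((H _ _ ((D F C hF).pder_bound_add_two j)).const_mul (((n:ℝ) - 2) / ((n:ℝ) - 1)))
  refine h.mono (le_of_eq ?_)
  rw [abs_neg, abs_two]
  ring

lemma vLap_vGreen (hn : 2 ≤ n) (hα : 0 < α) (hα1 : α < 1) (hν : 0 < ν) (hνn : ν + 2 < n)
    {F : Fin n → Euc n → ℝ} (hF : ∀ i, HolderBound n α (ν + 2) C (F i)) (x : Euc n) (j : Fin n) :
    vLap n (vGreen F) x j = F j x := by
  have hn0 : 0 < n := by omega
  obtain ⟨a, -, A⟩ := green_partialBound hn0 hα hα1 hν hνn 0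
  obtain ⟨b, -, B⟩ := vGreen_partialBound hn0 hα hα1 hν hνn 0
  obtain ⟨d, -, D⟩ := greenDiv_partialBound hn0 hα hα1 hν hνn 0
  have hd := D F C hF
  have hpd : ∀ j, HolderBound n α (ν + 2) (d * C) (pder n (greenDiv F) j) :=
    fun j => hd.pder_bound_add_two j
  have h1 := fun j => A _ _ (hF j)
  have h2 := fun j => A _ _ (hpd j)
  have e : ∀ j i, pder n (fun y => vGreen F y j) i = fun x => -2 * pder n (green (F j)) i x +
      ((n:ℝ) - 2) / ((n:ℝ) - 1) * pder n (green (pder n (greenDiv F) j)) i x := fun j i =>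
    pder_linear (h1 j).1 (h2 j).1 _ _ i
  have e1 : divg n (vGreen F) = fun x =>
      (-2 + ((n:ℝ) - 2) / ((n:ℝ) - 1)) * greenDiv F x := by
    funext x
    simp only [divg, e, Finset.sum_add_distrib, ← Finset.mul_sum]
    rw [sum_pder_green_pder hn0 hα hα1 hν hνn hd, greenDiv]
    ring
  have e2 : lap n (fun y => vGreen F y j) x =
      -2 * F j x + ((n:ℝ) - 2) / ((n:ℝ) - 1) * pder n (greenDiv F) j x := by
    have h3 : ∀ i, pder n (pder n (fun y => vGreen F y j) i) i x =
        -2 * pder n (pder n (green (F j)) i) i x + ((n:ℝ) - 2) / ((n:ℝ) - 1) *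
          pder n (pder n (green (pder n (greenDiv F) j)) i) i x := fun i => by
      rw [e, pder_linear ((h1 j).pder_bound i).1 ((h2 j).pder_bound i).1]
    have l1 := congrFun (lap_green hn0 hα hν hνn (hF j)) x
    have l2 := congrFun (lap_green hn0 hα hν hνn (hpd j)) x
    have h4 : lap n (fun y => vGreen F y j) x =
      ∑ i, pder n (pder n (fun y => vGreen F y j) i) i x := rfl
    rw [h4, ← l1, ← l2]
    simp only [h3, Finset.sum_add_distrib, ← Finset.mul_sum]
    rfl
  rw [vLap_eq hα hν.le (fun j => B F C hF j), e1, e2, pder_const_mul hd.1]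
  have hn2 : (2:ℝ) ≤ n := by exact_mod_cast hn
  have : (n:ℝ) - 1 ≠ 0 := by linarith
  have : (n:ℝ) ≠ 0 := by linarith
  field_simp
  ring

lemma eq_vGreen_of_vLap_eq (hn : 2 ≤ n) (hα : 0 < α) (hα1 : α < 1) (hν : 0 < ν)
    (hνn : ν + 2 < n) {F : Fin n → Euc n → ℝ} {C' : ℝ}
    (hF : ∀ i, HolderBound n α (ν + 2) C (F i)) {X : Euc n → Euc n}
    (hX : ∀ j, PartialBound n α 2 ν C' fun x => X x j) (h : ∀ x j, vLap n X x j = F j x) :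
    X = vGreen F := by
  have hn0 : 0 < n := by omega
  have hn2 : (2:ℝ) ≤ n := by exact_mod_cast hn
  have hne : (n:ℝ) - 1 ≠ 0 := by linarith
  have hne' : (n:ℝ) ≠ 0 := by linarith
  obtain ⟨a, -, A⟩ := green_partialBound hn0 hα hα1 hν hνn 0
  obtain ⟨d, -, D⟩ := greenDiv_partialBound hn0 hα hα1 hν hνn 0
  have hdv := divg_bound hX
  have hpd : ∀ j, HolderBound n α (ν + 2) (n * C') (pder n (divg n X) j) :=
    fun j => hdv.pder_bound_add_two j
  have e1 : ∀ j, (fun x => X x j) = fun x => -2 * green (F j) x +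
      (-2 * (1 / 2 - 1 / (n:ℝ))) * green (pder n (divg n X) j) x := by
    intro j
    rw [← green_lap hn0 hα hα1 hν hνn (hX j), ← green_linear hn0 hα hν hνn (hF j) (hpd j)]
    congr 1
    funext x
    have := vLap_eq hα hν.le hX x j
    rw [h x j] at this
    linarith
  have e2 : ∀ x, divg n X x = -2 * greenDiv F x + (-2 * (1 / 2 - 1 / (n:ℝ))) * divg n X x := by
    intro x
    have : divg n X x = ∑ j, (-2 * pder n (green (F j)) j x +
        (-2 * (1 / 2 - 1 / (n:ℝ))) * pder n (green (pder n (divg n X) j)) j x) := by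
      refine Finset.sum_congr rfl fun j _ => ?_
      rw [e1 j, pder_linear (A _ _ (hF j)).1 (A _ _ (hpd j)).1]
    rw [Finset.sum_add_distrib, ← Finset.mul_sum, ← Finset.mul_sum,
      sum_pder_green_pder hn0 hα hα1 hν hνn hdv] at this
    exact this
  have e3 : divg n X = fun x => (-(n:ℝ) / ((n:ℝ) - 1)) * greenDiv F x := by
    funext x
    have := e2 x
    field_simp at this ⊢
    linarith
  have hd := D F C hF
  funext x
  ext j
  have h1 := congrFun (e1 j) x
  simp only at h1
  rw [h1, vGreen_apply, e3, pder_const_mul hd.1]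
  have h2 := green_linear hn0 hα hν hνn (hd.pder_bound_add_two j) (hd.pder_bound_add_two j)
    (-(n:ℝ) / ((n:ℝ) - 1)) 0
  simp only [zero_mul, add_zero] at h2
  rw [h2]
  field_simp

lemma vGreen_sub (hn : 0 < n) (hα : 0 < α) (hα1 : α < 1) (hν : 0 < ν) (hνn : ν + 2 < n)
    {F G : Fin n → Euc n → ℝ} {C' : ℝ} (hF : ∀ i, HolderBound n α (ν + 2) C (F i))
    (hG : ∀ i, HolderBound n α (ν + 2) C' (G i)) (x : Euc n) (j : Fin n) :
    vGreen (fun i x => F i x - G i x) x j = vGreen F x j - vGreen G x j := by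
  obtain ⟨a, -, A⟩ := green_partialBound hn hα hα1 hν hνn 0
  obtain ⟨d, -, D⟩ := greenDiv_partialBound hn hα hα1 hν hνn 0
  have hs : ∀ {f g : Euc n → ℝ} {C C' : ℝ}, HolderBound n α (ν + 2) C f →
      HolderBound n α (ν + 2) C' g →
      green (fun x => f x - g x) = fun x => 1 * green f x + (-1) * green g x :=
    fun {f g C C'} hf hg => by
      rw [← green_linear hn hα hν hνn hf hg]
      congr 1
      funext x
      ring
  have e : greenDiv (fun i x => F i x - G i x) =
      fun x => 1 * greenDiv F x + (-1) * greenDiv G x := by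
    funext x
    simp only [greenDiv, Finset.mul_sum]
    rw [← Finset.sum_add_distrib]
    refine Finset.sum_congr rfl fun i _ => ?_
    rw [hs (hF i) (hG i), pder_linear (A _ _ (hF i)).1 (A _ _ (hG i)).1]
  have hdF := D F C hF
  have hdG := D G C' hG
  rw [vGreen_apply, vGreen_apply, vGreen_apply, hs (hF j) (hG j), e,
    pder_linear hdF.1 hdG.1, green_linear hn hα hν hνn (hdF.pder_bound_add_two j)
      (hdG.pder_bound_add_two j)]
  ring

end

section

variable {n : ℕ} {α ν C : ℝ} {u v : Euc n → ℝ}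

/-! ### Nonlinear estimates -/

lemma confKill_partialBound (hn : 0 < n) {k : ℕ} {X : Euc n → Euc n}
    (hX : ∀ j, PartialBound n α (k + 1) ν C fun x => X x j) (i j : Fin n) :
    PartialBound n α k (ν + 1) (2 * C) fun x => confKill n X x i j := by
  have hC := (hX i).nonneg
  have h := (((hX j).pder_bound i).add ((hX i).pder_bound j)).const_mul (1 / 2) |>.sub
    ((divg_bound hX).const_mul (1 / (n:ℝ) * if i = j then 1 else 0))
  have e : (fun x => confKill n X x i j) = fun x =>
      1 / 2 * (pder n (fun y => X y j) i x + pder n (fun y => X y i) j x) -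
        (1 / (n:ℝ) * if i = j then 1 else 0) * divg n X x := by
    funext x
    rw [confKill]
    ring
  rw [e]
  refine h.mono ?_
  have hn' : (0:ℝ) < n := by exact_mod_cast hn
  have h1 : |1 / (n:ℝ) * if i = j then 1 else 0| * (n * C) ≤ C := by
    split_ifs
    · rw [mul_one, abs_of_pos (by positivity)]
      field_simp
      exact le_rfl
    · simpa using hC
  rw [abs_of_pos (by norm_num : (0:ℝ) < 1 / 2)]
  linarith

lemma confKill_sub {X Y Z : Euc n → Euc n} (hX : ∀ j, Differentiable ℝ fun x => X x j)
    (hY : ∀ j, Differentiable ℝ fun x => Y x j) (hZ : ∀ x j, Z x j = X x j - Y x j)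
    (x : Euc n) (i j : Fin n) :
    confKill n Z x i j = confKill n X x i j - confKill n Y x i j := by
  have e : ∀ i j, pder n (fun y => Z y j) i x =
      pder n (fun y => X y j) i x - pder n (fun y => Y y j) i x := fun i j => by
    have h1 : (fun y => Z y j) = fun y => 1 * X y j + (-1) * Y y j := by
      funext y
      rw [hZ]
      ring
    rw [h1, pder_linear (hX j) (hY j)]
    ring
  simp only [confKill, divg, e, Finset.sum_sub_distrib]
  ring

lemma PartialBound.sq_mul_one_add_rpow (hα : 0 < α) (hα1 : α ≤ 1) (hν : 0 ≤ ν) {p : ℝ}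
    (hp : 0 ≤ p) (k : ℕ) (a M : ℝ) : ∃ c, 0 ≤ c ∧ ∀ (A ψ : Euc n → ℝ) (S : ℝ),
      PartialBound n α k p S A → PartialBound n α k ν M ψ → (∀ x, |ψ x| ≤ 1 / 2) →
      PartialBound n α k (p + p) (c * (S * S)) fun x => A x ^ 2 * (1 + ψ x) ^ a := by
  obtain ⟨c₁, hc₁, H₁⟩ := PartialBound.mul (n := n) hα hα1 k hp hp
  obtain ⟨c₂, hc₂, H₂⟩ := PartialBound.mul (n := n) hα hα1 k (add_nonneg hp hp) le_rfl
  obtain ⟨r, R⟩ := PartialBound.one_add_rpow (n := n) hα hα1 hν k a M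
  refine ⟨c₂ * c₁ * |r|, by positivity, fun A ψ S hA hψ hψ' => ?_⟩
  have h := H₂ _ _ _ _ (H₁ A A S S hA hA) ((R ψ hψ hψ').mono (le_abs_self r))
  rw [add_zero] at h
  have e : (fun x => A x ^ 2 * (1 + ψ x) ^ a) = fun x => A x * A x * (1 + ψ x) ^ a := by
    funext x
    rw [sq]
  rw [e]
  exact h.mono (le_of_eq (by ring))

lemma HolderBound.sq_mul_one_add_rpow_sub (hα : 0 < α) (hα1 : α ≤ 1) (hν : 0 ≤ ν) {p : ℝ}
    (hp : 0 ≤ p) (a : ℝ) : ∃ c, 0 ≤ c ∧ ∀ (A B ψ₁ ψ₂ : Euc n → ℝ) (S D : ℝ),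
      HolderBound n α p S A → HolderBound n α p S B →
      HolderBound n α p (S * D) (fun x => A x - B x) →
      HolderBound n α ν (1 / 2) ψ₁ → HolderBound n α ν (1 / 2) ψ₂ →
      HolderBound n α ν D (fun x => ψ₁ x - ψ₂ x) →
      HolderBound n α (p + p) (c * (S * S * D))
        fun x => A x ^ 2 * (1 + ψ₁ x) ^ a - B x ^ 2 * (1 + ψ₂ x) ^ a := by
  obtain ⟨c₁, hc₁, H₁⟩ := PartialBound.mul (n := n) hα hα1 0 hp hp
  obtain ⟨c₂, hc₂, H₂⟩ := PartialBound.mul (n := n) hα hα1 0 (add_nonneg hp hp) le_rfl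
  obtain ⟨r, R⟩ := PartialBound.one_add_rpow (n := n) hα hα1 hν 0 a (1 / 2)
  obtain ⟨d, hd, L⟩ := HolderBound.one_add_rpow_sub (n := n) (α := α) hν a
  refine ⟨c₂ * c₁ * (2 * |r| + d), by positivity, fun A B ψ₁ ψ₂ S D hA hB hAB h₁ h₂ hD => ?_⟩
  have hr := (R ψ₁ h₁ (h₁.abs_le hν)).mono (le_abs_self r)
  have hr' := PartialBound.weaken (n := n) (k := 0) (ν' := 0) hν (L ψ₁ ψ₂ D h₁ h₂ hD)
  have hs : PartialBound n α 0 p (S + S) fun x => A x + B x :=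
    PartialBound.add (k := 0) hA hB
  have h := PartialBound.add (H₂ _ _ _ _ (H₁ _ _ _ _ hAB hs) hr)
    (H₂ _ _ _ _ (H₁ B B S S hB hB) hr')
  rw [add_zero] at h
  have e : (fun x => A x ^ 2 * (1 + ψ₁ x) ^ a - B x ^ 2 * (1 + ψ₂ x) ^ a) = fun x =>
      (A x - B x) * (A x + B x) * (1 + ψ₁ x) ^ a +
        B x * B x * ((1 + ψ₁ x) ^ a - (1 + ψ₂ x) ^ a) := by
    funext x
    ring
  rw [e]
  exact PartialBound.mono (k := 0) (le_of_eq (by ring)) h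

/-- The right-hand side of the momentum constraint `L W = F`. -/
def momentumSource (τ ψ : Euc n → ℝ) (i : Fin n) (x : Euc n) : ℝ :=
  -(((n:ℝ) - 1) / n) * ((1 + ψ x) ^ (2 * (n:ℝ) / ((n:ℝ) - 2)) * pder n τ i x)

/-- The right-hand side of the Lichnerowicz equation `Δ ψ = N`. -/
def lichSource (W : Euc n → Euc n) (τ ψ : Euc n → ℝ) (x : Euc n) : ℝ :=
  -(((n:ℝ) - 2) / (4 * ((n:ℝ) - 1))) * (∑ i, ∑ j, confKill n W x i j ^ 2 *
      (1 + ψ x) ^ ((-3 * (n:ℝ) + 2) / ((n:ℝ) - 2))) +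
    ((n:ℝ) - 2) / (4 * (n:ℝ)) * (τ x ^ 2 * (1 + ψ x) ^ (((n:ℝ) + 2) / ((n:ℝ) - 2)))

lemma momentumSource_partialBound (hα : 0 < α) (hα1 : α ≤ 1) (hν : 0 ≤ ν) {p : ℝ}
    (hp : 0 ≤ p) (k : ℕ) (M : ℝ) : ∃ c, 0 ≤ c ∧ ∀ (τ ψ : Euc n → ℝ) (T : ℝ),
      (∀ i, PartialBound n α k p T (pder n τ i)) → PartialBound n α k ν M ψ →
      (∀ x, |ψ x| ≤ 1 / 2) → ∀ i, PartialBound n α k p (c * T) (momentumSource τ ψ i) := by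
  obtain ⟨c₁, hc₁, H₁⟩ := PartialBound.mul (n := n) hα hα1 k le_rfl hp
  obtain ⟨r, R⟩ := PartialBound.one_add_rpow (n := n) hα hα1 hν k
    (2 * (n:ℝ) / ((n:ℝ) - 2)) M
  refine ⟨|(-(((n:ℝ) - 1) / n))| * (c₁ * |r|), by positivity, fun τ ψ T hτ hψ hψ' i => ?_⟩
  have h := (H₁ _ _ _ _ ((R ψ hψ hψ').mono (le_abs_self r)) (hτ i)).const_mul
    (-(((n:ℝ) - 1) / n))
  rw [zero_add] at h
  exact h.mono (le_of_eq (by ring))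

lemma momentumSource_sub_holderBound (hα : 0 < α) (hα1 : α ≤ 1) (hν : 0 ≤ ν) {p : ℝ}
    (hp : 0 ≤ p) : ∃ c, 0 ≤ c ∧ ∀ (τ ψ₁ ψ₂ : Euc n → ℝ) (T D : ℝ),
      (∀ i, HolderBound n α p T (pder n τ i)) →
      HolderBound n α ν (1 / 2) ψ₁ → HolderBound n α ν (1 / 2) ψ₂ →
      HolderBound n α ν D (fun x => ψ₁ x - ψ₂ x) →
      ∀ i, HolderBound n α p (c * (T * D))
        fun x => momentumSource τ ψ₁ i x - momentumSource τ ψ₂ i x := by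
  obtain ⟨c₁, hc₁, H₁⟩ := PartialBound.mul (n := n) hα hα1 0 le_rfl hp
  obtain ⟨d, hd, L⟩ := HolderBound.one_add_rpow_sub (n := n) (α := α) hν
    (2 * (n:ℝ) / ((n:ℝ) - 2))
  refine ⟨|(-(((n:ℝ) - 1) / n))| * (c₁ * d), by positivity, fun τ ψ₁ ψ₂ T D hτ h₁ h₂ hD i => ?_⟩
  have hr' := PartialBound.weaken (n := n) (k := 0) (ν' := 0) hν (L ψ₁ ψ₂ D h₁ h₂ hD)
  have h := (H₁ _ _ _ _ hr' (hτ i)).const_mul (-(((n:ℝ) - 1) / n))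
  rw [zero_add] at h
  have e : (fun x => momentumSource τ ψ₁ i x - momentumSource τ ψ₂ i x) = fun x =>
      -(((n:ℝ) - 1) / n) * (((1 + ψ₁ x) ^ (2 * (n:ℝ) / ((n:ℝ) - 2)) -
        (1 + ψ₂ x) ^ (2 * (n:ℝ) / ((n:ℝ) - 2))) * pder n τ i x) := by
    funext x
    simp only [momentumSource]
    ring
  rw [e]
  exact PartialBound.mono (k := 0) (le_of_eq (by ring)) h

lemma PartialBound.sum_sum {k : ℕ} {f : Fin n → Fin n → Euc n → ℝ}
    (h : ∀ i j, PartialBound n α k ν C (f i j)) :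
    PartialBound n α k ν (n * n * C) fun x => ∑ i, ∑ j, f i j x := by
  have h' := PartialBound.sum Finset.univ (f := fun i x => ∑ j, f i j x)
    (D := fun _ => ∑ _ : Fin n, C) fun i _ =>
      PartialBound.sum Finset.univ (f := fun j => f i j) (D := fun _ => C) fun j _ => h i j
  refine h'.mono (le_of_eq ?_)
  simp [mul_assoc]

lemma lichSource_partialBound (hn : 0 < n) (hα : 0 < α) (hα1 : α ≤ 1) (hν : 0 ≤ ν) {p : ℝ}
    (hp : 0 ≤ p) (k : ℕ) (M : ℝ) : ∃ c, 0 ≤ c ∧ ∀ (W : Euc n → Euc n) (τ ψ : Euc n → ℝ) (S : ℝ),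
      (∀ i, PartialBound n α (k + 1) p S fun x => W x i) → PartialBound n α k (p + 1) S τ →
      PartialBound n α k ν M ψ → (∀ x, |ψ x| ≤ 1 / 2) →
      PartialBound n α k (p + 1 + (p + 1)) (c * (S * S)) (lichSource W τ ψ) := by
  have hp1 : 0 ≤ p + 1 := by linarith
  obtain ⟨c₁, hc₁, H₁⟩ := PartialBound.sq_mul_one_add_rpow (n := n) hα hα1 hν hp1 k
    ((-3 * (n:ℝ) + 2) / ((n:ℝ) - 2)) M
  obtain ⟨c₂, hc₂, H₂⟩ := PartialBound.sq_mul_one_add_rpow (n := n) hα hα1 hν hp1 k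
    (((n:ℝ) + 2) / ((n:ℝ) - 2)) M
  refine ⟨|(-(((n:ℝ) - 2) / (4 * ((n:ℝ) - 1))))| * (n * n * (4 * c₁)) +
    |((n:ℝ) - 2) / (4 * (n:ℝ))| * c₂, by positivity, fun W τ ψ S hW hτ hψ hψ' => ?_⟩
  have h1 := (PartialBound.sum_sum fun i j =>
    H₁ _ ψ _ (confKill_partialBound hn hW i j) hψ hψ').const_mul
      (-(((n:ℝ) - 2) / (4 * ((n:ℝ) - 1))))
  have h2 := (H₂ τ ψ S hτ hψ hψ').const_mul (((n:ℝ) - 2) / (4 * (n:ℝ)))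
  exact (h1.add h2).mono (le_of_eq (by ring))

lemma lichSource_sub_holderBound (hn : 0 < n) (hα : 0 < α) (hα1 : α ≤ 1) (hν : 0 ≤ ν) {p : ℝ}
    (hp : 0 ≤ p) : ∃ c, 0 ≤ c ∧
      ∀ (V W Z : Euc n → Euc n) (τ ψ₁ ψ₂ : Euc n → ℝ) (S D : ℝ),
      (∀ i, PartialBound n α 1 p S fun x => V x i) →
      (∀ i, PartialBound n α 1 p S fun x => W x i) →
      (∀ i, PartialBound n α 1 p (S * D) fun x => Z x i) →
      (∀ x i, Z x i = V x i - W x i) → HolderBound n α (p + 1) S τ →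
      HolderBound n α ν (1 / 2) ψ₁ → HolderBound n α ν (1 / 2) ψ₂ →
      HolderBound n α ν D (fun x => ψ₁ x - ψ₂ x) →
      HolderBound n α (p + 1 + (p + 1)) (c * (S * S * D))
        fun x => lichSource V τ ψ₁ x - lichSource W τ ψ₂ x := by
  have hp1 : 0 ≤ p + 1 := by linarith
  set a := (-3 * (n:ℝ) + 2) / ((n:ℝ) - 2) with ha
  set b := ((n:ℝ) + 2) / ((n:ℝ) - 2) with hb
  obtain ⟨c₁, hc₁, H₁⟩ := HolderBound.sq_mul_one_add_rpow_sub (n := n) hα hα1 hν hp1 a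
  obtain ⟨c₂, hc₂, H₂⟩ := HolderBound.sq_mul_one_add_rpow_sub (n := n) hα hα1 hν hp1 b
  refine ⟨|(-(((n:ℝ) - 2) / (4 * ((n:ℝ) - 1))))| * (n * n * (4 * c₁)) +
    |((n:ℝ) - 2) / (4 * (n:ℝ))| * c₂, by positivity,
    fun V W Z τ ψ₁ ψ₂ S D hV hW hZ hVW hτ h₁ h₂ hD => ?_⟩
  have hS := nonneg_of_weighted_bound hτ.1
  have hD0 := nonneg_of_weighted_bound hD.1
  have hdiff : ∀ i j, HolderBound n α (p + 1) (2 * S * D)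
      fun x => confKill n V x i j - confKill n W x i j := fun i j => by
    have e : (fun x => confKill n V x i j - confKill n W x i j) = fun x => confKill n Z x i j :=
      funext fun x => (confKill_sub (fun j => (hV j).1) (fun j => (hW j).1) hVW x i j).symm
    rw [e]
    exact (confKill_partialBound (k := 0) hn hZ i j).mono (le_of_eq (by ring))
  have h1 := PartialBound.const_mul (k := 0) (-(((n:ℝ) - 2) / (4 * ((n:ℝ) - 1))))
    (PartialBound.sum_sum (k := 0) fun i j => H₁ _ _ ψ₁ ψ₂ _ D
      (confKill_partialBound (k := 0) hn hV i j) (confKill_partialBound (k := 0) hn hW i j)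
      (hdiff i j) h₁ h₂ hD)
  have hz : HolderBound n α (p + 1) (S * D) fun x => τ x - τ x := by
    have := PartialBound.mono (k := 0) (mul_nonneg hS hD0) (PartialBound.zero n α 0 (p + 1))
    simpa [PartialBound] using this
  have h2 := PartialBound.const_mul (k := 0) (((n:ℝ) - 2) / (4 * (n:ℝ)))
    (H₂ τ τ ψ₁ ψ₂ S D hτ hτ hz h₁ h₂ hD)
  have h := PartialBound.mono (k := 0)
    (C' := (|(-(((n:ℝ) - 2) / (4 * ((n:ℝ) - 1))))| * (n * n * (4 * c₁)) +
    |((n:ℝ) - 2) / (4 * (n:ℝ))| * c₂) * (S * S * D)) (le_of_eq (by ring)) (h1.add h2)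
  have e : (fun x => lichSource V τ ψ₁ x - lichSource W τ ψ₂ x) = fun x =>
      -(((n:ℝ) - 2) / (4 * ((n:ℝ) - 1))) * (∑ i, ∑ j, (confKill n V x i j ^ 2 * (1 + ψ₁ x) ^ a -
        confKill n W x i j ^ 2 * (1 + ψ₂ x) ^ a)) +
      ((n:ℝ) - 2) / (4 * (n:ℝ)) * (τ x ^ 2 * (1 + ψ₁ x) ^ b - τ x ^ 2 * (1 + ψ₂ x) ^ b) := by
    funext x
    simp only [lichSource, Finset.sum_sub_distrib]
    ring
  rw [e]
  exact h

end

section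

variable {n : ℕ} {α ν C : ℝ} {u v : Euc n → ℝ}

/-! ### The fixed point formulation of the constraint system -/

/-- The solution `W` of the momentum constraint with conformal factor `1 + ψ`. -/
def momentumField (τ ψ : Euc n → ℝ) : Euc n → Euc n := vGreen (momentumSource τ ψ)

/-- The map whose fixed points solve the constraint system. -/
def constraintMap (τ ψ : Euc n → ℝ) : Euc n → ℝ :=
  green (lichSource (momentumField τ ψ) τ ψ)

lemma constraintMap_partialBound (hn : 0 < n) (hα : 0 < α) (hα1 : α < 1) (hν : 0 < ν)
    (hνn : ν + 2 < n) {j k : ℕ} (hjk : j ≤ k) (hk : 1 ≤ k) (M : ℝ) :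
    ∃ c, 0 ≤ c ∧ ∀ (τ ψ : Euc n → ℝ) (T : ℝ), T ≤ 1 → PartialBound n α k (ν / 2 + 1) T τ →
      PartialBound n α j ν M ψ → (∀ x, |ψ x| ≤ 1 / 2) →
      (∀ i, HolderBound n α (ν / 2 + 2) (c * T) (momentumSource τ ψ i)) ∧
      (∀ i, PartialBound n α (j + 1) (ν / 2) (c * T) fun x => momentumField τ ψ x i) ∧
      PartialBound n α j (ν + 2) (c * T) (lichSource (momentumField τ ψ) τ ψ) ∧
      PartialBound n α (j + 2) ν (c * T) (constraintMap τ ψ) := by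
  have hμ : 0 < ν / 2 := by linarith
  have hμn : ν / 2 + 2 < n := by linarith
  have hμ1 : 0 ≤ ν / 2 + 1 := by linarith
  have hμ2 : 0 ≤ ν / 2 + 2 := by linarith
  obtain ⟨i, hik, hij, hji⟩ : ∃ i, i + 1 ≤ k ∧ i ≤ j ∧ j + 1 ≤ i + 2 :=
    ⟨min j (k - 1), by omega, by omega, by omega⟩
  obtain ⟨c₀, hc₀, H₀⟩ := PartialBound.level_le (n := n) hα hα1.le hjk hμ1
  obtain ⟨c₁, hc₁, H₁⟩ := PartialBound.level_le (n := n) hα hα1.le hik hμ1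
  obtain ⟨c₂, hc₂, H₂⟩ := PartialBound.level_le (n := n) hα hα1.le hij hν.le
  obtain ⟨c₃, hc₃, H₃⟩ := momentumSource_partialBound (n := n) hα hα1.le hν.le hμ2 i (c₂ * M)
  obtain ⟨c₄, hc₄, H₄⟩ := vGreen_partialBound hn hα hα1 hμ hμn i
  obtain ⟨c₅, hc₅, H₅⟩ := PartialBound.level_le (n := n) hα hα1.le hji hμ.le
  obtain ⟨c₆, hc₆, H₆⟩ := lichSource_partialBound hn hα hα1.le hν.le hμ.le j M
  obtain ⟨c₇, hc₇, H₇⟩ := green_partialBound hn hα hα1 hν hνn j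
  obtain ⟨c₈, hc₈, H₈⟩ := PartialBound.level_le (n := n) hα hα1.le (Nat.zero_le i) hμ2
  set s := c₀ + c₅ * (c₄ * (c₃ * c₁)) with hs
  have hs0 : 0 ≤ s := by positivity
  refine ⟨c₈ * (c₃ * c₁) + s + c₆ * (s * s) + c₇ * (c₆ * (s * s)), by positivity,
    fun τ ψ T hT hτ hψ hψ' => ?_⟩
  have hT0 := hτ.nonneg
  have hF := H₃ τ ψ _ (fun l => (H₁ τ T hτ).pder_bound_add_two l) (H₂ ψ M hψ) hψ'
  have hW : ∀ l, PartialBound n α (j + 1) (ν / 2) (s * T) fun x => momentumField τ ψ x l :=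
    fun l => (H₅ _ _ (H₄ _ _ hF l)).mono (by
      have : 0 ≤ c₀ * T := by positivity
      linear_combination this)
  have hτ' : PartialBound n α j (ν / 2 + 1) (s * T) τ := (H₀ τ T hτ).mono (by
    have : 0 ≤ c₅ * (c₄ * (c₃ * c₁)) * T := by positivity
    linear_combination this)
  have hN := H₆ _ τ ψ _ hW hτ' hψ hψ'
  rw [show ν / 2 + 1 + (ν / 2 + 1) = ν + 2 by ring] at hN
  have hTT : T * T ≤ T := mul_le_of_le_one_left hT0 hT
  have hN' : PartialBound n α j (ν + 2) (c₆ * (s * s) * T)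
      (lichSource (momentumField τ ψ) τ ψ) := hN.mono (by
    have := mul_le_mul_of_nonneg_left hTT (show 0 ≤ c₆ * (s * s) by positivity)
    linear_combination this)
  have e₁ : 0 ≤ c₈ * (c₃ * c₁) * T := by positivity
  have e₂ : 0 ≤ s * T := by positivity
  have e₃ : 0 ≤ c₆ * (s * s) * T := by positivity
  have e₄ : 0 ≤ c₇ * (c₆ * (s * s)) * T := by positivity
  exact ⟨fun l => HolderBound.mono (H₈ _ _ (hF l)) (by linear_combination e₂ + e₃ + e₄),
    fun l => (hW l).mono (by linear_combination e₁ + e₃ + e₄),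
    hN'.mono (by linear_combination e₁ + e₂ + e₄),
    (H₇ _ _ hN').mono (by linear_combination e₁ + e₂ + e₃)⟩

lemma constraintMap_sub_holderBound (hn : 0 < n) (hα : 0 < α) (hα1 : α < 1) (hν : 0 < ν)
    (hνn : ν + 2 < n) {k : ℕ} (hk : 1 ≤ k) :
    ∃ c, 0 ≤ c ∧ ∀ (τ ψ₁ ψ₂ : Euc n → ℝ) (T D : ℝ), T ≤ 1 →
      PartialBound n α k (ν / 2 + 1) T τ →
      HolderBound n α ν (1 / 2) ψ₁ → HolderBound n α ν (1 / 2) ψ₂ →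
      HolderBound n α ν D (fun x => ψ₁ x - ψ₂ x) →
      HolderBound n α ν (c * T * D) fun x => constraintMap τ ψ₁ x - constraintMap τ ψ₂ x := by
  have hμ : 0 < ν / 2 := by linarith
  have hμn : ν / 2 + 2 < n := by linarith
  have hμ1 : 0 ≤ ν / 2 + 1 := by linarith
  have hμ2 : 0 ≤ ν / 2 + 2 := by linarith
  obtain ⟨c₀, hc₀, H₀⟩ := PartialBound.level_le (n := n) hα hα1.le (Nat.zero_le k) hμ1
  obtain ⟨c₁, hc₁, H₁⟩ := PartialBound.level_le (n := n) hα hα1.le hk hμ1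
  obtain ⟨c₂, hc₂, H₂⟩ := constraintMap_partialBound hn hα hα1 hν hνn (Nat.zero_le k) hk (1 / 2)
  obtain ⟨c₃, hc₃, H₃⟩ := momentumSource_sub_holderBound (n := n) hα hα1.le hν.le hμ2
  obtain ⟨c₄, hc₄, H₄⟩ := vGreen_partialBound hn hα hα1 hμ hμn 0
  obtain ⟨c₅, hc₅, H₅⟩ := PartialBound.level_le (n := n) hα hα1.le (one_le_two) hμ.le
  obtain ⟨c₆, hc₆, H₆⟩ := lichSource_sub_holderBound hn hα hα1.le hν.le hμ.le
  obtain ⟨c₇, hc₇, H₇⟩ := green_partialBound hn hα hα1 hν hνn 0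
  obtain ⟨c₈, hc₈, H₈⟩ := PartialBound.level_le (n := n) hα hα1.le (Nat.zero_le 2) hν.le
  set s := c₀ + c₂ + c₅ * (c₄ * (c₃ * c₁)) with hs
  have hs0 : 0 ≤ s := by positivity
  refine ⟨c₈ * (c₇ * (c₆ * (s * s))), by positivity, fun τ ψ₁ ψ₂ T D hT hτ h₁ h₂ hD => ?_⟩
  have hT0 := hτ.nonneg
  have hD0 := nonneg_of_weighted_bound hD.1
  obtain ⟨hF₁, hW₁, hN₁, -⟩ := H₂ τ ψ₁ T hT hτ h₁ (h₁.abs_le hν.le)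
  obtain ⟨hF₂, hW₂, hN₂, -⟩ := H₂ τ ψ₂ T hT hτ h₂ (h₂.abs_le hν.le)
  have hZ := H₄ _ _ (H₃ τ ψ₁ ψ₂ _ D
    (fun l => (H₁ τ T hτ).pder_bound_add_two (k := 0) l) h₁ h₂ hD)
  have e₁ : 0 ≤ c₀ * T := by positivity
  have e₂ : 0 ≤ c₂ * T := by positivity
  have e₃ : 0 ≤ c₅ * (c₄ * (c₃ * c₁)) * T := by positivity
  have hc2 : c₂ * T ≤ s * T := by linear_combination e₁ + e₃
  have hN := H₆ _ _ _ τ ψ₁ ψ₂ (s * T) D (fun l => (hW₁ l).mono hc2) (fun l => (hW₂ l).mono hc2)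
    (fun l => (H₅ _ _ (hZ l)).mono (by
      have := mul_nonneg (add_nonneg e₁ e₂) hD0
      linear_combination this))
    (vGreen_sub hn hα hα1 hμ hμn hF₁ hF₂)
    (HolderBound.mono (H₀ τ T hτ) (by linear_combination e₂ + e₃)) h₁ h₂ hD
  rw [show ν / 2 + 1 + (ν / 2 + 1) = ν + 2 by ring] at hN
  have e : (fun x => constraintMap τ ψ₁ x - constraintMap τ ψ₂ x) =
      green fun x => lichSource (momentumField τ ψ₁) τ ψ₁ x -
        lichSource (momentumField τ ψ₂) τ ψ₂ x := by
    have := green_linear hn hα hν hνn hN₁ hN₂ 1 (-1)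
    simp only [one_mul, neg_one_mul, ← sub_eq_add_neg] at this
    exact this.symm
  rw [e]
  refine HolderBound.mono (H₈ _ _ (H₇ _ _ hN)) ?_
  have hTT : T * T ≤ T := mul_le_of_le_one_left hT0 hT
  have := mul_le_mul_of_nonneg_left hTT (show 0 ≤ c₈ * (c₇ * (c₆ * (s * s))) * D by positivity)
  linear_combination this

/-! ### Contractions of weighted Hölder balls -/

lemma HolderBound.of_tendsto {w : ℕ → Euc n → ℝ} (h : ∀ m, HolderBound n α ν C (w m))
    (hw : ∀ x, Tendsto (fun m => w m x) atTop (nhds (u x))) : HolderBound n α ν C u :=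
  ⟨fun x => le_of_tendsto (hw x).abs (Eventually.of_forall fun m => (h m).1 x),
    fun x y hxy => le_of_tendsto ((hw x).sub (hw y)).abs
      (Eventually.of_forall fun m => (h m).2 x y hxy)⟩

lemma eq_of_forall_holderBound_half_pow (hν : 0 ≤ ν)
    (h : ∀ m : ℕ, HolderBound n α ν ((1 / 2) ^ m) fun x => u x - v x) : u = v := by
  funext x
  have ht : Tendsto (fun m : ℕ => ((1:ℝ) / 2) ^ m) atTop (nhds 0) :=
    tendsto_pow_atTop_nhds_zero_of_lt_one (by norm_num) (by norm_num)
  have := ge_of_tendsto' ht fun m => (h m).abs_le hν x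
  exact sub_eq_zero.1 (abs_eq_zero.1 (le_antisymm this (abs_nonneg _)))

lemma HolderBound.sub_of_half {u v : Euc n → ℝ} (hu : HolderBound n α ν (1 / 2) u)
    (hv : HolderBound n α ν (1 / 2) v) : HolderBound n α ν 1 fun x => u x - v x := by
  have := PartialBound.sub (k := 0) hu hv
  norm_num at this
  exact this

variable {Φ : (Euc n → ℝ) → Euc n → ℝ}

lemma fixedPoint_unique_of_half_contraction (hν : 0 ≤ ν)
    (hc : ∀ ψ₁ ψ₂ D, HolderBound n α ν (1 / 2) ψ₁ → HolderBound n α ν (1 / 2) ψ₂ →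
      HolderBound n α ν D (fun x => ψ₁ x - ψ₂ x) →
      HolderBound n α ν (1 / 2 * D) fun x => Φ ψ₁ x - Φ ψ₂ x)
    (hu : HolderBound n α ν (1 / 2) u) (hv : HolderBound n α ν (1 / 2) v)
    (hu' : Φ u = u) (hv' : Φ v = v) : u = v := by
  refine eq_of_forall_holderBound_half_pow (α := α) hν fun m => ?_
  induction m with
  | zero => simpa using hu.sub_of_half hv
  | succ m ih =>
    have := hc u v _ hu hv ih
    rw [hu', hv', ← pow_succ'] at this
    exact this

lemma exists_fixedPoint_of_half_contraction (hν : 0 ≤ ν)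
    (hm : ∀ ψ, HolderBound n α ν (1 / 2) ψ → HolderBound n α ν (1 / 2) (Φ ψ))
    (hc : ∀ ψ₁ ψ₂ D, HolderBound n α ν (1 / 2) ψ₁ → HolderBound n α ν (1 / 2) ψ₂ →
      HolderBound n α ν D (fun x => ψ₁ x - ψ₂ x) →
      HolderBound n α ν (1 / 2 * D) fun x => Φ ψ₁ x - Φ ψ₂ x) :
    ∃ ψ, HolderBound n α ν (1 / 2) ψ ∧ Φ ψ = ψ := by
  set w : ℕ → Euc n → ℝ := fun m => Φ^[m] fun _ => 0 with hw
  have hsucc : ∀ m, w (m + 1) = Φ (w m) := fun m => Function.iterate_succ_apply' Φ m _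
  have hb : ∀ m, HolderBound n α ν (1 / 2) (w m) := by
    intro m
    induction m with
    | zero => exact HolderBound.mono (PartialBound.zero n α 0 ν) (by norm_num)
    | succ m ih =>
      rw [hsucc]
      exact hm _ ih
  have hd : ∀ m p, HolderBound n α ν ((1 / 2) ^ m) fun x => w m x - w (m + p) x := by
    intro m p
    induction m with
    | zero => simpa using (hb 0).sub_of_half (hb (0 + p))
    | succ m ih =>
      have := hc _ _ _ (hb m) (hb (m + p)) ih
      rwa [← hsucc, ← hsucc, ← pow_succ', show m + p + 1 = m + 1 + p by ring] at this
  have ht : Tendsto (fun m : ℕ => ((1:ℝ) / 2) ^ m) atTop (nhds 0) :=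
    tendsto_pow_atTop_nhds_zero_of_lt_one (by norm_num) (by norm_num)
  have hlim : ∀ x, ∃ l, Tendsto (fun m => w m x) atTop (nhds l) := fun x => by
    refine cauchySeq_tendsto_of_complete (cauchySeq_of_le_tendsto_0' (fun m => (1 / 2) ^ m)
      (fun m p hmp => ?_) ht)
    obtain ⟨p, rfl⟩ := Nat.exists_eq_add_of_le hmp
    exact (hd m p).abs_le hν x
  choose ψ hψ using hlim
  have hψb : HolderBound n α ν (1 / 2) ψ := HolderBound.of_tendsto hb hψ
  have hdψ : ∀ m, HolderBound n α ν ((1 / 2) ^ m) fun x => w m x - ψ x := fun m => by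
    refine HolderBound.of_tendsto (hd m) fun x => tendsto_const_nhds.sub ?_
    simpa [add_comm] using (tendsto_add_atTop_iff_nat m).2 (hψ x)
  refine ⟨ψ, hψb, eq_of_forall_holderBound_half_pow (α := α) hν fun m => ?_⟩
  have h1 := hdψ (m + 1)
  have h2 := hc _ _ _ (hb m) hψb (hdψ m)
  rw [← hsucc, ← pow_succ'] at h2
  have h := PartialBound.sub (k := 0) h1 h2
  refine HolderBound.mono (C := (1 / 2) ^ (m + 1) + (1 / 2) ^ (m + 1)) ?_
    (le_of_eq (by rw [pow_succ]; ring))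
  simpa [PartialBound] using h

end

section

variable {n : ℕ} {α ν C : ℝ} {u v : Euc n → ℝ}

/-! ### Regularity of fixed points and equivalence with the constraint system -/

lemma fixedPoint_partialBound (hn : 0 < n) (hα : 0 < α) (hα1 : α < 1) (hν : 0 < ν)
    (hνn : ν + 2 < n) {k : ℕ} (hk : 1 ≤ k) :
    ∃ c, 0 ≤ c ∧ ∀ (τ ψ : Euc n → ℝ) (T : ℝ), T ≤ 1 → PartialBound n α k (ν / 2 + 1) T τ →
      HolderBound n α ν (1 / 2) ψ → constraintMap τ ψ = ψ →
      PartialBound n α (k + 2) ν (c * T) ψ ∧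
      ∀ i, PartialBound n α (k + 1) (ν / 2) (c * T) fun x => momentumField τ ψ x i := by
  have key : ∀ j ≤ k, ∃ M, ∀ (τ ψ : Euc n → ℝ) (T : ℝ), T ≤ 1 →
      PartialBound n α k (ν / 2 + 1) T τ → HolderBound n α ν (1 / 2) ψ →
      constraintMap τ ψ = ψ → PartialBound n α j ν M ψ := by
    intro j hj
    induction j with
    | zero => exact ⟨1 / 2, fun τ ψ T _ _ hψ _ => hψ⟩
    | succ j ih =>
      obtain ⟨M, hM⟩ := ih (by omega)
      obtain ⟨c, hc, H⟩ :=
        constraintMap_partialBound hn hα hα1 hν hνn (show j ≤ k by omega) hk M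
      obtain ⟨l, hl, L⟩ := PartialBound.level_le (n := n) hα hα1.le (j + 1).le_succ hν.le
      refine ⟨l * c, fun τ ψ T hT hτ hψ hfix => ?_⟩
      have h := (H τ ψ T hT hτ (hM τ ψ T hT hτ hψ hfix) (hψ.abs_le hν.le)).2.2.2
      rw [hfix] at h
      refine (L _ _ h).mono ?_
      gcongr
      exact mul_le_of_le_one_right hc hT
  obtain ⟨M, hM⟩ := key k le_rfl
  obtain ⟨c, hc, H⟩ := constraintMap_partialBound hn hα hα1 hν hνn le_rfl hk M
  refine ⟨c, hc, fun τ ψ T hT hτ hψ hfix => ?_⟩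
  obtain ⟨-, hW, -, h⟩ := H τ ψ T hT hτ (hM τ ψ T hT hτ hψ hfix) (hψ.abs_le hν.le)
  rw [hfix] at h
  exact ⟨h, hW⟩

lemma lap_const_add (u : Euc n → ℝ) (a : ℝ) : lap n (fun x => a + u x) = lap n u := by
  have h : ∀ i, pder n (fun x => a + u x) i = pder n u i := fun i => by
    funext x
    rw [pder, fderiv_const_add, pder]
  funext x
  simp only [lap, h]

lemma vacuumSystem_iff (W : Euc n → Euc n) (τ ψ : Euc n → ℝ) :
    VacuumSystem n (fun x => 1 + ψ x) W τ ↔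
      lap n ψ = lichSource W τ ψ ∧ ∀ x i, vLap n W x i = momentumSource τ ψ i x := by
  simp only [VacuumSystem, lap_const_add, funext_iff, lichSource, momentumSource,
    ← Finset.sum_mul]
  refine and_congr (forall_congr' fun x => ?_) (forall_congr' fun x => forall_congr' fun i => ?_)
  · constructor <;> intro h <;> linear_combination h
  · constructor <;> intro h <;> linear_combination h

/-! ### Components of vector fields -/

lemma WBound.apply {k : ℕ} {W : Euc n → Euc n} (h : WBound n k α ν C W) (j : Fin n) :
    WBound n k α ν C fun x => W x j :=
  (h.clm_comp (EuclideanSpace.proj j : Euc n →L[ℝ] ℝ)).mono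
    (mul_le_of_le_one_left h.nonneg (norm_proj_le j))

lemma WBound.of_apply {k : ℕ} {W : Euc n → Euc n} (h : ∀ j, WBound n k α ν C fun x => W x j) :
    WBound n k α ν (n * C) W := by
  have hs := WBound.sum Finset.univ (D := fun _ : Fin n => C) fun j _ =>
    ((h j).clm_comp (ContinuousLinearMap.toSpanSingleton ℝ
      (EuclideanSpace.single j (1:ℝ) : Euc n))).mono (C' := C) (by
        rw [ContinuousLinearMap.norm_toSpanSingleton, norm_single_one, one_mul])
  have e : W = fun x => ∑ j, ContinuousLinearMap.toSpanSingleton ℝ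
      (EuclideanSpace.single j (1:ℝ) : Euc n) (W x j) := by
    funext x
    ext i
    simp [Finset.sum_apply, Pi.single_apply]
  rw [e]
  simpa using hs

lemma exists_holderBound_half_of_wBound (hα : 0 < α) (hα1 : α < 1) (hν : 0 < ν) (k : ℕ) :
    ∃ ε, 0 < ε ∧ ∀ (u : Euc n → ℝ) (C : ℝ), C < ε → WBound n k α ν C u →
      HolderBound n α ν (1 / 2) u := by
  obtain ⟨e, he, E⟩ := WBound.partialBound (n := n) hα k hν.le
  obtain ⟨l, hl, L⟩ := PartialBound.level_le (n := n) hα hα1.le (Nat.zero_le k) hν.le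
  refine ⟨1 / (2 * (l * e)), by positivity, fun u C hC h => ?_⟩
  refine HolderBound.mono (L _ _ (E u C h)) ?_
  rw [lt_div_iff₀ (by positivity)] at hC
  linarith

end

/-- Theorem 3 of the paper. Let `n ≥ 3`, `k ≥ 1`, `α ∈ (0,1)`,
`0 < ν < n−2`. There is `δ > 0` such that for every `τ ∈ C^{k,α}_{−ν/2−1}(ℝⁿ)` with
norm `< δ` there are `ψ ∈ C^{k+2,α}_{−ν}` and `W ∈ C^{k+1,α}_{−ν/2}` with `φ := 1 + ψ`
positive such that `(φ, W, τ)` solves the flat-background conformally formulated vacuum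
constraint system; moreover `(ψ, W)` is the unique such pair of norm `< ε` for some `ε > 0`. -/
theorem small_mean_curvature_solutions
    (n k : ℕ) (α ν : ℝ) (hn : 3 ≤ n) (hk : 1 ≤ k)
    (hα0 : 0 < α) (hα1 : α < 1) (hν0 : 0 < ν) (hν1 : ν < (n:ℝ) - 2) :
    ∃ δ : ℝ, 0 < δ ∧
      ∀ τ : Euc n → ℝ,
        (∃ Cτ : ℝ, Cτ < δ ∧ WBound n k α (ν/2 + 1) Cτ τ) →
        ∃ ψ : Euc n → ℝ, ∃ W : Euc n → Euc n,
          MemW n (k+2) α ν ψ ∧ MemW n (k+1) α (ν/2) W ∧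
          (∀ x : Euc n, 0 < 1 + ψ x) ∧
          VacuumSystem n (fun x => 1 + ψ x) W τ ∧
          ∃ ε : ℝ, 0 < ε ∧
            (∃ C₁ C₂ : ℝ, WBound n (k+2) α ν C₁ ψ ∧ WBound n (k+1) α (ν/2) C₂ W ∧
              C₁ + C₂ < ε) ∧
            ∀ (ψ' : Euc n → ℝ) (W' : Euc n → Euc n),
              (∃ C₁ C₂ : ℝ, WBound n (k+2) α ν C₁ ψ' ∧ WBound n (k+1) α (ν/2) C₂ W' ∧
                C₁ + C₂ < ε) →
              (∀ x : Euc n, 0 < 1 + ψ' x) →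
              VacuumSystem n (fun x => 1 + ψ' x) W' τ →
              ψ' = ψ ∧ W' = W := by
  have hn0 : 0 < n := by omega
  have hn2 : 2 ≤ n := by omega
  have hνn : ν + 2 < n := by linarith
  have hμ : 0 < ν / 2 := by linarith
  have hμn : ν / 2 + 2 < n := by linarith
  obtain ⟨a, ha, A⟩ := WBound.partialBound (n := n) hα0 k (show 0 ≤ ν / 2 + 1 by linarith)
  obtain ⟨r, hr, R⟩ := fixedPoint_partialBound hn0 hα0 hα1 hν0 hνn hk
  obtain ⟨d₁, hd₁, D₁⟩ := PartialBound.wBound (n := n) hα0 (k + 2) hν0.le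
  obtain ⟨d₂, hd₂, D₂⟩ := PartialBound.wBound (n := n) hα0 (k + 1) hμ.le
  obtain ⟨s, hs, S⟩ :=
    constraintMap_partialBound hn0 hα0 hα1 hν0 hνn (Nat.zero_le k) hk (1 / 2)
  obtain ⟨l, hl, L⟩ := PartialBound.level_le (n := n) hα0 hα1.le (Nat.zero_le 2) hν0.le
  obtain ⟨q, hq, Q⟩ := constraintMap_sub_holderBound hn0 hα0 hα1 hν0 hνn hk
  obtain ⟨ε, hε, E⟩ := exists_holderBound_half_of_wBound (n := n) hα0 hα1 hν0 (k + 2)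
  obtain ⟨e₁, -, E₁⟩ := WBound.partialBound (n := n) hα0 (k + 2) hν0.le
  obtain ⟨e₂, -, E₂⟩ := WBound.partialBound (n := n) hα0 (k + 1) hμ.le
  obtain ⟨l₁, -, L₁⟩ :=
    PartialBound.level_le (n := n) hα0 hα1.le (show 2 ≤ k + 2 by omega) hν0.le
  obtain ⟨l₂, -, L₂⟩ :=
    PartialBound.level_le (n := n) hα0 hα1.le (show 2 ≤ k + 1 by omega) hμ.le
  set m := d₁ * r + n * (d₂ * r) with hm
  have hm0 : 0 ≤ m := by positivity
  set K := 1 + 2 * (l * s) + 2 * q + m / ε with hK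
  have hK0 : 0 < K := by positivity
  refine ⟨1 / (a * K), by positivity, fun τ ⟨Cτ, hCτ, hτW⟩ => ?_⟩
  have hτ := A τ Cτ hτW
  set T := a * Cτ with hT
  have hT0 : 0 ≤ T := hτ.nonneg
  have hTK : T * K < 1 := by
    rw [lt_div_iff₀ (by positivity)] at hCτ
    rw [hT]
    linarith
  have p₁ : 0 ≤ T * (l * s) := by positivity
  have p₂ : 0 ≤ T * q := by positivity
  have p₃ : 0 ≤ T * (m / ε) := by positivity
  have hTK' : T + 2 * (T * (l * s)) + 2 * (T * q) + T * (m / ε) < 1 := by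
    rw [hK] at hTK
    linarith
  have hT1 : T ≤ 1 := by linarith
  have hmap : ∀ ψ, HolderBound n α ν (1 / 2) ψ →
      HolderBound n α ν (1 / 2) (constraintMap τ ψ) := fun ψ hψ =>
    HolderBound.mono (L _ _ (S τ ψ T hT1 hτ hψ (hψ.abs_le hν0.le)).2.2.2) (by linarith)
  have hcontr : ∀ ψ₁ ψ₂ D, HolderBound n α ν (1 / 2) ψ₁ → HolderBound n α ν (1 / 2) ψ₂ →
      HolderBound n α ν D (fun x => ψ₁ x - ψ₂ x) →
      HolderBound n α ν (1 / 2 * D) fun x => constraintMap τ ψ₁ x - constraintMap τ ψ₂ x :=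
    fun ψ₁ ψ₂ D h₁ h₂ hD => (Q τ ψ₁ ψ₂ T D hT1 hτ h₁ h₂ hD).mono
      (mul_le_mul_of_nonneg_right (by linarith) (nonneg_of_weighted_bound hD.1))
  obtain ⟨ψ, hψ, hfix⟩ := exists_fixedPoint_of_half_contraction hν0.le hmap hcontr
  obtain ⟨hψk, hWk⟩ := R τ ψ T hT1 hτ hψ hfix
  have hψW := D₁ ψ _ hψk
  have hWW := WBound.of_apply fun j => D₂ _ _ (hWk j)
  obtain ⟨hF, -, hN, -⟩ := S τ ψ T hT1 hτ hψ (hψ.abs_le hν0.le)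
  refine ⟨ψ, momentumField τ ψ, ⟨_, hψW⟩, ⟨_, hWW⟩, fun x => ?_, ?_, ε, hε,
    ⟨_, _, hψW, hWW, ?_⟩, fun ψ' W' ⟨C₁, C₂, hψ', hW', hC⟩ _ hsys => ?_⟩
  · linarith [(abs_le.1 (hψ.abs_le hν0.le x)).1]
  · refine (vacuumSystem_iff _ _ _).2 ⟨?_, vLap_vGreen hn2 hα0 hα1 hμ hμn hF⟩
    have := lap_green hn0 hα0 hν0 hνn hN
    change lap n (constraintMap τ ψ) = _ at this
    rwa [hfix] at this
  · have h : T * (m / ε) < 1 := by linarith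
    rw [← mul_div_assoc, div_lt_one hε, hm] at h
    linarith
  · obtain ⟨h₁, h₂⟩ := (vacuumSystem_iff _ _ _).1 hsys
    have hψ'H := E ψ' C₁ (by linarith [hW'.nonneg]) hψ'
    obtain ⟨hF', -, -, -⟩ := S τ ψ' T hT1 hτ hψ'H (hψ'H.abs_le hν0.le)
    have hWeq : W' = momentumField τ ψ' := eq_vGreen_of_vLap_eq hn2 hα0 hα1 hμ hμn hF'
      (fun j => L₂ _ _ (E₂ _ _ (hW'.apply j))) h₂
    have hfix' : constraintMap τ ψ' = ψ' := by
      rw [constraintMap, ← hWeq, ← h₁]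
      exact green_lap hn0 hα0 hα1 hν0 hνn (L₁ _ _ (E₁ _ _ hψ'))
    obtain rfl := fixedPoint_unique_of_half_contraction hν0.le hcontr hψ'H hψ hfix' hfix
    exact ⟨rfl, hWeq⟩
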